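/- Assume in addition that g ∈ C^{1,γ}[0,κ], and suppose c = c_*(h) > c_#(h) with h ∈ [0,h_*] (i.e. the minimal wavefront is pushed). Then the minimal wavefront profile φ_c satisfies, for an appropriate s₀ ∈ ℝ and some σ > 0: φ_c(t+s₀) = e^{λ₁ t} + O(e^{(λ₁+σ)t}) and φ_c'(t+s₀) = λ₁ e^{λ₁ t} + O(e^{(λ₁+σ)t}) as t → −∞, where λ₁ = λ₁(c) is the larger positive root of χ(z,c) = z² − cz − 1 + g'(0)e^{−zch} = 0. -/

import Mathlib

open Filter Set Asymptotics

noncomputable section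

/-- The wave profile equation `φ'' - cφ' - φ + g(φ(· - ch)) = 0`. -/
def ProfileEq (g : ℝ → ℝ) (c h : ℝ) (φ : ℝ → ℝ) : Prop :=
  ∀ t : ℝ, deriv (deriv φ) t - c * deriv φ t - φ t + g (φ (t - c * h)) = 0

/-- A wavefront profile of speed `c`: positive, `C²`, solving the profile equation,
with `φ(-∞) = 0` and `φ(+∞) = κ`. -/
def Wavefront (g : ℝ → ℝ) (κ c h : ℝ) (φ : ℝ → ℝ) : Prop :=
  (∀ t, 0 < φ t) ∧ ContDiff ℝ 2 φ ∧ ProfileEq g c h φ ∧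
    Tendsto φ atBot (nhds 0) ∧ Tendsto φ atTop (nhds κ)

/-- The characteristic function `χ(z,c) = z² - cz - 1 + b e^{-zch}` at the zero
equilibrium, where `b = g'(0)`. -/
def chi0 (b c h z : ℝ) : ℝ := z ^ 2 - c * z - 1 + b * Real.exp (-(z * c * h))

lemma pf_exists_max {f : ℝ → ℝ} (hf : Continuous f) (h0 : Tendsto f atBot (nhds 0)) {t0 T : ℝ}
    (h1 : 0 < f t0) (h2 : t0 ≤ T) : ∃ t, t ≤ T ∧ 0 < f t ∧ ∀ s, s ≤ T → f s ≤ f t := by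
  have h3 : ∀ᶠ s in atBot, f s < f t0 := h0.eventually (gt_mem_nhds h1)
  obtain ⟨N, hN⟩ := eventually_atBot.1 h3
  have hc : IsCompact (Icc (min N t0) T) := isCompact_Icc
  obtain ⟨t, ht, hmax⟩ := hc.exists_isMaxOn ⟨t0, ⟨min_le_right _ _, h2⟩⟩ hf.continuousOn
  have h4 : f t0 ≤ f t := hmax ⟨min_le_right _ _, h2⟩
  refine ⟨t, ht.2, lt_of_lt_of_le h1 h4, fun s hs => ?_⟩
  by_cases h5 : min N t0 ≤ s
  · exact hmax ⟨h5, hs⟩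
  · push Not at h5
    exact ((hN s (h5.le.trans (min_le_left _ _))).le).trans h4

lemma pf_first_zero {f : ℝ → ℝ} (hf : Continuous f) {a b : ℝ} (hab : a ≤ b)
    (h1 : f a < 0) (h2 : 0 ≤ f b) : ∃ T, a < T ∧ T ≤ b ∧ f T = 0 ∧ ∀ t, a ≤ t → t < T → f t < 0 := by
  have hc : IsCompact (Icc a b ∩ f ⁻¹' (Ici 0)) :=
    isCompact_Icc.inter_right (isClosed_Ici.preimage hf)
  obtain ⟨T, hT, hmin⟩ := hc.exists_isLeast ⟨b, ⟨hab, le_rfl⟩, h2⟩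
  have hlt : ∀ t, a ≤ t → t < T → f t < 0 := by
    intro t h3 h4
    by_contra h5
    push Not at h5
    have := hmin ⟨⟨h3, h4.le.trans hT.1.2⟩, h5⟩
    linarith
  have haT : a < T := by
    rcases hT.1.1.lt_or_eq with h | h
    · exact h
    · exfalso; have := hT.2; rw [← h] at this; simp at this; linarith
  refine ⟨T, haT, hT.1.2, ?_, hlt⟩
  apply le_antisymm _ hT.2
  have : closure (Ico a T) = Icc a T := closure_Ico haT.ne
  have h6 : ∀ t ∈ closure (Ico a T), f t ≤ 0 := by
    intro t ht
    exact closure_minimal (s := Ico a T) (t := f ⁻¹' (Iic 0)) (fun s hs => (hlt s hs.1 hs.2).le)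
      (isClosed_Iic.preimage hf) ht
  exact h6 T (by rw [this]; exact ⟨haT.le, le_rfl⟩)

lemma pf_local_min {y y1 : ℝ → ℝ} {y2 t : ℝ} (h1 : ∀ s, HasDerivAt y (y1 s) s)
    (h2 : HasDerivAt y1 y2 t) (hm : IsLocalMin y t) : y1 t = 0 ∧ 0 ≤ y2 := by
  have hd : deriv y = y1 := funext fun s => (h1 s).deriv
  have hz : y1 t = 0 := by rw [← hd]; exact hm.deriv_eq_zero
  refine ⟨hz, ?_⟩
  by_contra hneg
  push Not at hneg
  have hM : IsLocalMax y t := by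
    apply isLocalMax_of_deriv_deriv_neg
    · rw [hd, h2.deriv]; exact hneg
    · rw [hd, hz]
    · exact (h1 t).continuousAt
  have he : y =ᶠ[nhds t] fun _ => y t := by
    filter_upwards [hm, hM] with s hs1 hs2
    exact le_antisymm hs2 hs1
  have he2 : y1 =ᶠ[nhds t] fun _ => 0 := by
    have := he.deriv
    rw [hd] at this
    simpa using this
  have := (he2.deriv_eq)
  rw [h2.deriv] at this
  simp at this
  linarith

lemma pf_anti {f f' : ℝ → ℝ} {s : Set ℝ} (hs : Convex ℝ s) (h1 : ∀ t ∈ s, HasDerivAt f (f' t) t)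
    (h2 : ∀ t ∈ s, f' t ≤ 0) : AntitoneOn f s := by
  apply antitoneOn_of_deriv_nonpos hs
  · exact fun t ht => (h1 t ht).continuousAt.continuousWithinAt
  · exact fun t ht => (h1 t (interior_subset ht)).differentiableAt.differentiableWithinAt
  · intro t ht
    rw [(h1 t (interior_subset ht)).deriv]; exact h2 t (interior_subset ht)

lemma pf_mono {f f' : ℝ → ℝ} {s : Set ℝ} (hs : Convex ℝ s) (h1 : ∀ t ∈ s, HasDerivAt f (f' t) t)
    (h2 : ∀ t ∈ s, 0 ≤ f' t) : MonotoneOn f s := by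
  apply monotoneOn_of_deriv_nonneg hs
  · exact fun t ht => (h1 t ht).continuousAt.continuousWithinAt
  · exact fun t ht => (h1 t (interior_subset ht)).differentiableAt.differentiableWithinAt
  · intro t ht
    rw [(h1 t (interior_subset ht)).deriv]; exact h2 t (interior_subset ht)

lemma pf_hasDeriv_exp (r t : ℝ) : HasDerivAt (fun t => Real.exp (r * t)) (r * Real.exp (r * t)) t := by
  have h1 : HasDerivAt (fun t : ℝ => r * t) r t := by simpa using (hasDerivAt_id t).const_mul r
  have := h1.exp
  rwa [mul_comm] at this

lemma pf_exp_mul_hasDeriv {Z : ℝ → ℝ} {z1 : ℝ} (r t : ℝ) (h : HasDerivAt Z z1 t) :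
    HasDerivAt (fun t => Real.exp (r * t) * Z t) (Real.exp (r * t) * (r * Z t + z1)) t := by
  have := (pf_hasDeriv_exp r t).mul h
  exact this.congr_deriv (by ring)

lemma pf_barrier_fwd {Z Z1 : ℝ → ℝ} {n T : ℝ} (h1 : ∀ t, T ≤ t → HasDerivAt Z (Z1 t) t)
    (h2 : ∀ t, T ≤ t → Z1 t ≤ n * Z t)
    (h3 : Tendsto (fun t => Real.exp (-n * t) * Z t) atTop (nhds 0)) : ∀ t, T ≤ t → 0 ≤ Z t := by
  have ha : AntitoneOn (fun t => Real.exp (-n * t) * Z t) (Ici T) := by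
    apply pf_anti (convex_Ici T) (fun t ht => pf_exp_mul_hasDeriv (-n) t (h1 t ht))
    intro t ht
    have := h2 t ht
    have h5 := Real.exp_pos (-n * t)
    nlinarith
  intro t ht
  have h4 : 0 ≤ Real.exp (-n * t) * Z t := by
    apply le_of_tendsto h3
    filter_upwards [eventually_ge_atTop t] with s hs
    exact ha ht (le_trans ht hs) hs
  exact nonneg_of_mul_nonneg_right h4 (Real.exp_pos _)

lemma pf_tendsto_exp_top {n : ℝ} (hn : 0 < n) : Tendsto (fun t => Real.exp (-n * t)) atTop (nhds 0) := by
  apply Real.tendsto_exp_atBot.comp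
  exact tendsto_id.const_mul_atTop_of_neg (by linarith)

lemma pf_tendsto_exp_bot {n : ℝ} (hn : 0 < n) : Tendsto (fun t => Real.exp (n * t)) atBot (nhds 0) := by
  apply Real.tendsto_exp_atBot.comp
  exact tendsto_id.const_mul_atBot hn

lemma pf_barrier_fwd_bdd {Z Z1 : ℝ → ℝ} {n T M : ℝ} (hn : 0 < n) (h1 : ∀ t, T ≤ t → HasDerivAt Z (Z1 t) t)
    (h2 : ∀ t, T ≤ t → Z1 t ≤ n * Z t)
    (h3 : ∀ t, T ≤ t → |Z t| ≤ M) : ∀ t, T ≤ t → 0 ≤ Z t := by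
  apply pf_barrier_fwd h1 h2
  apply squeeze_zero_norm' (a := fun t => Real.exp (-n * t) * M)
  · filter_upwards [eventually_ge_atTop T] with t ht
    rw [norm_mul, Real.norm_eq_abs, Real.norm_eq_abs, abs_of_pos (Real.exp_pos _)]
    exact mul_le_mul_of_nonneg_left (h3 t ht) (Real.exp_pos _).le
  · simpa using (pf_tendsto_exp_top hn).mul_const M

/-- backward barrier -/
lemma pf_barrier_bwd {Z Z1 : ℝ → ℝ} {E T : ℝ} (h1 : ∀ t, t ≤ T → HasDerivAt Z (Z1 t) t)
    (h2 : ∀ t, t ≤ T → 0 ≤ Z1 t + E * Z t)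
    (h3 : Tendsto (fun t => Real.exp (E * t) * Z t) atBot (nhds 0)) : ∀ t, t ≤ T → 0 ≤ Z t := by
  have ha : MonotoneOn (fun t => Real.exp (E * t) * Z t) (Iic T) := by
    apply pf_mono (convex_Iic T) (fun t ht => pf_exp_mul_hasDeriv E t (h1 t ht))
    intro t ht
    have := h2 t ht
    have h5 := Real.exp_pos (E * t)
    nlinarith
  intro t ht
  have h4 : 0 ≤ Real.exp (E * t) * Z t := by
    apply le_of_tendsto h3
    filter_upwards [eventually_le_atBot t] with s hs
    exact ha (le_trans hs ht) ht hs
  exact nonneg_of_mul_nonneg_right h4 (Real.exp_pos _)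

/-- properties of the nonlinearity used in the proof -/
structure PfG (g : ℝ → ℝ) (κ θ A δ γ b k L : ℝ) : Prop where
  cont : Continuous g
  nonneg : ∀ x, 0 ≤ x → 0 ≤ g x
  g0 : g 0 = 0
  gk : g κ = κ
  b1 : 1 < b
  k0 : 0 < k
  L0 : 0 < L
  A0 : 0 < A
  γ0 : 0 < γ
  δ0 : 0 < δ
  δθ : δ < θ
  θκ : θ < κ
  gt : ∀ u, 0 < u → u < κ → u < g u
  above : ∀ u, κ ≤ u → g u ≤ κ
  mono : ∀ u w, 0 ≤ u → u ≤ w → w ≤ θ → g u ≤ g w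
  anti : ∀ u w, θ ≤ u → u ≤ w → g w ≤ g u
  Q : ∀ u w, 0 ≤ u → u ≤ w → w ≤ κ → g u + k * u ≤ g w + k * w
  lip : ∀ u w, 0 ≤ u → u ≤ w → w ≤ κ → g w - g u ≤ L * (w - u)
  hol : ∀ u, 0 ≤ u → u ≤ δ → |g u - b * u| ≤ A * u ^ (1 + γ)

/-- scaled front -/
structure PfF (g : ℝ → ℝ) (κ a h : ℝ) (φ φ1 φ2 : ℝ → ℝ) : Prop where
  pos : ∀ t, 0 < φ t
  d1 : ∀ t, HasDerivAt φ (φ1 t) t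
  d2 : ∀ t, HasDerivAt φ1 (φ2 t) t
  eq : ∀ t, a * φ2 t - φ1 t - φ t + g (φ (t - h)) = 0
  bot : Tendsto φ atBot (nhds 0)
  top : Tendsto φ atTop (nhds κ)

def PfP (a b h z : ℝ) : ℝ := a * z ^ 2 - z - 1 + b * Real.exp (-(z * h))

lemma pf_bdd {f : ℝ → ℝ} (hf : Continuous f) {x y : ℝ} (h0 : Tendsto f atBot (nhds x))
    (h1 : Tendsto f atTop (nhds y)) : ∃ M, 0 < M ∧ ∀ t, |f t| ≤ M := by
  obtain ⟨a, ha⟩ := eventually_atBot.1 ((h0.abs).eventually (gt_mem_nhds (lt_add_one |x|)))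
  obtain ⟨b, hb⟩ := eventually_atTop.1 ((h1.abs).eventually (gt_mem_nhds (lt_add_one |y|)))
  obtain ⟨C, hC⟩ := (isCompact_Icc (a := a) (b := b)).exists_bound_of_continuousOn hf.continuousOn
  refine ⟨max C 0 + |x| + |y| + 1, by positivity, fun t => ?_⟩
  have e1 := le_max_left C 0
  have e2 := le_max_right C 0
  have e3 := abs_nonneg x
  have e4 := abs_nonneg y
  by_cases h2 : t ≤ a
  · linarith [ha t h2]
  · by_cases h3 : b ≤ t
    · linarith [hb t h3]
    · push Not at h2 h3
      have := hC t ⟨h2.le, h3.le⟩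
      rw [Real.norm_eq_abs] at this
      linarith

lemma pf_d1_aux {a M N : ℝ} (ha : 0 < a) {y y1 y2 f : ℝ → ℝ} (h1 : ∀ t, HasDerivAt y (y1 t) t)
    (h2 : ∀ t, HasDerivAt y1 (y2 t) t) (he : ∀ t, a * y2 t = y1 t + f t) (hM : ∀ t, |f t| ≤ M)
    (hN : ∀ t, |y t| ≤ N) : ∀ t, y1 t ≤ M := by
  intro t0
  by_contra hc
  push Not at hc
  have hmono : MonotoneOn (fun t => Real.exp (-(1/a) * t) * (y1 t - M)) univ := by
    apply pf_mono convex_univ (fun t _ => pf_exp_mul_hasDeriv _ t ((h2 t).sub_const M))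
    intro t _
    apply mul_nonneg (Real.exp_pos _).le
    have e := (abs_le.1 (hM t)).1
    have : y2 t = (y1 t + f t) / a := by field_simp; linarith [he t]
    rw [this]
    have : -(1/a) * (y1 t - M) + (y1 t + f t) / a = (f t + M) / a := by ring
    rw [this]
    apply div_nonneg _ ha.le
    linarith
  have hge : ∀ t, t0 ≤ t → y1 t0 ≤ y1 t := by
    intro t ht
    have := hmono (mem_univ t0) (mem_univ t) ht
    simp only at this
    have e1 : Real.exp (-(1/a) * t) ≤ Real.exp (-(1/a) * t0) := by
      apply Real.exp_le_exp.2
      have : 0 < 1 / a := by positivity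
      nlinarith
    have e2 := Real.exp_pos (-(1/a) * t)
    have e3 : Real.exp (-(1/a) * t) * (y1 t0 - M) ≤ Real.exp (-(1/a) * t) * (y1 t - M) :=
      (mul_le_mul_of_nonneg_right e1 (by linarith)).trans this
    have := le_of_mul_le_mul_left e3 e2
    linarith
  have hM0 : 0 ≤ M := (abs_nonneg _).trans (hM t0)
  have hp : 0 < y1 t0 := by linarith
  have hlin : MonotoneOn (fun t => y t - y1 t0 * t) (Ici t0) := by
    apply pf_mono (f' := fun t => y1 t - y1 t0) (convex_Ici _)
    · intro t _
      exact ((h1 t).sub ((hasDerivAt_id t).const_mul (y1 t0))).congr_deriv (by simp)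
    · intro t ht
      linarith [hge t ht]
  have hN0 : 0 ≤ N := (abs_nonneg _).trans (hN t0)
  have ht1 : t0 ≤ t0 + (2 * N + 1) / y1 t0 := by
    have : 0 ≤ (2 * N + 1) / y1 t0 := by positivity
    linarith
  have := hlin (mem_Ici.2 le_rfl) (mem_Ici.2 ht1) ht1
  simp only at this
  have e1 : y1 t0 * (t0 + (2 * N + 1) / y1 t0) = y1 t0 * t0 + (2 * N + 1) := by field_simp
  have e2 := abs_le.1 (hN t0)
  have e3 := abs_le.1 (hN (t0 + (2 * N + 1) / y1 t0))
  linarith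

lemma pf_d1_bdd {a M N : ℝ} (ha : 0 < a) {y y1 y2 f : ℝ → ℝ} (h1 : ∀ t, HasDerivAt y (y1 t) t)
    (h2 : ∀ t, HasDerivAt y1 (y2 t) t) (he : ∀ t, a * y2 t = y1 t + f t) (hM : ∀ t, |f t| ≤ M)
    (hN : ∀ t, |y t| ≤ N) : ∀ t, |y1 t| ≤ M := by
  intro t
  rw [abs_le]
  constructor
  · have := pf_d1_aux (y := fun t => - y t) (y1 := fun t => - y1 t) (y2 := fun t => - y2 t)
      (f := fun t => - f t) (M := M) (N := N) ha (fun t => (h1 t).neg) (fun t => (h2 t).neg)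
      (fun t => by linarith [he t]) (fun t => by simpa using hM t) (fun t => by simpa using hN t) t
    linarith
  · exact pf_d1_aux ha h1 h2 he hM hN t

section
variable {g : ℝ → ℝ} {κ θ A δ γ b k L a h m : ℝ} {φ φ1 φ2 : ℝ → ℝ}

lemma PfF.cont (F : PfF g κ a h φ φ1 φ2) : Continuous φ :=
  continuous_iff_continuousAt.2 fun t => (F.d1 t).continuousAt

lemma PfF.cont1 (F : PfF g κ a h φ φ1 φ2) : Continuous φ1 :=
  continuous_iff_continuousAt.2 fun t => (F.d2 t).continuousAt

/-- boundedness of a front together with its derivatives -/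
lemma PfF.bdd (F : PfF g κ a h φ φ1 φ2) (hg : Continuous g) (ha : 0 < a) :
    ∃ M, 0 < M ∧ ∀ t, φ t ≤ M ∧ |φ1 t| ≤ M ∧ |φ2 t| ≤ M ∧ |g (φ t)| ≤ M := by
  obtain ⟨M0, hM0, hb⟩ := pf_bdd F.cont F.bot F.top
  obtain ⟨C, hC0, hC⟩ := pf_bdd (hg.comp F.cont) ((hg.tendsto 0).comp F.bot) ((hg.tendsto κ).comp F.top)
  simp only [Function.comp] at hC
  have h1 : ∀ t, |φ1 t| ≤ M0 + C := by
    apply pf_d1_bdd (f := fun t => φ t - g (φ (t - h))) (N := M0) ha F.d1 F.d2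
    · intro t; linarith [F.eq t]
    · intro t
      have := abs_sub (φ t) (g (φ (t - h)))
      linarith [hb t, hC (t - h)]
    · exact hb
  have h2 : ∀ t, |φ2 t| ≤ (2 * (M0 + C)) / a := by
    intro t
    have e : φ2 t = (φ1 t + (φ t - g (φ (t - h)))) / a := by
      field_simp; linarith [F.eq t]
    rw [e, abs_div, abs_of_pos ha]
    apply div_le_div_of_nonneg_right _ ha.le
    have e1 := abs_add_le (φ1 t) (φ t - g (φ (t - h)))
    have e2 := abs_sub (φ t) (g (φ (t - h)))
    linarith [hb t, hC (t - h), h1 t]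
  have hp : 0 < (2 * (M0 + C)) / a := by positivity
  refine ⟨M0 + C + (2 * (M0 + C)) / a, by positivity, fun t => ⟨?_, ?_, ?_, ?_⟩⟩
  · have := le_abs_self (φ t); linarith [hb t]
  · linarith [h1 t]
  · linarith [h2 t]
  · linarith [hC t]

lemma PfF.V_low (F : PfF g κ a h φ φ1 φ2) (hg : Continuous g)
    (ha : 0 < a) (hm : 0 < m) (T v : ℝ)
    (hv : ∀ t, T ≤ t → (a * m ^ 2 + m) * v ≤ (a * m ^ 2 + m - 1) * φ t + g (φ (t - h))) :
    ∀ t, T ≤ t → m * v ≤ φ1 t + m * φ t := by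
  obtain ⟨M, hM, hb⟩ := F.bdd hg ha
  have := pf_barrier_fwd_bdd (Z := fun t => φ1 t + m * φ t - m * v) (n := 1 / a + m)
    (Z1 := fun t => φ2 t + m * φ1 t) (T := T) (M := M + m * M + m * |v|)
    (by positivity) (fun t _ => ((F.d2 t).add ((F.d1 t).const_mul m)).sub_const _) ?_ ?_
  · intro t ht; linarith [this t ht]
  · intro t ht
    have e : φ2 t = (φ1 t + (φ t - g (φ (t - h)))) / a := by
      field_simp; linarith [F.eq t]
    rw [e]
    have e2 : (1 / a + m) * (φ1 t + m * φ t - m * v) - ((φ1 t + (φ t - g (φ (t - h)))) / a + m * φ1 t)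
      = ((a * m ^ 2 + m - 1) * φ t + g (φ (t - h)) - (a * m ^ 2 + m) * v) / a := by
      field_simp; ring
    have := div_nonneg (sub_nonneg.2 (hv t ht)) ha.le
    linarith
  · intro t ht
    obtain ⟨e1, e2, e3, e4⟩ := hb t
    have e5 := abs_sub (φ1 t + m * φ t) (m * v)
    have e6 := abs_add_le (φ1 t) (m * φ t)
    rw [abs_mul m v, abs_of_pos hm] at e5
    rw [abs_mul m, abs_of_pos hm, abs_of_pos (F.pos t)] at e6
    have : m * φ t ≤ m * M := by gcongr
    linarith

lemma PfF.V_nonneg (F : PfF g κ a h φ φ1 φ2) (hg : Continuous g) (hg0 : ∀ x, 0 ≤ x → 0 ≤ g x)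
    (ha : 0 < a) (hm : 0 < m) (hK : 0 ≤ a * m ^ 2 + m - 1) : ∀ t, 0 ≤ φ1 t + m * φ t := by
  intro t
  have := F.V_low hg ha hm t 0 (fun s _ => by
    have := mul_nonneg hK (F.pos s).le
    have := hg0 _ (F.pos (s - h)).le
    linarith) t le_rfl
  linarith

/-- a front does not reach `κ` -/
lemma PfF.lt_kappa (F : PfF g κ a h φ φ1 φ2) (G : PfG g κ θ A δ γ b k L)
    (ha : 0 < a) (hm : 0 < m) (hh : 0 ≤ h)
    (hK : k * Real.exp (m * h) < a * m ^ 2 + m - 1) : ∀ t, φ t < κ := by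
  have hκ : 0 < κ := by linarith [G.δ0, G.δθ, G.θκ]
  obtain ⟨M, hM, hb⟩ := F.bdd G.cont ha
  by_contra hcon
  push Not at hcon
  obtain ⟨tb, htb⟩ := hcon
  -- x = κ - φ
  obtain ⟨ta, hta⟩ := eventually_atBot.1 (F.bot.eventually (gt_mem_nhds hκ))
  have hcx : Continuous (fun t => φ t - κ) := F.cont.sub continuous_const
  obtain ⟨t1, h1a, h1b, h1z, h1n⟩ := pf_first_zero hcx (min_le_right ta tb)
    (by linarith [hta _ (min_le_left ta tb)]) (by linarith)
  have hlt : ∀ t, t < t1 → φ t < κ := by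
    intro t ht
    by_cases h2 : min ta tb ≤ t
    · linarith [h1n t h2 ht]
    · push Not at h2
      exact hta t (h2.le.trans (min_le_left _ _))
  -- w = e^{mt} x
  have hwc : Continuous (fun t => Real.exp (m * t) * (κ - φ t)) := by
    have := F.cont
    fun_prop
  have hw0 : Tendsto (fun t => Real.exp (m * t) * (κ - φ t)) atBot (nhds 0) := by
    have := (pf_tendsto_exp_bot hm).mul ((tendsto_const_nhds (x := κ)).sub F.bot)
    simpa using this
  have hx1 : φ t1 = κ := by linarith
  obtain ⟨t2, h2a, h2p, h2m⟩ := pf_exists_max hwc hw0 (t0 := t1 - 1) (T := t1)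
    (mul_pos (Real.exp_pos _) (by linarith [hlt (t1 - 1) (by linarith)])) (by linarith)
  have h2lt : t2 < t1 := by
    rcases h2a.lt_or_eq with h | h
    · exact h
    · rw [h, hx1] at h2p; simp at h2p
  have h2d : -φ1 t2 + m * (κ - φ t2) = 0 := by
    have hloc : IsLocalMax (fun t => Real.exp (m * t) * (κ - φ t)) t2 := by
      filter_upwards [Iio_mem_nhds h2lt] with s hs
      exact h2m s (le_of_lt hs)
    have hd := pf_exp_mul_hasDeriv m t2 ((F.d1 t2).const_sub κ)
    have := hloc.hasDerivAt_eq_zero hd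
    rcases mul_eq_zero.1 this with h | h
    · exact absurd h (Real.exp_pos _).ne'
    · linarith
  set w2 := Real.exp (m * t2) * (κ - φ t2) with hw2
  -- ν
  obtain ⟨ν, hν0, hν⟩ : ∃ ν, 0 < ν ∧ a * ν ^ 2 + ν - 1 = 0 := by
    have := intermediate_value_Icc (a := (0:ℝ)) (b := 1) zero_le_one
      (f := fun ν => a * ν ^ 2 + ν - 1) (by fun_prop)
    obtain ⟨ν, hν, e⟩ := this (show (0:ℝ) ∈ _ by constructor <;> norm_num; exact ha.le)
    refine ⟨ν, ?_, e⟩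
    rcases hν.1.lt_or_eq with h | h
    · exact h
    · simp only at e; rw [← h] at e; norm_num at e
  set l := 1 / a + ν with hl
  have hal : a * l = 1 + a * ν := by rw [hl]; field_simp
  have hl0 : 0 < l := by positivity
  set p : ℝ → ℝ := fun t => -φ1 t + ν * (κ - φ t) with hp
  have hpc : Continuous p := by
    have := F.cont
    have := F.cont1
    fun_prop
  have hpd : ∀ t, HasDerivAt p (-φ2 t + ν * (-φ1 t)) t := fun t =>
    (F.d2 t).neg.add (((F.d1 t).const_sub κ).const_mul ν)
  have hpe : ∀ t, a * (-l * p t + (-φ2 t + ν * (-φ1 t))) = g (φ (t - h)) - κ := by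
    intro t
    have e := F.eq t
    have : a * (-l * p t + (-φ2 t + ν * (-φ1 t))) =
      -(a * l) * p t - a * φ2 t - a * ν * φ1 t := by ring
    rw [this, hal, hp]
    simp only
    have e3 : κ - φ t = (a * ν ^ 2 + ν) * (κ - φ t) := by
      have : a * ν ^ 2 + ν = 1 := by linarith
      rw [this]; ring
    linarith
  have hml : a * (m - ν) * (m + l) = a * m ^ 2 + m - 1 := by
    have : a * (m - ν) * (m + l) = (m - ν) * (a * m + a * l) := by ring
    rw [this, hal]; linarith
  -- Y
  set c0 := k * Real.exp (m * h) * w2 / (a * (m + l)) with hc0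
  have hYa : AntitoneOn (fun t => Real.exp (-l * t) * p t + c0 * Real.exp (-(m + l) * t)) (Iic (t1 + h)) := by
    apply pf_anti (convex_Iic _)
      (fun t _ => (pf_exp_mul_hasDeriv (-l) t (hpd t)).add ((pf_hasDeriv_exp (-(m + l)) t).const_mul c0))
    intro t ht
    have ht' : t - h ≤ t1 := by have := mem_Iic.1 ht; linarith
    have e1 := hpe t
    have hle : φ (t - h) ≤ κ := by
      rcases ht'.lt_or_eq with h | h
      · exact (hlt _ h).le
      · rw [h, hx1]
    have e2 := G.Q (φ (t - h)) κ (F.pos _).le hle le_rfl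
    rw [G.gk] at e2
    have e3 := h2m (t - h) ht'
    have e4 : κ - φ (t - h) ≤ w2 * Real.exp (-m * (t - h)) := by
      have : κ - φ (t - h) = Real.exp (-m * (t - h)) * (Real.exp (m * (t - h)) * (κ - φ (t - h))) := by
        rw [← mul_assoc, ← Real.exp_add]; ring_nf; simp
      rw [this, mul_comm]
      exact mul_le_mul_of_nonneg_right e3 (Real.exp_pos _).le
    have e5 : a * (-l * p t + (-φ2 t + ν * (-φ1 t))) ≤ k * (w2 * Real.exp (-m * (t - h))) := by
      rw [e1]
      have := mul_le_mul_of_nonneg_left e4 G.k0.le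
      linarith
    have e6 : c0 * (-(m + l) * Real.exp (-(m + l) * t)) =
        - (Real.exp (-l * t) * (k * (w2 * Real.exp (-m * (t - h))) / a)) := by
      have q1 : Real.exp (-(m + l) * t) = Real.exp (-l * t) * Real.exp (-m * t) := by
        rw [← Real.exp_add]; ring_nf
      have q2 : Real.exp (-m * (t - h)) = Real.exp (-m * t) * Real.exp (m * h) := by
        rw [← Real.exp_add]; ring_nf
      rw [q1, q2, hc0]
      have : m + l ≠ 0 := by positivity
      field_simp
    rw [e6]
    have e7 : -l * p t + (-φ2 t + ν * (-φ1 t)) ≤ k * (w2 * Real.exp (-m * (t - h))) / a := by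
      rw [le_div_iff₀ ha]; linarith
    have := mul_le_mul_of_nonneg_left e7 (Real.exp_pos (-l * t)).le
    linarith
  have hc0p : 0 ≤ c0 := by
    have := G.k0
    positivity
  have hY2 : Real.exp (-l * t2) * p t2 + c0 * Real.exp (-(m + l) * t2) < 0 := by
    have e1 : p t2 = -(m - ν) * (κ - φ t2) := by rw [hp]; simp only; linarith
    have e2 : c0 * Real.exp (-(m + l) * t2) = Real.exp (-l * t2) * ((κ - φ t2) * (k * Real.exp (m * h) / (a * (m + l)))) := by
      have q1 : Real.exp (-(m + l) * t2) = Real.exp (-l * t2) * Real.exp (-m * t2) := by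
        rw [← Real.exp_add]; ring_nf
      have q2 : Real.exp (-m * t2) * Real.exp (m * t2) = 1 := by
        rw [← Real.exp_add]; simp
      rw [hc0, q1, hw2]
      calc _ = Real.exp (-l * t2) * ((κ - φ t2) * (k * Real.exp (m * h) / (a * (m + l)))) * (Real.exp (-m * t2) * Real.exp (m * t2)) := by ring
        _ = _ := by rw [q2, mul_one]
    rw [e1, e2, ← mul_add]
    apply mul_neg_of_pos_of_neg (Real.exp_pos _)
    have e3 : 0 < κ - φ t2 := by linarith [hlt t2 h2lt]
    have e4 : k * Real.exp (m * h) / (a * (m + l)) < m - ν := by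
      rw [div_lt_iff₀ (by positivity)]
      linarith
    nlinarith
  have hpneg : ∀ t, t2 ≤ t → t ≤ t1 + h → p t < 0 := by
    intro t hta htb
    have e1 := hYa (mem_Iic.2 (by linarith)) (mem_Iic.2 htb) hta
    simp only at e1
    have e2 := mul_nonneg hc0p (Real.exp_pos (-(m + l) * t)).le
    have e3 : Real.exp (-l * t) * p t < 0 := by linarith
    by_contra hc
    push Not at hc
    have := mul_nonneg (Real.exp_pos (-l * t)).le hc
    linarith
  -- sign of x when p negative
  have hxneg : ∀ T, (∀ t, t1 ≤ t → t < T → p t < 0) → ∀ t, t1 ≤ t → t ≤ T → κ ≤ φ t := by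
    intro T hT t hta htb
    have : AntitoneOn (fun t => Real.exp (ν * t) * (κ - φ t)) (Icc t1 t) := by
      apply antitoneOn_of_deriv_nonpos (convex_Icc _ _)
      · have := F.cont
        fun_prop
      · intro s _
        exact (pf_exp_mul_hasDeriv ν s ((F.d1 s).const_sub κ)).differentiableAt.differentiableWithinAt
      · intro s hs
        rw [interior_Icc] at hs
        rw [(pf_exp_mul_hasDeriv ν s ((F.d1 s).const_sub κ)).deriv]
        have := hT s hs.1.le (by linarith [hs.2])
        simp only [hp] at this
        apply mul_nonpos_of_nonneg_of_nonpos (Real.exp_pos _).le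
        linarith
    have e := this (left_mem_Icc.2 hta) (right_mem_Icc.2 hta) hta
    simp only at e
    rw [hx1] at e
    simp only [sub_self, mul_zero] at e
    by_contra hc
    push Not at hc
    have := mul_pos (Real.exp_pos (ν * t)) (sub_pos.2 hc)
    linarith
  have hanti : ∀ T, (∀ t, t1 ≤ t → t < T → p t < 0) →
      AntitoneOn (fun t => Real.exp (-l * t) * p t) (Icc (t1 + h) T) := by
    intro T hT
    apply pf_anti (convex_Icc _ _) (fun t _ => pf_exp_mul_hasDeriv (-l) t (hpd t))
    intro t ht
    apply mul_nonpos_of_nonneg_of_nonpos (Real.exp_pos _).le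
    have e1 := hpe t
    have e2 := G.above _ (hxneg T hT (t - h) (by linarith [ht.1]) (by linarith [ht.2]))
    have : a * (-l * p t + (-φ2 t + ν * (-φ1 t))) ≤ 0 := by linarith
    exact nonpos_of_mul_nonpos_right this ha
  have hall : ∀ t, t1 ≤ t → p t < 0 := by
    by_contra hc
    push Not at hc
    obtain ⟨tq, hq1, hq2⟩ := hc
    obtain ⟨T, hT1, hT2, hT3, hT4⟩ := pf_first_zero hpc hq1 (hpneg t1 h2a (by linarith)) hq2
    have hTh : t1 + h < T := by
      by_contra hc
      push Not at hc
      have := hpneg T (by linarith) hc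
      linarith
    have := hanti T hT4 (left_mem_Icc.2 hTh.le) (right_mem_Icc.2 hTh.le) hTh.le
    simp only at this
    rw [hT3] at this
    have e := hpneg (t1 + h) (by linarith) le_rfl
    have := mul_neg_of_pos_of_neg (Real.exp_pos (-l * (t1 + h))) e
    linarith
  -- contradiction with boundedness
  have hη := hpneg (t1 + h) (by linarith) le_rfl
  have hlim : Tendsto (fun t => Real.exp (-l * t) * p t) atTop (nhds 0) := by
    apply squeeze_zero_norm' (a := fun t => Real.exp (-l * t) * (M + ν * (κ + M)))
    · filter_upwards with t
      rw [norm_mul, Real.norm_eq_abs, Real.norm_eq_abs, abs_of_pos (Real.exp_pos _)]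
      apply mul_le_mul_of_nonneg_left _ (Real.exp_pos _).le
      obtain ⟨q1, q2, q3, q4⟩ := hb t
      rw [hp]
      have e1 := abs_add_le (-φ1 t) (ν * (κ - φ t))
      rw [abs_neg, abs_mul, abs_of_pos hν0] at e1
      have e2 : |κ - φ t| ≤ κ + M := by
        rw [abs_le]; constructor <;> linarith [F.pos t]
      have := mul_le_mul_of_nonneg_left e2 hν0.le
      simp only
      linarith
    · simpa using (pf_tendsto_exp_top hl0).mul_const (M + ν * (κ + M))
  have : 0 ≤ Real.exp (-l * (t1 + h)) * p (t1 + h) := by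
    apply le_of_tendsto hlim
    filter_upwards [eventually_ge_atTop (t1 + h)] with t ht
    exact hanti t (fun s hs _ => hall s hs) (left_mem_Icc.2 ht) (right_mem_Icc.2 ht) ht
  have := mul_neg_of_pos_of_neg (Real.exp_pos (-l * (t1 + h))) hη
  linarith

end

section
variable {g : ℝ → ℝ} {κ θ A δ γ b k L a h m : ℝ} {φ φ1 φ2 : ℝ → ℝ}

lemma PfG.small (G : PfG g κ θ A δ γ b k L) {ε : ℝ} (hε : 0 < ε) :
    ∃ d, 0 < d ∧ d ≤ δ ∧ A * d ^ γ ≤ ε := by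
  have h1 : Tendsto (fun u : ℝ => A * u ^ γ) (nhdsWithin 0 (Ioi 0)) (nhds 0) := by
    have : ContinuousAt (fun u : ℝ => A * u ^ γ) 0 :=
      (Real.continuousAt_rpow_const 0 γ (Or.inr G.γ0.le)).const_mul A
    have h2 := this.tendsto
    simp only [Real.zero_rpow G.γ0.ne', mul_zero] at h2
    exact h2.mono_left nhdsWithin_le_nhds
  have h2 : ∀ᶠ u in nhdsWithin (0:ℝ) (Ioi 0), A * u ^ γ < ε := h1.eventually (gt_mem_nhds hε)
  have h3 : ∀ᶠ u in nhdsWithin (0:ℝ) (Ioi 0), u ∈ Ioc 0 δ := Ioc_mem_nhdsGT G.δ0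
  obtain ⟨d, hd1, hd2⟩ := (h2.and h3).exists
  exact ⟨d, hd2.1, hd2.2, hd1.le⟩

lemma PfG.hol2 (G : PfG g κ θ A δ γ b k L) {d ε u : ℝ} (hd : d ≤ δ) (hA : A * d ^ γ ≤ ε)
    (hu : 0 ≤ u) (hud : u ≤ d) : |g u - b * u| ≤ ε * u := by
  have h1 := G.hol u hu (hud.trans hd)
  have h2 : u ^ (1 + γ) = u * u ^ γ := by
    rcases hu.lt_or_eq with h | h
    · rw [Real.rpow_add h, Real.rpow_one]
    · rw [← h, Real.zero_rpow (by linarith [G.γ0]), zero_mul]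
  have h3 : u ^ γ ≤ d ^ γ := Real.rpow_le_rpow hu hud G.γ0.le
  have h4 : A * u ^ γ ≤ ε := (mul_le_mul_of_nonneg_left h3 G.A0.le).trans hA
  rw [h2] at h1
  have := mul_le_mul_of_nonneg_right h4 hu
  linarith

/-- touching lemma -/
lemma PfF.touch (F : PfF g κ a h φ φ1 φ2) (ha : 0 < a) {W W1 W2 : ℝ → ℝ} {ρ t b' : ℝ}
    (h1 : ∀ s, HasDerivAt W (W1 s) s) (h2 : ∀ s, HasDerivAt W1 (W2 s) s) (hρ : 0 < ρ)
    (hloc : ∀ᶠ s in nhds t, φ s ≤ ρ * W s) (heq : φ t = ρ * W t)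
    (hd : φ (t - h) ≤ ρ * W (t - h)) (hsup : a * W2 t - W1 t - W t + b' * W (t - h) < 0)
    (hb : 0 ≤ b') (hg : g (φ (t - h)) ≤ b' * φ (t - h)) : False := by
  have hmin : IsLocalMin (fun s => ρ * W s - φ s) t := by
    filter_upwards [hloc] with s hs
    rw [heq]; linarith
  obtain ⟨e1, e2⟩ := pf_local_min (y1 := fun s => ρ * W1 s - φ1 s) (y2 := ρ * W2 t - φ2 t)
    (fun s => ((h1 s).const_mul ρ).sub (F.d1 s)) (((h2 t).const_mul ρ).sub (F.d2 t)) hmin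
  have e3 := F.eq t
  have e4 := mul_nonneg ha.le e2
  have e5 := mul_neg_of_pos_of_neg hρ hsup
  have e6 := mul_le_mul_of_nonneg_left hd hb
  nlinarith

lemma pf_exp_super (z t : ℝ) : a * (z * (z * Real.exp (z * t))) - z * Real.exp (z * t) - Real.exp (z * t)
    + b * Real.exp (z * (t - h)) = PfP a b h z * Real.exp (z * t) := by
  have : Real.exp (z * (t - h)) = Real.exp (-(z * h)) * Real.exp (z * t) := by
    rw [← Real.exp_add]; ring_nf
  rw [this, PfP]; ring

lemma PfF.exp_mono (F : PfF g κ a h φ φ1 φ2) (hV : ∀ t, 0 ≤ φ1 t + m * φ t) :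
    Monotone (fun t => Real.exp (m * t) * φ t) := by
  have : MonotoneOn (fun t => Real.exp (m * t) * φ t) univ := by
    apply pf_mono convex_univ (fun t _ => pf_exp_mul_hasDeriv m t (F.d1 t))
    intro t _
    apply mul_nonneg (Real.exp_pos _).le
    linarith [hV t]
  exact monotoneOn_univ.1 this

lemma pf_div_exp {x B z t : ℝ} : x ≤ B * Real.exp (z * t) ↔ Real.exp (-z * t) * x ≤ B := by
  have : Real.exp (-z * t) * Real.exp (z * t) = 1 := by rw [← Real.exp_add]; simp
  constructor
  · intro h
    have := mul_le_mul_of_nonneg_left h (Real.exp_pos (-z * t)).le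
    calc _ ≤ _ := this
      _ = B * (Real.exp (-z * t) * Real.exp (z * t)) := by ring
      _ = B := by rw [‹Real.exp (-z * t) * Real.exp (z * t) = 1›, mul_one]
  · intro h
    have := mul_le_mul_of_nonneg_right h (Real.exp_pos (z * t)).le
    calc x = Real.exp (-z * t) * Real.exp (z * t) * x := by rw [‹Real.exp (-z * t) * Real.exp (z * t) = 1›, one_mul]
      _ = Real.exp (-z * t) * x * Real.exp (z * t) := by ring
      _ ≤ _ := this

lemma PfF.dich (F : PfF g κ a h φ φ1 φ2) (ha : 0 < a) (hh : 0 ≤ h) (hm : 0 < m)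
    (hV : ∀ t, 0 ≤ φ1 t + m * φ t) {b' z B T0 : ℝ} (hb : 0 ≤ b') (hz : 0 < z) (hB : 0 < B)
    (hP : PfP a b' h z < 0) (hT0 : ∀ t, t ≤ T0 → g (φ t) ≤ b' * φ t)
    (hf : ∃ᶠ t in atBot, φ t ≤ B * Real.exp (z * t)) :
    ∃ B' T, 0 < B' ∧ ∀ t, t ≤ T → φ t ≤ B' * Real.exp (z * t) := by
  obtain ⟨ta, hta1, hta2⟩ := frequently_atBot.1 hf T0
  set B' := B * Real.exp ((m + z) * h) with hB'
  have hBB : B ≤ B' := by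
    rw [hB']; apply le_mul_of_one_le_right hB.le
    apply Real.one_le_exp; positivity
  refine ⟨B', ta, by positivity, ?_⟩
  by_contra hcon
  push Not at hcon
  obtain ⟨t, ht1, ht2⟩ := hcon
  obtain ⟨tb, htb1, htb2⟩ := frequently_atBot.1 hf (t - 1)
  have hwin : ∀ s, tb - h ≤ s → s ≤ tb → φ s ≤ B' * Real.exp (z * s) := by
    intro s hs1 hs2
    have e1 := F.exp_mono hV hs2
    simp only at e1
    have e2 : φ s ≤ Real.exp (m * (tb - s)) * φ tb := by
      have q : Real.exp (m * tb) = Real.exp (m * s) * Real.exp (m * (tb - s)) := by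
        rw [← Real.exp_add]; ring_nf
      rw [q, mul_assoc] at e1
      exact le_of_mul_le_mul_left e1 (Real.exp_pos _)
    calc φ s ≤ Real.exp (m * (tb - s)) * φ tb := e2
      _ ≤ Real.exp (m * (tb - s)) * (B * Real.exp (z * tb)) := by gcongr
      _ = B * (Real.exp ((m + z) * (tb - s)) * Real.exp (z * s)) := by
        have : Real.exp (m * (tb - s)) * Real.exp (z * tb) = Real.exp ((m + z) * (tb - s)) * Real.exp (z * s) := by
          rw [← Real.exp_add, ← Real.exp_add]; ring_nf
        rw [← this]; ring
      _ ≤ B * (Real.exp ((m + z) * h) * Real.exp (z * s)) := by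
        gcongr; linarith
      _ = _ := by rw [hB']; ring
  have hfc : Continuous (fun s => Real.exp (-z * s) * φ s) := by have := F.cont; fun_prop
  obtain ⟨ts, hts, hmax⟩ := (isCompact_Icc (a := tb - h) (b := ta)).exists_isMaxOn
    ⟨t, by constructor <;> linarith⟩ hfc.continuousOn
  set ρ := Real.exp (-z * ts) * φ ts with hρ
  have hρB : B' < ρ := by
    have e1 : Real.exp (-z * t) * φ t ≤ ρ := hmax ⟨by linarith, by linarith⟩
    by_contra hc
    push Not at hc
    exact absurd (pf_div_exp.2 (e1.trans hc)) (not_le.2 ht2)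
  have h1 : tb < ts := by
    by_contra hc
    push Not at hc
    have := pf_div_exp.1 (hwin ts hts.1 hc)
    linarith
  have h2 : ts < ta := by
    rcases hts.2.lt_or_eq with h | h
    · exact h
    · have := pf_div_exp.1 (hta2)
      rw [← h] at this; linarith
  have hle : ∀ s, tb - h ≤ s → s ≤ ta → φ s ≤ ρ * Real.exp (z * s) := by
    intro s hs1 hs2
    exact pf_div_exp.2 (hmax ⟨hs1, hs2⟩)
  refine F.touch (W := fun s => Real.exp (z * s)) (b' := b') (ρ := ρ) (t := ts) ha (fun s => pf_hasDeriv_exp z s)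
    (fun s => (pf_hasDeriv_exp z s).const_mul z) (by have : 0 < B' := by positivity
                                                     linarith) ?_ ?_ ?_ ?_ hb ?_
  · filter_upwards [Ioo_mem_nhds h1 h2] with s hs
    exact hle s (by linarith [hs.1]) hs.2.le
  · rw [hρ]
    have : Real.exp (-z * ts) * Real.exp (z * ts) = 1 := by rw [← Real.exp_add]; simp
    calc φ ts = Real.exp (-z * ts) * Real.exp (z * ts) * φ ts := by rw [this, one_mul]
      _ = _ := by ring
  · exact hle _ (by linarith) (by linarith)
  · rw [pf_exp_super]; exact mul_neg_of_neg_of_pos hP (Real.exp_pos _)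
  · exact hT0 _ (by linarith)

lemma PfF.improve (F : PfF g κ a h φ φ1 φ2) (ha : 0 < a) (hh : 0 ≤ h) {b' z za z' C0 T0 T1 : ℝ} (hb : 0 ≤ b')
    (hza : za < z)
    (hPa : PfP a b' h za < 0) (hP' : PfP a b' h z' < 0) (hT0 : ∀ t, t ≤ T0 → g (φ t) ≤ b' * φ t)
    (hO : ∀ t, t ≤ T1 → φ t ≤ C0 * Real.exp (z * t)) :
    ∃ C, 0 < C ∧ ∀ t, t ≤ T0 → φ t ≤ C * Real.exp (z' * t) := by
  set C := Real.exp (-z' * T0) * φ T0 with hC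
  have hC0 : 0 < C := mul_pos (Real.exp_pos _) (F.pos _)
  refine ⟨C, hC0, ?_⟩
  have key : ∀ η, 0 < η → ∀ t, t ≤ T0 → φ t ≤ η * Real.exp (za * t) + C * Real.exp (z' * t) := by
    intro η hη
    set W : ℝ → ℝ := fun t => η * Real.exp (za * t) + C * Real.exp (z' * t) with hW
    have hWp : ∀ t, 0 < W t := fun t => by rw [hW]; positivity
    have hWc : Continuous W := by fun_prop
    by_contra hcon
    push Not at hcon
    obtain ⟨t, ht1, ht2⟩ := hcon
    have hfc : Continuous (fun s => φ s / W s) := F.cont.div hWc (fun s => (hWp s).ne')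
    have hf0 : Tendsto (fun s => φ s / W s) atBot (nhds 0) := by
      apply squeeze_zero' (g := fun s => C0 / η * Real.exp ((z - za) * s))
      · exact Eventually.of_forall fun s => div_nonneg (F.pos s).le (hWp s).le
      · filter_upwards [eventually_le_atBot T1] with s hs
        have e1 := hO s hs
        calc φ s / W s ≤ φ s / (η * Real.exp (za * s)) := by
              apply div_le_div_of_nonneg_left (F.pos s).le (by positivity)
              simp only [hW]
              have : 0 < C * Real.exp (z' * s) := by positivity
              linarith
          _ ≤ (C0 * Real.exp (z * s)) / (η * Real.exp (za * s)) := by gcongr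
          _ = _ := by
            have : Real.exp (z * s) = Real.exp ((z - za) * s) * Real.exp (za * s) := by
              rw [← Real.exp_add]; ring_nf
            rw [this]; field_simp
      · simpa using (pf_tendsto_exp_bot (sub_pos.2 hza)).const_mul (C0 / η)
    obtain ⟨ts, h1, h2, h3⟩ := pf_exists_max hfc hf0 (t0 := t) (T := T0) (div_pos (F.pos t) (hWp t)) ht1
    have h4 : 1 < φ ts / W ts := lt_of_lt_of_le ((one_lt_div (hWp t)).2 ht2) (h3 t ht1)
    have h5 : ts < T0 := by
      rcases h1.lt_or_eq with h | h
      · exact h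
      · rw [h, one_lt_div (hWp T0)] at h4
        have e : C * Real.exp (z' * T0) = φ T0 := by
          rw [hC]
          have : Real.exp (-z' * T0) * Real.exp (z' * T0) = 1 := by rw [← Real.exp_add]; simp
          calc _ = Real.exp (-z' * T0) * Real.exp (z' * T0) * φ T0 := by ring
            _ = _ := by rw [this, one_mul]
        simp only [hW] at h4
        have : 0 < η * Real.exp (za * T0) := by positivity
        linarith
    set ρ := φ ts / W ts with hρ
    have hle : ∀ s, s ≤ T0 → φ s ≤ ρ * W s := by
      intro s hs
      exact (div_le_iff₀ (hWp s)).1 (h3 s hs)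
    refine F.touch (W := W) (b' := b') (ρ := ρ) (t := ts) ha
      (W1 := fun s => η * (za * Real.exp (za * s)) + C * (z' * Real.exp (z' * s)))
      (W2 := fun s => η * (za * (za * Real.exp (za * s))) + C * (z' * (z' * Real.exp (z' * s))))
      (fun s => ((pf_hasDeriv_exp za s).const_mul η).add ((pf_hasDeriv_exp z' s).const_mul C))
      (fun s => (((pf_hasDeriv_exp za s).const_mul za).const_mul η).add
        (((pf_hasDeriv_exp z' s).const_mul z').const_mul C)) (by linarith) ?_ ?_ ?_ ?_ hb ?_
    · filter_upwards [Iio_mem_nhds h5] with s hs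
      exact hle s (le_of_lt hs)
    · rw [hρ]; field_simp [(hWp ts).ne']
    · exact hle _ (by linarith)
    · have e1 := pf_exp_super (a := a) (b := b') (h := h) za ts
      have e2 := pf_exp_super (a := a) (b := b') (h := h) z' ts
      have e3 : η * (PfP a b' h za * Real.exp (za * ts)) < 0 :=
        mul_neg_of_pos_of_neg hη (mul_neg_of_neg_of_pos hPa (Real.exp_pos _))
      have e4 : C * (PfP a b' h z' * Real.exp (z' * ts)) < 0 :=
        mul_neg_of_pos_of_neg hC0 (mul_neg_of_neg_of_pos hP' (Real.exp_pos _))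
      rw [← e1] at e3
      rw [← e2] at e4
      simp only [hW]
      linarith
    · exact hT0 _ (by linarith)
  intro t ht
  have hl : Tendsto (fun η : ℝ => η * Real.exp (za * t) + C * Real.exp (z' * t)) (nhdsWithin 0 (Ioi 0))
      (nhds (0 * Real.exp (za * t) + C * Real.exp (z' * t))) := by
    apply Tendsto.mono_left _ nhdsWithin_le_nhds
    exact Continuous.tendsto (by fun_prop) 0
  have := ge_of_tendsto hl (by filter_upwards [self_mem_nhdsWithin] with η hη using key η hη t ht)
  linarith

end

lemma pf_left_touch {u : ℝ → ℝ} {u1 t : ℝ} (hd : HasDerivAt u u1 t) (h0 : u t = 0)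
    (hn : ∀ s, s ≤ t → 0 ≤ u s) : u1 ≤ 0 := by
  by_contra hc
  push Not at hc
  have h1 := hd.hasDerivWithinAt (s := Iio t)
  rw [hasDerivWithinAt_iff_tendsto_slope' (by simp)] at h1
  have h2 : u1 ≤ 0 := by
    apply le_of_tendsto h1
    filter_upwards [self_mem_nhdsWithin] with s hs
    rw [slope_def_field, h0]
    have e1 := hn s (le_of_lt hs)
    have e2 : s - t < 0 := sub_neg.2 hs
    exact div_nonpos_of_nonneg_of_nonpos (by linarith) e2.le
  linarith

lemma pf_avg {I r : ℝ → ℝ} {h t M : ℝ} (hh : 0 ≤ h) (hI : ∀ s, s ≤ t → HasDerivAt I (r s) s)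
    (hM : ∀ s, t - h ≤ s → s ≤ t → r s ≤ M) : I t - I (t - h) ≤ M * h := by
  have : MonotoneOn (fun s => M * s - I s) (Icc (t - h) t) := by
    apply pf_mono (f' := fun s => M - r s) (convex_Icc _ _)
    · intro s hs
      exact (((hasDerivAt_id s).const_mul M).sub (hI s hs.2)).congr_deriv (by simp)
    · intro s hs
      linarith [hM s hs.1 hs.2]
  have := this (left_mem_Icc.2 (by linarith)) (right_mem_Icc.2 (by linarith)) (by linarith : t - h ≤ t)
  simp only at this
  linarith

/-- comparison of increments -/
lemma pf_incr {Y r Z y : ℝ → ℝ} {h t ρ : ℝ} (hh : 0 ≤ h) (hY : ∀ s, HasDerivAt Y (Z s) s)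
    (hr : ∀ s, HasDerivAt r (y s) s) (hM : ∀ s, s ≤ t → y s ≤ ρ * Z s) :
    r t - r (t - h) ≤ ρ * (Y t - Y (t - h)) := by
  have := pf_avg (I := fun s => r s - ρ * Y s) (r := fun s => y s - ρ * Z s) (M := 0) hh
    (fun s (_ : s ≤ t) => (hr s).sub ((hY s).const_mul ρ)) (fun s _ hs => by linarith [hM s hs])
  linarith

section
variable {a q E1 h τ τ' σ Cf Cy T : ℝ} {r y y1 f : ℝ → ℝ}

lemma pf_ode_touch (ha : 0 < a) (hq : 0 ≤ q) (hh : 0 ≤ h) (hσ : 0 < σ) (hτ' : 0 < τ')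
    (hr : ∀ t, HasDerivAt r (y t) t) (hy : ∀ t, HasDerivAt y (y1 t) t)
    (he : ∀ t, t ≤ T → a * y1 t + E1 * y t = q * (r t - r (t - h)) - f t)
    (hf : ∀ t, t ≤ T → |f t| ≤ Cf * Real.exp (σ * t))
    (hP : a * τ' ^ 2 - E1 * τ' + q * (Real.exp (τ' * h) - 1) < 0) {C η ρ ts : ℝ} (hη : 0 < η)
    (hC : 0 < C) (hCf : Cf ≤ C * (E1 - q * h)) (hCf0 : 0 ≤ Cf) (hρ : 1 ≤ ρ) (hts : ts ≤ T)
    (hle : ∀ t, t ≤ ts → y t ≤ ρ * (η * Real.exp (-τ' * t) + C * Real.exp (σ * t)))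
    (heq : y ts = ρ * (η * Real.exp (-τ' * ts) + C * Real.exp (σ * ts))) : False := by
  have h1 := pf_left_touch (u := fun t => ρ * (η * Real.exp (-τ' * t) + C * Real.exp (σ * t)) - y t)
    (t := ts) (((((pf_hasDeriv_exp (-τ') ts).const_mul η).add ((pf_hasDeriv_exp σ ts).const_mul C)).const_mul ρ).sub
      (hy ts)) (by rw [heq]; ring) (fun s hs => by linarith [hle s hs])
  have h2 := pf_incr (Y := fun t => η / (-τ') * Real.exp (-τ' * t) + C / σ * Real.exp (σ * t)) (r := r) hh
    (t := ts) (ρ := ρ) (Z := fun t => η * Real.exp (-τ' * t) + C * Real.exp (σ * t))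
    (fun s => (((pf_hasDeriv_exp (-τ') s).const_mul (η / (-τ'))).add ((pf_hasDeriv_exp σ s).const_mul (C / σ))).congr_deriv
      (by field_simp)) hr hle
  have e1 := he ts hts
  have e2 := (abs_le.1 (hf ts hts)).2
  have e2' := (abs_le.1 (hf ts hts)).1
  have q1 : Real.exp (-τ' * (ts - h)) = Real.exp (τ' * h) * Real.exp (-τ' * ts) := by
    rw [← Real.exp_add]; ring_nf
  have q2 : Real.exp (σ * (ts - h)) = Real.exp (-(σ * h)) * Real.exp (σ * ts) := by
    rw [← Real.exp_add]; ring_nf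
  rw [q1, q2] at h2
  set X := Real.exp (-τ' * ts) with hX
  set Y := Real.exp (σ * ts) with hY
  have hXp : 0 < X := Real.exp_pos _
  have hYp : 0 < Y := Real.exp_pos _
  set e := Real.exp (τ' * h)
  have q3 : 1 - σ * h ≤ Real.exp (-(σ * h)) := by
    have := Real.add_one_le_exp (-(σ * h)); linarith
  set e' := Real.exp (-(σ * h))
  have h3 : r ts - r (ts - h) ≤ ρ * (η * X * ((e - 1) / τ') + C * Y * h) := by
    refine h2.trans ?_
    apply mul_le_mul_of_nonneg_left _ (by linarith)
    have : η / (-τ') * X + C / σ * Y - (η / (-τ') * (e * X) + C / σ * (e' * Y)) =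
      η * X * ((e - 1) / τ') + C * Y * ((1 - e') / σ) := by
      field_simp; ring
    rw [this]
    have : (1 - e') / σ ≤ h := by rw [div_le_iff₀ hσ]; linarith
    have := mul_le_mul_of_nonneg_left this (mul_pos hC hYp).le
    linarith
  have h4 := mul_le_mul_of_nonneg_left h3 hq
  have h5 := mul_nonpos_of_nonneg_of_nonpos ha.le h1
  have h6 : E1 * (y ts - ρ * (η * X + C * Y)) = 0 := by rw [heq]; ring
  have h7 : 0 < ρ * (η * X) * (-(a * τ') + E1 - q * ((e - 1) / τ')) := by
    apply mul_pos (by positivity)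
    have : (-(a * τ') + E1 - q * ((e - 1) / τ')) = -(a * τ' ^ 2 - E1 * τ' + q * (e - 1)) / τ' := by
      field_simp; ring
    rw [this]
    apply div_pos (by linarith) hτ'
  have h8 : 0 ≤ ρ * (C * Y) * (a * σ) := by positivity
  have h9 : ρ * Y * Cf ≤ ρ * Y * (C * (E1 - q * h)) := by
    apply mul_le_mul_of_nonneg_left hCf; positivity
  have h10 : Cf * Y ≤ ρ * Y * Cf := by nlinarith [mul_nonneg hCf0 hYp.le]
  nlinarith

lemma pf_ode (ha : 0 < a) (hq : 0 ≤ q) (hh : 0 ≤ h) (hσ : 0 < σ) (hτ' : 0 < τ') (hττ : τ < τ')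
    (hr : ∀ t, HasDerivAt r (y t) t) (hy : ∀ t, HasDerivAt y (y1 t) t)
    (he : ∀ t, t ≤ T → a * y1 t + E1 * y t = q * (r t - r (t - h)) - f t)
    (hf : ∀ t, t ≤ T → |f t| ≤ Cf * Real.exp (σ * t)) (hCf : 0 < Cf)
    (hP : a * τ' ^ 2 - E1 * τ' + q * (Real.exp (τ' * h) - 1) < 0) (hE : q * h < E1)
    (hCy : ∀ t, t ≤ T → |y t| ≤ Cy * Real.exp (-τ * t)) :
    ∃ C, 0 < C ∧ ∀ t, t ≤ T → |y t| ≤ C * Real.exp (σ * t) := by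
  set C := Cf / (E1 - q * h) with hC
  have hEp : 0 < E1 - q * h := by linarith
  have hCp : 0 < C := by positivity
  have hCe : Cf ≤ C * (E1 - q * h) := by rw [hC]; field_simp; exact le_rfl
  refine ⟨C, hCp, ?_⟩
  have key : ∀ η, 0 < η → ∀ t, t ≤ T → |y t| ≤ η * Real.exp (-τ' * t) + C * Real.exp (σ * t) := by
    intro η hη
    by_contra hcon
    push Not at hcon
    obtain ⟨t, ht1, ht2⟩ := hcon
    set Z : ℝ → ℝ := fun t => η * Real.exp (-τ' * t) + C * Real.exp (σ * t) with hZ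
    have hZp : ∀ t, 0 < Z t := fun t => by rw [hZ]; positivity
    have hZc : Continuous Z := by fun_prop
    have hyc : Continuous y := continuous_iff_continuousAt.2 fun t => (hy t).continuousAt
    have hfc : Continuous (fun s => |y s| / Z s) := hyc.abs.div hZc (fun s => (hZp s).ne')
    have hf0 : Tendsto (fun s => |y s| / Z s) atBot (nhds 0) := by
      apply squeeze_zero' (g := fun s => Cy / η * Real.exp ((τ' - τ) * s))
      · exact Eventually.of_forall fun s => div_nonneg (abs_nonneg _) (hZp s).le
      · filter_upwards [eventually_le_atBot T] with s hs
        have e1 := hCy s hs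
        calc |y s| / Z s ≤ |y s| / (η * Real.exp (-τ' * s)) := by
              apply div_le_div_of_nonneg_left (abs_nonneg _) (by positivity)
              simp only [hZ]
              have : 0 < C * Real.exp (σ * s) := by positivity
              linarith
          _ ≤ (Cy * Real.exp (-τ * s)) / (η * Real.exp (-τ' * s)) := by gcongr
          _ = _ := by
            have : Real.exp (-τ * s) = Real.exp ((τ' - τ) * s) * Real.exp (-τ' * s) := by
              rw [← Real.exp_add]; ring_nf
            rw [this]; field_simp
      · simpa using (pf_tendsto_exp_bot (sub_pos.2 hττ)).const_mul (Cy / η)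
    have hgt : 1 < |y t| / Z t := (one_lt_div (hZp t)).2 ht2
    obtain ⟨ts, h1, h2, h3⟩ := pf_exists_max hfc hf0 (t0 := t) (T := T) (by linarith) ht1
    have h4 : 1 < |y ts| / Z ts := lt_of_lt_of_le hgt (h3 t ht1)
    set ρ := |y ts| / Z ts with hρ
    have hle : ∀ s, s ≤ ts → |y s| ≤ ρ * Z s := by
      intro s hs
      exact (div_le_iff₀ (hZp s)).1 (h3 s (hs.trans h1))
    have heq : |y ts| = ρ * Z ts := by rw [hρ]; field_simp [(hZp ts).ne']
    rcases abs_choice (y ts) with h5 | h5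
    · exact pf_ode_touch ha hq hh hσ hτ' hr hy he hf hP hη hCp hCe hCf.le h4.le h1
        (fun s hs => (le_abs_self _).trans (hle s hs)) (by rw [← h5]; exact heq)
    · exact pf_ode_touch (r := fun s => - r s) (y := fun s => - y s) (y1 := fun s => - y1 s) (f := fun s => - f s)
        (T := T) (E1 := E1)
        ha hq hh hσ hτ' (fun s => (hr s).neg) (fun s => (hy s).neg)
        (fun s hs => by linarith [he s hs]) (fun s hs => by simpa using hf s hs) hP hη hCp hCe hCf.le h4.le h1
        (fun s hs => (neg_le_abs _).trans (hle s hs)) (by rw [← h5]; exact heq)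
  intro t ht
  have hl : Tendsto (fun η : ℝ => η * Real.exp (-τ' * t) + C * Real.exp (σ * t)) (nhdsWithin 0 (Ioi 0))
      (nhds (0 * Real.exp (-τ' * t) + C * Real.exp (σ * t))) := by
    apply Tendsto.mono_left _ nhdsWithin_le_nhds
    exact Continuous.tendsto (by fun_prop) 0
  have := ge_of_tendsto hl (by filter_upwards [self_mem_nhdsWithin] with η hη using key η hη t ht)
  linarith

/-- limits of integrated exponential bounds -/
lemma pf_lim (hσ : 0 < σ) {C : ℝ} (hr : ∀ t, HasDerivAt r (y t) t)
    (hy : ∀ t, t ≤ T → |y t| ≤ C * Real.exp (σ * t)) {A0 : ℝ} (hA : Tendsto r atBot (nhds A0)) :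
    ∀ t, t ≤ T → |r t - A0| ≤ C / σ * Real.exp (σ * t) := by
  have hm1 : MonotoneOn (fun t => r t + C / σ * Real.exp (σ * t)) (Iic T) := by
    apply pf_mono (convex_Iic T) (fun t _ => (hr t).add ((pf_hasDeriv_exp σ t).const_mul _))
    intro t ht
    have := (abs_le.1 (hy t ht)).1
    have e : C / σ * (σ * Real.exp (σ * t)) = C * Real.exp (σ * t) := by field_simp
    rw [e]; linarith
  have hm2 : MonotoneOn (fun t => C / σ * Real.exp (σ * t) - r t) (Iic T) := by
    apply pf_mono (convex_Iic T) (fun t _ => ((pf_hasDeriv_exp σ t).const_mul _).sub (hr t))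
    intro t ht
    have := (abs_le.1 (hy t ht)).2
    have e : C / σ * (σ * Real.exp (σ * t)) = C * Real.exp (σ * t) := by field_simp
    rw [e]; linarith
  have hE : Tendsto (fun t => C / σ * Real.exp (σ * t)) atBot (nhds 0) := by
    simpa using (pf_tendsto_exp_bot hσ).const_mul (C / σ)
  intro t ht
  rw [abs_le]
  constructor
  · have := le_of_tendsto (hA.add hE) (b := r t + C / σ * Real.exp (σ * t)) (by
      filter_upwards [eventually_le_atBot t] with s hs
      exact hm1 (mem_Iic.2 (hs.trans ht)) ht hs)
    linarith
  · have := le_of_tendsto (hE.sub hA) (b := C / σ * Real.exp (σ * t) - r t) (by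
      filter_upwards [eventually_le_atBot t] with s hs
      exact hm2 (mem_Iic.2 (hs.trans ht)) ht hs)
    linarith

lemma pf_lim_exists (hσ : 0 < σ) {C : ℝ} (hr : ∀ t, HasDerivAt r (y t) t) (hC : 0 ≤ C)
    (hy : ∀ t, t ≤ T → |y t| ≤ C * Real.exp (σ * t)) (hr0 : ∀ t, 0 ≤ r t) :
    ∃ A0, 0 ≤ A0 ∧ Tendsto r atBot (nhds A0) := by
  have hm1 : MonotoneOn (fun t => r t + C / σ * Real.exp (σ * t)) (Iic T) := by
    apply pf_mono (convex_Iic T) (fun t _ => (hr t).add ((pf_hasDeriv_exp σ t).const_mul _))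
    intro t ht
    have := (abs_le.1 (hy t ht)).1
    have e : C / σ * (σ * Real.exp (σ * t)) = C * Real.exp (σ * t) := by field_simp
    rw [e]; linarith
  set F : ℝ → ℝ := fun t => r (min t T) + C / σ * Real.exp (σ * (min t T)) with hF
  have hFm : Monotone F := by
    intro s t hst
    exact hm1 (mem_Iic.2 (min_le_right _ _)) (mem_Iic.2 (min_le_right _ _)) (min_le_min_right T hst)
  have hb : BddBelow (range F) := by
    refine ⟨0, ?_⟩
    rintro _ ⟨t, rfl⟩
    simp only [hF]
    have := hr0 (min t T)
    positivity
  have hl := tendsto_atBot_ciInf hFm hb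
  have hE : Tendsto (fun t => C / σ * Real.exp (σ * t)) atBot (nhds 0) := by
    simpa using (pf_tendsto_exp_bot hσ).const_mul (C / σ)
  have hl2 := hl.sub hE
  rw [sub_zero] at hl2
  have hl3 : Tendsto r atBot (nhds (⨅ i, F i)) := by
    refine hl2.congr' ?_
    filter_upwards [eventually_le_atBot T] with s hs
    simp only [hF, min_eq_left hs]; ring
  exact ⟨_, ge_of_tendsto' hl3 hr0, hl3⟩

lemma pf_lim_pos (ha : 0 < a) (hq : 0 ≤ q) (hh : 0 ≤ h) (hσ : 0 < σ) {C σ2 D : ℝ} (hσ2 : 0 < σ2) (hD : 0 < D)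
    (hr : ∀ t, HasDerivAt r (y t) t) (hy : ∀ t, HasDerivAt y (y1 t) t)
    (he : ∀ t, t ≤ T → a * y1 t + E1 * y t = q * (r t - r (t - h)) - f t)
    (hf : ∀ t, t ≤ T → |f t| ≤ D * Real.exp (σ2 * t) * r (t - h)) (hE : q * h < E1)
    (hCy : ∀ t, t ≤ T → |y t| ≤ C * Real.exp (σ * t)) (hr0 : ∀ t, 0 < r t)
    (hA : Tendsto r atBot (nhds 0)) : False := by
  have hrc : Continuous r := continuous_iff_continuousAt.2 fun t => (hr t).continuousAt
  obtain ⟨I, hI⟩ : ∃ I : ℝ → ℝ, ∀ t, HasDerivAt I (r t) t :=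
    ⟨fun t => ∫ s in (0:ℝ)..t, r s, fun t => (hrc.integral_hasStrictDerivAt 0 t).hasDerivAt⟩
  have hrb := pf_lim hσ hr hCy hA
  have hId : ∀ t, HasDerivAt (fun t => I (t - h)) (r (t - h)) t := by
    intro t
    exact ((hI (t - h)).comp t ((hasDerivAt_id t).sub_const h)).congr_deriv (by simp)
  set J : ℝ → ℝ := fun t => a * y t + E1 * r t - q * (I t - I (t - h)) with hJ
  have hJd : ∀ t, HasDerivAt J (a * y1 t + E1 * y t - q * (r t - r (t - h))) t := fun t =>
    (((hy t).const_mul a).add ((hr t).const_mul E1)).sub (((hI t).sub (hId t)).const_mul q)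
  have hE0 : Tendsto (fun t => Real.exp (σ * t)) atBot (nhds 0) := pf_tendsto_exp_bot hσ
  have hy0 : Tendsto y atBot (nhds 0) := by
    apply squeeze_zero_norm' (a := fun t => C * Real.exp (σ * t))
    · filter_upwards [eventually_le_atBot T] with s hs
      exact hCy s hs
    · simpa using hE0.const_mul C
  have hI0 : Tendsto (fun t => I t - I (t - h)) atBot (nhds 0) := by
    apply squeeze_zero' (g := fun t => C / σ * Real.exp (σ * t) * h)
    · filter_upwards with t
      have := pf_avg (I := fun s => - I s) (r := fun s => - r s) (M := 0) (h := h) (t := t) hh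
        (fun s _ => (hI s).neg) (fun s _ _ => by linarith [hr0 s])
      linarith
    · filter_upwards [eventually_le_atBot T] with t ht
      apply pf_avg hh (fun s _ => hI s)
      intro s hs1 hs2
      have e1 := hrb s (hs2.trans ht)
      rw [sub_zero, abs_of_pos (hr0 s)] at e1
      refine e1.trans ?_
      have e2 : Real.exp (σ * s) ≤ Real.exp (σ * t) := by gcongr
      have e3 : 0 ≤ C := by
        have := (abs_nonneg _).trans (hCy T le_rfl)
        exact nonneg_of_mul_nonneg_left this (Real.exp_pos _)
      gcongr
    · simpa using (hE0.const_mul (C / σ)).mul_const h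
  have hJ0 : Tendsto J atBot (nhds 0) := by
    have := ((hy0.const_mul a).add (hA.const_mul E1)).sub (hI0.const_mul q)
    simpa using this
  -- choose small T'
  have hEp : 0 < E1 - q * h := by linarith
  obtain ⟨T', hT'T, hT'⟩ : ∃ T', T' ≤ T ∧ D / σ2 * Real.exp (σ2 * T') < E1 - q * h := by
    have : Tendsto (fun t => D / σ2 * Real.exp (σ2 * t)) atBot (nhds 0) := by
      simpa using (pf_tendsto_exp_bot hσ2).const_mul (D / σ2)
    obtain ⟨T', h1, h2⟩ := ((eventually_le_atBot T).and (this.eventually (gt_mem_nhds hEp))).exists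
    exact ⟨T', h1, h2⟩
  obtain ⟨ts, h1, h2, h3⟩ := pf_exists_max hrc hA (hr0 T') (le_refl T')
  set R := r ts with hR
  have hJb := pf_lim (r := J) (T := T') (C := D * R) hσ2 hJd (fun t ht => by
    have e1 := he t (ht.trans hT'T)
    have e2 := hf t (ht.trans hT'T)
    have e3 : a * y1 t + E1 * y t - q * (r t - r (t - h)) = - f t := by linarith
    rw [e3, abs_neg]
    refine e2.trans ?_
    have := h3 (t - h) (by linarith)
    calc D * Real.exp (σ2 * t) * r (t - h) ≤ D * Real.exp (σ2 * t) * R := by gcongr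
      _ = _ := by ring) hJ0 ts h1
  rw [sub_zero] at hJb
  have e1 := (le_abs_self _).trans hJb
  have e2 : Real.exp (σ2 * ts) ≤ Real.exp (σ2 * T') := by gcongr
  have e3 : D * R / σ2 * Real.exp (σ2 * ts) < (E1 - q * h) * R := by
    calc D * R / σ2 * Real.exp (σ2 * ts) ≤ D * R / σ2 * Real.exp (σ2 * T') := by gcongr
      _ = D / σ2 * Real.exp (σ2 * T') * R := by ring
      _ < _ := by gcongr
  have e4 : I ts - I (ts - h) ≤ R * h := pf_avg hh (fun s _ => hI s) (fun s _ hs => h3 s (hs.trans h1))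
  have e5 : 0 ≤ y ts := by
    have := pf_left_touch (u := fun s => R - r s) ((hr ts).const_sub R) (by simp [hR])
      (fun s hs => by linarith [h3 s (hs.trans h1)])
    linarith
  have e6 := mul_le_mul_of_nonneg_left e4 hq
  have e7 := mul_nonneg ha.le e5
  simp only [hJ] at e1
  nlinarith
end

section
variable {g : ℝ → ℝ} {κ θ A δ γ b k L a h m : ℝ} {φ φ1 φ2 : ℝ → ℝ}

lemma PfF.d1_exp (F : PfF g κ a h φ φ1 φ2) (ha : 0 < a) (hh : 0 ≤ h) (hm : 0 < m)
    (hK : 0 ≤ a * m ^ 2 + m - 1)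
    (hV : ∀ t, 0 ≤ φ1 t + m * φ t) {b' z C0 T0 : ℝ} (hb : 0 ≤ b') (hz : 0 < z) (hC0 : 0 < C0)
    (hzn : z < 1 / a + m) (hT0 : ∀ t, t ≤ T0 → g (φ t) ≤ b' * φ t)
    (hO : ∀ t, t ≤ T0 → φ t ≤ C0 * Real.exp (z * t)) :
    ∃ C1, 0 < C1 ∧ ∀ t, t ≤ T0 → |φ1 t| ≤ C1 * Real.exp (z * t) := by
  set n := 1 / a + m with hn
  set K := a * m ^ 2 + m - 1 with hKd
  have hnz : 0 < n - z := by linarith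
  set C' := (K + b') * C0 / (a * (n - z)) + Real.exp (-z * T0) * (φ1 T0 + m * φ T0) with hC'
  have hx0 : 0 ≤ Real.exp (-z * T0) * (φ1 T0 + m * φ T0) := mul_nonneg (Real.exp_pos _).le (hV _)
  have hy0 : 0 ≤ (K + b') * C0 / (a * (n - z)) := by positivity
  have hC'0 : 0 ≤ C' := by rw [hC']; linarith
  have hanti : AntitoneOn (fun t => Real.exp (-n * t) * (C' * Real.exp (z * t) - (φ1 t + m * φ t))) (Iic T0) := by
    apply pf_anti (convex_Iic _) (fun t _ => pf_exp_mul_hasDeriv (-n) t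
      (((pf_hasDeriv_exp z t).const_mul C').sub ((F.d2 t).add ((F.d1 t).const_mul m))))
    intro t ht
    have ht := mem_Iic.1 ht
    apply mul_nonpos_of_nonneg_of_nonpos (Real.exp_pos _).le
    have e : φ2 t = (φ1 t + (φ t - g (φ (t - h)))) / a := by
      field_simp; linarith [F.eq t]
    rw [e]
    have e1 : -n * (C' * Real.exp (z * t) - (φ1 t + m * φ t)) + (C' * (z * Real.exp (z * t)) -
      ((φ1 t + (φ t - g (φ (t - h)))) / a + m * φ1 t)) = (K * φ t + g (φ (t - h))) / a - C' * (n - z) * Real.exp (z * t) := by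
      rw [hn, hKd]; field_simp; ring
    refine e1.trans_le ?_
    have e2 : (K + b') * C0 / a ≤ C' * (n - z) := by
      have : (K + b') * C0 / a = (K + b') * C0 / (a * (n - z)) * (n - z) := by field_simp
      rw [this]
      apply mul_le_mul_of_nonneg_right _ hnz.le
      rw [hC']; linarith
    have e3 : φ (t - h) ≤ C0 * Real.exp (z * t) := by
      refine (hO (t - h) (by linarith)).trans ?_
      have : Real.exp (z * (t - h)) ≤ Real.exp (z * t) := by
        apply Real.exp_le_exp.2; nlinarith
      gcongr
    have e4 : K * φ t + g (φ (t - h)) ≤ (K + b') * (C0 * Real.exp (z * t)) := by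
      have := hT0 (t - h) (by linarith)
      have := mul_le_mul_of_nonneg_left e3 hb
      have := mul_le_mul_of_nonneg_left (hO t ht) hK
      linarith
    have e5 : (K * φ t + g (φ (t - h))) / a ≤ (K + b') * C0 / a * Real.exp (z * t) := by
      calc _ ≤ (K + b') * (C0 * Real.exp (z * t)) / a := by gcongr
        _ = _ := by ring
    have := mul_le_mul_of_nonneg_right e2 (Real.exp_pos (z * t)).le
    linarith
  have hVle : ∀ t, t ≤ T0 → φ1 t + m * φ t ≤ C' * Real.exp (z * t) := by
    intro t ht
    have e1 := hanti (mem_Iic.2 ht) (mem_Iic.2 le_rfl) ht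
    have e2 : 0 ≤ C' * Real.exp (z * T0) - (φ1 T0 + m * φ T0) := by
      have : φ1 T0 + m * φ T0 ≤ C' * Real.exp (z * T0) := by
        rw [pf_div_exp, hC']; linarith
      linarith
    have e3 := (mul_nonneg (Real.exp_pos (-n * T0)).le e2).trans e1
    have := nonneg_of_mul_nonneg_right e3 (Real.exp_pos _)
    linarith
  refine ⟨C' + m * C0, by positivity, fun t ht => ?_⟩
  have e1 := hVle t ht
  have e2 := mul_le_mul_of_nonneg_left (hO t ht) hm.le
  have e3 := mul_pos hm (F.pos t)
  have e4 := mul_nonneg hC'0 (Real.exp_pos (z * t)).le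
  rw [abs_le]
  constructor
  · linarith [hV t]
  · linarith

lemma PfF.fast (F : PfF g κ a h φ φ1 φ2) (G : PfG g κ θ A δ γ b k L)
    (ha : 0 < a) (hh : 0 ≤ h) (hm : 0 < m) (hK : 0 ≤ a * m ^ 2 + m - 1)
    (hV : ∀ t, 0 ≤ φ1 t + m * φ t) {Λ z τ' C0 T0 b' : ℝ} (hz : 0 < z) (hzΛ : z < Λ)
    (hzγ : Λ < (1 + γ) * z) (hτ : Λ - z < τ') (hΛ : PfP a b h Λ = 0)
    (hE : b * Real.exp (-(Λ * h)) * h < 2 * a * Λ - 1)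
    (hP : PfP a b h (Λ - τ') < 0) (hb' : 0 ≤ b') (hT0 : ∀ t, t ≤ T0 → g (φ t) ≤ b' * φ t)
    (hT0δ : ∀ t, t ≤ T0 → φ t ≤ δ) (hC0 : 0 < C0)
    (hO : ∀ t, t ≤ T0 → φ t ≤ C0 * Real.exp (z * t)) :
    ∃ A0 σ C, 0 < A0 ∧ 0 < σ ∧ ∀ t, t ≤ T0 → |φ t - A0 * Real.exp (Λ * t)| ≤ C * Real.exp ((Λ + σ) * t) ∧
      |φ1 t - Λ * (A0 * Real.exp (Λ * t))| ≤ C * Real.exp ((Λ + σ) * t) := by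
  have hb0 : 0 < b := by linarith [G.b1]
  have hΛ0 : 0 < Λ := by linarith
  have hzn : z < 1 / a + m := by
    by_contra hc
    push Not at hc
    have e1 : a * Λ ^ 2 - Λ - 1 < 0 := by
      have : 0 < b * Real.exp (-(Λ * h)) := by positivity
      rw [PfP] at hΛ; linarith
    have e2 : 1 / a + m < Λ := by linarith
    have e3 : 1 + a * m < a * Λ := by
      have := mul_lt_mul_of_pos_left e2 ha
      have q : a * (1 / a + m) = 1 + a * m := by field_simp
      linarith
    have e4 : m < Λ := by have : 0 < 1 / a := by positivity
                          linarith
    nlinarith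
  obtain ⟨C1, hC1, hφ1⟩ := F.d1_exp ha hh hm hK hV hb' hz hC0 hzn hT0 hO
  set q := b * Real.exp (-(Λ * h)) with hq
  have hq0 : 0 < q := by positivity
  set E1 := 2 * a * Λ - 1 with hE1
  set r : ℝ → ℝ := fun t => Real.exp (-Λ * t) * φ t with hr
  set y : ℝ → ℝ := fun t => Real.exp (-Λ * t) * (-Λ * φ t + φ1 t) with hy
  set y1 : ℝ → ℝ := fun t => Real.exp (-Λ * t) * (-Λ * (-Λ * φ t + φ1 t) + (-Λ * φ1 t + φ2 t)) with hy1
  set f : ℝ → ℝ := fun t => Real.exp (-Λ * t) * (g (φ (t - h)) - b * φ (t - h)) with hf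
  have hrd : ∀ t, HasDerivAt r (y t) t := fun t => pf_exp_mul_hasDeriv (-Λ) t (F.d1 t)
  have hyd : ∀ t, HasDerivAt y (y1 t) t := fun t =>
    pf_exp_mul_hasDeriv (-Λ) t (((F.d1 t).const_mul (-Λ)).add (F.d2 t))
  have hrp : ∀ t, 0 < r t := fun t => mul_pos (Real.exp_pos _) (F.pos t)
  have hdel : ∀ t, Real.exp (-Λ * t) = Real.exp (-(Λ * h)) * Real.exp (-Λ * (t - h)) := by
    intro t; rw [← Real.exp_add]; ring_nf
  have he : ∀ t, t ≤ T0 → a * y1 t + E1 * y t = q * (r t - r (t - h)) - f t := by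
    intro t _
    have e1 : q * r (t - h) = Real.exp (-Λ * t) * (b * φ (t - h)) := by
      simp only [hr, hq]; rw [hdel t]; ring
    have e2 : a * φ2 t = φ1 t + φ t - g (φ (t - h)) := by linarith [F.eq t]
    have e3 : q = 1 + Λ - a * Λ ^ 2 := by rw [PfP] at hΛ; linarith
    have e4 : a * y1 t + E1 * y t = Real.exp (-Λ * t) * (a * φ2 t - φ1 t + (Λ - a * Λ ^ 2) * φ t) := by
      simp only [hy1, hy, hE1]; ring
    have e5 : q * (r t - r (t - h)) = Real.exp (-Λ * t) * ((1 + Λ - a * Λ ^ 2) * φ t) - q * r (t - h) := by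
      rw [mul_sub, e3]; simp only [hr]; ring
    rw [e4, e5, e1, e2]; simp only [hf]; ring
  set σ := (1 + γ) * z - Λ with hσ
  have hσ0 : 0 < σ := by linarith
  set Cf := A * C0 ^ (1 + γ) with hCf
  have hCf0 : 0 < Cf := by have := G.A0; positivity
  have hγ := G.γ0
  have hfb0 : ∀ t, t ≤ T0 → |f t| ≤ Real.exp (-Λ * t) * (A * φ (t - h) ^ (1 + γ)) := by
    intro t ht
    simp only [hf]
    rw [abs_mul, abs_of_pos (Real.exp_pos _)]
    exact mul_le_mul_of_nonneg_left (G.hol _ (F.pos _).le (hT0δ _ (by linarith))) (Real.exp_pos _).le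
  have hdO : ∀ t, t ≤ T0 → φ (t - h) ≤ C0 * Real.exp (z * t) := by
    intro t ht
    refine (hO (t - h) (by linarith)).trans ?_
    have : Real.exp (z * (t - h)) ≤ Real.exp (z * t) := by
      apply Real.exp_le_exp.2; nlinarith
    gcongr
  have hfb : ∀ t, t ≤ T0 → |f t| ≤ Cf * Real.exp (σ * t) := by
    intro t ht
    refine (hfb0 t ht).trans ?_
    have e1 : φ (t - h) ^ (1 + γ) ≤ (C0 * Real.exp (z * t)) ^ (1 + γ) :=
      Real.rpow_le_rpow (F.pos _).le (hdO t ht) (by linarith)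
    rw [Real.mul_rpow hC0.le (Real.exp_pos _).le, ← Real.exp_mul] at e1
    calc Real.exp (-Λ * t) * (A * φ (t - h) ^ (1 + γ)) ≤
          Real.exp (-Λ * t) * (A * (C0 ^ (1 + γ) * Real.exp (z * t * (1 + γ)))) := by
          have := G.A0; gcongr
      _ = Cf * (Real.exp (-Λ * t) * Real.exp (z * t * (1 + γ))) := by rw [hCf]; ring
      _ = _ := by rw [← Real.exp_add, hσ]; ring_nf
  have hfr : ∀ t, t ≤ T0 → |f t| ≤ (A * C0 ^ γ) * Real.exp ((γ * z) * t) * r (t - h) := by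
    intro t ht
    refine (hfb0 t ht).trans ?_
    have e1 : φ (t - h) ^ γ ≤ (C0 * Real.exp (z * t)) ^ γ :=
      Real.rpow_le_rpow (F.pos _).le (hdO t ht) hγ.le
    rw [Real.mul_rpow hC0.le (Real.exp_pos _).le, ← Real.exp_mul] at e1
    have e2 : φ (t - h) ^ (1 + γ) = φ (t - h) * φ (t - h) ^ γ := by
      rw [Real.rpow_add (F.pos _), Real.rpow_one]
    have e3 : Real.exp (-Λ * t) ≤ Real.exp (-Λ * (t - h)) := by
      apply Real.exp_le_exp.2; nlinarith
    have e4 := F.pos (t - h)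
    have hA := G.A0
    calc Real.exp (-Λ * t) * (A * φ (t - h) ^ (1 + γ)) =
          Real.exp (-Λ * t) * (A * (φ (t - h) * φ (t - h) ^ γ)) := by rw [e2]
      _ ≤ Real.exp (-Λ * (t - h)) * (A * (φ (t - h) * (C0 ^ γ * Real.exp (z * t * γ)))) := by gcongr
      _ = _ := by
        simp only [hr]
        have : z * t * γ = γ * z * t := by ring
        rw [this]; ring
  have hPt : a * τ' ^ 2 - E1 * τ' + q * (Real.exp (τ' * h) - 1) < 0 := by
    have : PfP a b h (Λ - τ') = PfP a b h Λ + (a * τ' ^ 2 - E1 * τ' + q * (Real.exp (τ' * h) - 1)) := by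
      rw [PfP, PfP]
      have : Real.exp (-((Λ - τ') * h)) = Real.exp (-(Λ * h)) * Real.exp (τ' * h) := by
        rw [← Real.exp_add]; ring_nf
      rw [this, hq, hE1]; ring
    rw [this, hΛ] at hP
    linarith
  obtain ⟨C, hC, hyb⟩ := pf_ode (τ := Λ - z) (Cy := Λ * C0 + C1) ha hq0.le hh hσ0 (by linarith) hτ hrd hyd he hfb hCf0 hPt hE
    (fun t ht => by
      simp only [hy]
      rw [abs_mul, abs_of_pos (Real.exp_pos _)]
      have e1 := abs_add_le (-Λ * φ t) (φ1 t)
      rw [abs_mul, abs_neg, abs_of_pos hΛ0, abs_of_pos (F.pos t)] at e1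
      have e2 := mul_le_mul_of_nonneg_left (hO t ht) hΛ0.le
      have e3 := hφ1 t ht
      have e4 : |-Λ * φ t + φ1 t| ≤ (Λ * C0 + C1) * Real.exp (z * t) := by linarith
      calc _ ≤ Real.exp (-Λ * t) * ((Λ * C0 + C1) * Real.exp (z * t)) := by gcongr
        _ = (Λ * C0 + C1) * (Real.exp (-Λ * t) * Real.exp (z * t)) := by ring
        _ = _ := by rw [← Real.exp_add]; ring_nf)
  obtain ⟨A0, hA0, hlim⟩ := pf_lim_exists hσ0 hrd hC.le hyb (fun t => (hrp t).le)
  have hA0p : 0 < A0 := by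
    rcases hA0.lt_or_eq with h0 | h0
    · exact h0
    · exfalso
      rw [← h0] at hlim
      have hA := G.A0
      exact pf_lim_pos (D := A * C0 ^ γ) (σ2 := γ * z) ha hq0.le hh hσ0 (by positivity) (by positivity) hrd hyd he hfr hE hyb hrp hlim
  have hrb := pf_lim hσ0 hrd hyb hlim
  refine ⟨A0, σ, C + (Λ + 1) * (C / σ), hA0p, hσ0, fun t ht => ?_⟩
  have q1 : Real.exp (Λ * t) * Real.exp (-Λ * t) = 1 := by rw [← Real.exp_add]; simp
  have e1 : φ t = Real.exp (Λ * t) * r t := by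
    simp only [hr]; rw [← mul_assoc, q1, one_mul]
  have e2 : φ1 t = Real.exp (Λ * t) * (y t + Λ * r t) := by
    simp only [hr, hy]
    calc φ1 t = (Real.exp (Λ * t) * Real.exp (-Λ * t)) * φ1 t := by rw [q1, one_mul]
      _ = _ := by ring
  have q2 : Real.exp ((Λ + σ) * t) = Real.exp (Λ * t) * Real.exp (σ * t) := by
    rw [← Real.exp_add]; ring_nf
  have hX := Real.exp_pos (Λ * t)
  have hY := Real.exp_pos (σ * t)
  have hCs : 0 < C / σ := by positivity
  constructor
  · have : φ t - A0 * Real.exp (Λ * t) = Real.exp (Λ * t) * (r t - A0) := by rw [e1]; ring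
    rw [this, abs_mul, abs_of_pos hX, q2]
    calc _ ≤ Real.exp (Λ * t) * (C / σ * Real.exp (σ * t)) := by gcongr; exact hrb t ht
      _ = (C / σ) * (Real.exp (Λ * t) * Real.exp (σ * t)) := by ring
      _ ≤ _ := by gcongr; nlinarith
  · have : φ1 t - Λ * (A0 * Real.exp (Λ * t)) = Real.exp (Λ * t) * (y t + Λ * (r t - A0)) := by rw [e2]; ring
    rw [this, abs_mul, abs_of_pos hX, q2]
    have e3 : |y t + Λ * (r t - A0)| ≤ (C + Λ * (C / σ)) * Real.exp (σ * t) := by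
      have q3 := abs_add_le (y t) (Λ * (r t - A0))
      rw [abs_mul Λ, abs_of_pos hΛ0] at q3
      have q4 := mul_le_mul_of_nonneg_left (hrb t ht) hΛ0.le
      have := hyb t ht
      linarith
    calc _ ≤ Real.exp (Λ * t) * ((C + Λ * (C / σ)) * Real.exp (σ * t)) := by gcongr
      _ = (C + Λ * (C / σ)) * (Real.exp (Λ * t) * Real.exp (σ * t)) := by ring
      _ ≤ _ := by gcongr; nlinarith
end

section
open MeasureTheory

def PfB (V : ℝ → ℝ) : Prop := Measurable V ∧ ∃ M, ∀ t, |V t| ≤ M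

def pfPhi (m : ℝ) (V : ℝ → ℝ) (t : ℝ) : ℝ := Real.exp (-m * t) * ∫ s in Iic t, Real.exp (m * s) * V s

variable {m : ℝ} {V W : ℝ → ℝ}

lemma PfB.int (hV : PfB V) (hm : 0 < m) (t : ℝ) : IntegrableOn (fun s => Real.exp (m * s) * V s) (Iic t) := by
  obtain ⟨hmeas, M, hM⟩ := hV
  refine Integrable.mono' ((integrableOn_exp_mul_Iic hm t).mul_const M) ?_ ?_
  · exact ((by fun_prop : Measurable (fun s => Real.exp (m * s))).mul hmeas).aestronglyMeasurable
  · refine ae_of_all _ fun s => ?_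
    rw [norm_mul, Real.norm_eq_abs, Real.norm_eq_abs, abs_of_pos (Real.exp_pos _)]
    exact mul_le_mul_of_nonneg_left (hM s) (Real.exp_pos _).le

lemma PfB.intI (hV : PfB V) (hm : 0 < m) (a b : ℝ) :
    IntervalIntegrable (fun s => Real.exp (m * s) * V s) volume a b := by
  rw [intervalIntegrable_iff]
  exact (hV.int hm (max a b)).mono_set (fun x hx => hx.2)

lemma pf_exp_neg_mul (m t : ℝ) : Real.exp (-m * t) * Real.exp (m * t) = 1 := by
  rw [← Real.exp_add]; simp

lemma pfPhi_const (hm : 0 < m) (c t : ℝ) : pfPhi m (fun _ => c) t = c / m := by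
  rw [pfPhi, integral_mul_const, integral_exp_mul_Iic hm]
  have := pf_exp_neg_mul m t
  calc _ = (Real.exp (-m * t) * Real.exp (m * t)) * (c / m) := by ring
    _ = _ := by rw [this, one_mul]

lemma pfPhi_mono (hm : 0 < m) (hV : PfB V) (hW : PfB W) {t : ℝ} (h : ∀ s, s ≤ t → V s ≤ W s) :
    pfPhi m V t ≤ pfPhi m W t := by
  apply mul_le_mul_of_nonneg_left _ (Real.exp_pos _).le
  apply setIntegral_mono_on (hV.int hm t) (hW.int hm t) measurableSet_Iic
  intro s hs
  exact mul_le_mul_of_nonneg_left (h s hs) (Real.exp_pos _).le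

lemma PfB.const (c : ℝ) : PfB (fun _ => c) := ⟨measurable_const, |c|, fun _ => le_rfl⟩

lemma pfPhi_le (hm : 0 < m) (hV : PfB V) {c t : ℝ} (h : ∀ s, s ≤ t → V s ≤ c) : pfPhi m V t ≤ c / m := by
  rw [← pfPhi_const hm c t]
  exact pfPhi_mono hm hV (PfB.const c) h

lemma pfPhi_ge (hm : 0 < m) (hV : PfB V) {c t : ℝ} (h : ∀ s, s ≤ t → c ≤ V s) : c / m ≤ pfPhi m V t := by
  rw [← pfPhi_const hm c t]
  exact pfPhi_mono hm (PfB.const c) hV h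

lemma pfPhi_diff (hm : 0 < m) (hV : PfB V) (hW : PfB W) (hVW : ∀ s, V s ≤ W s) {h : ℝ} (hh : 0 ≤ h) (t : ℝ) :
    pfPhi m W (t - h) - pfPhi m V (t - h) ≤ Real.exp (m * h) * (pfPhi m W t - pfPhi m V t) := by
  have e : ∀ u, pfPhi m W u - pfPhi m V u = Real.exp (-m * u) * ∫ s in Iic u, (Real.exp (m * s) * W s - Real.exp (m * s) * V s) := by
    intro u
    rw [integral_sub (hW.int hm u) (hV.int hm u), pfPhi, pfPhi]; ring
  rw [e, e, ← mul_assoc, ← Real.exp_add]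
  have : m * h + -m * t = -m * (t - h) := by ring
  rw [this]
  apply mul_le_mul_of_nonneg_left _ (Real.exp_pos _).le
  apply setIntegral_mono_set ((hW.int hm t).sub (hV.int hm t))
  · refine ae_of_all _ fun s => ?_
    have := mul_le_mul_of_nonneg_left (hVW s) (Real.exp_pos (m * s)).le
    exact sub_nonneg.2 this
  · exact (Iic_subset_Iic.2 (by linarith)).eventuallyLE

lemma pfPhi_eq (hm : 0 < m) (hV : PfB V) (t : ℝ) : pfPhi m V t =
    Real.exp (-m * t) * ((∫ s in Iic (0:ℝ), Real.exp (m * s) * V s) + ∫ s in (0:ℝ)..t, Real.exp (m * s) * V s) := by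
  rw [pfPhi, ← intervalIntegral.integral_Iic_sub_Iic (hV.int hm 0) (hV.int hm t)]
  ring_nf

lemma pfPhi_cont (hm : 0 < m) (hV : PfB V) : Continuous (pfPhi m V) := by
  rw [funext (pfPhi_eq hm hV)]
  have := intervalIntegral.continuous_primitive (hV.intI hm) 0
  fun_prop

lemma pfPhi_deriv (hm : 0 < m) (hV : PfB V) (hc : Continuous V) (t : ℝ) :
    HasDerivAt (pfPhi m V) (V t - m * pfPhi m V t) t := by
  have hc2 : Continuous (fun s => Real.exp (m * s) * V s) := by fun_prop
  have h1 := ((hc2.integral_hasStrictDerivAt 0 t).hasDerivAt).const_add (∫ s in Iic (0:ℝ), Real.exp (m * s) * V s)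
  have h2 := pf_exp_mul_hasDeriv (-m) t h1
  rw [funext (pfPhi_eq hm hV)]
  refine h2.congr_deriv ?_
  have := pf_exp_neg_mul m t
  have e : Real.exp (-m * t) * (Real.exp (m * t) * V t) = V t := by rw [← mul_assoc, this, one_mul]
  rw [mul_add, e]; ring

lemma pfPhi_dct (hm : 0 < m) {Vn : ℕ → ℝ → ℝ} {M : ℝ} (hmeas : ∀ j, Measurable (Vn j))
    (hb : ∀ j t, |Vn j t| ≤ M) (hl : ∀ t, Tendsto (fun j => Vn j t) atTop (nhds (V t))) (t : ℝ) :
    Tendsto (fun j => pfPhi m (Vn j) t) atTop (nhds (pfPhi m V t)) := by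
  apply Tendsto.const_mul
  apply tendsto_integral_of_dominated_convergence (fun s => Real.exp (m * s) * M)
  · intro j
    exact ((by fun_prop : Measurable (fun s => Real.exp (m * s))).mul (hmeas j)).aestronglyMeasurable
  · exact (integrableOn_exp_mul_Iic hm t).mul_const M
  · intro j
    refine ae_of_all _ fun s => ?_
    rw [norm_mul, Real.norm_eq_abs, Real.norm_eq_abs, abs_of_pos (Real.exp_pos _)]
    exact mul_le_mul_of_nonneg_left (hb j s) (Real.exp_pos _).le
  · exact ae_of_all _ fun s => (hl s).const_mul _

lemma pfPhi_unique (hm : 0 < m) (hV : PfB V) {S : ℝ → ℝ} (c : ℝ) (hS : Continuous S)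
    (hd : ∀ t, t ≠ c → HasDerivAt S (V t - m * S t) t)
    (h0 : Tendsto (fun t => Real.exp (m * t) * S t) atBot (nhds 0)) (t : ℝ) : pfPhi m V t = S t := by
  have h1 : ∀ u, ∫ s in u..t, Real.exp (m * s) * V s = Real.exp (m * t) * S t - Real.exp (m * u) * S u := by
    intro u
    apply integral_eq_of_hasDerivAt_off_countable (fun t => Real.exp (m * t) * S t) _ (s := {c}) (countable_singleton c)
    · fun_prop
    · intro x hx
      exact (pf_exp_mul_hasDeriv m x (hd x hx.2)).congr_deriv (by ring)
    · exact hV.intI hm u t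
  have h2 := intervalIntegral_tendsto_integral_Iic t (hV.int hm t) (tendsto_id (α := ℝ) (x := atBot))
  simp only [id, h1] at h2
  have h3 := tendsto_nhds_unique h2 (h0.const_sub _)
  rw [pfPhi, h3, sub_zero, ← mul_assoc, pf_exp_neg_mul, one_mul]

/-- the second operator -/
def pfH (g : ℝ → ℝ) (K m h : ℝ) (V : ℝ → ℝ) (t : ℝ) : ℝ := K * pfPhi m V t + g (pfPhi m V (t - h))

def pfT (g : ℝ → ℝ) (a K m h : ℝ) (V : ℝ → ℝ) (t : ℝ) : ℝ :=
  pfPhi (1 / a + m) (fun s => pfH g K m h V (-s) / a) (-t)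

variable {g : ℝ → ℝ} {a K h : ℝ}

lemma pfH_cont (hg : Continuous g) (hm : 0 < m) (hV : PfB V) : Continuous (pfH g K m h V) := by
  have := pfPhi_cont hm hV
  unfold pfH
  fun_prop

lemma pfPhi_bdd (hm : 0 < m) {M : ℝ} (hV : Measurable V) (hM : ∀ t, |V t| ≤ M) (t : ℝ) :
    |pfPhi m V t| ≤ M / m := by
  have hB : PfB V := ⟨hV, M, hM⟩
  rw [abs_le]
  constructor
  · have := pfPhi_ge hm hB (c := -M) (t := t) (fun s _ => (abs_le.1 (hM s)).1)
    rwa [neg_div] at this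
  · exact pfPhi_le hm hB (fun s _ => (abs_le.1 (hM s)).2)

lemma pfH_bdd (hg : Continuous g) (hm : 0 < m) (M : ℝ) : ∃ N, ∀ V : ℝ → ℝ, Measurable V →
    (∀ t, |V t| ≤ M) → ∀ t, |pfH g K m h V t| ≤ N := by
  obtain ⟨C, hC⟩ := (isCompact_Icc (a := -(M / m)) (b := M / m)).exists_bound_of_continuousOn hg.continuousOn
  refine ⟨|K| * (M / m) + C, fun V hV hM t => ?_⟩
  unfold pfH
  refine (abs_add_le _ _).trans ?_
  rw [abs_mul]
  have e1 := mul_le_mul_of_nonneg_left (pfPhi_bdd hm hV hM t) (abs_nonneg K)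
  have e2 := hC (pfPhi m V (t - h)) (abs_le.1 (pfPhi_bdd hm hV hM (t - h)))
  rw [Real.norm_eq_abs] at e2
  linarith

lemma pfHB (ha : 0 < a) (hg : Continuous g) (hm : 0 < m) (hV : PfB V) :
    PfB (fun s => pfH g K m h V (-s) / a) := by
  obtain ⟨M, hM⟩ := hV.2
  obtain ⟨N, hN⟩ := pfH_bdd (g := g) (K := K) (h := h) hg hm M
  refine ⟨?_, N / a, fun t => ?_⟩
  · have := pfH_cont (K := K) (h := h) hg hm hV
    exact (by fun_prop : Continuous (fun s => pfH g K m h V (-s) / a)).measurable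
  · rw [abs_div, abs_of_pos ha]
    exact div_le_div_of_nonneg_right (hN V hV.1 hM _) ha.le

lemma pfT_deriv (ha : 0 < a) (hg : Continuous g) (hm : 0 < m) (hV : PfB V) (t : ℝ) :
    HasDerivAt (pfT g a K m h V) ((1 / a + m) * pfT g a K m h V t - pfH g K m h V t / a) t := by
  have hn : 0 < 1 / a + m := by positivity
  have hc := pfH_cont (K := K) (h := h) hg hm hV
  have h1 := pfPhi_deriv hn (pfHB (K := K) (h := h) ha hg hm hV) (by fun_prop) (-t)
  have h2 := h1.comp t (hasDerivAt_neg t)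
  refine h2.congr_deriv ?_
  simp only [neg_neg, pfT]; ring

lemma pfT_cont (ha : 0 < a) (hg : Continuous g) (hm : 0 < m) (hV : PfB V) : Continuous (pfT g a K m h V) :=
  continuous_iff_continuousAt.2 fun t => (pfT_deriv ha hg hm hV t).continuousAt

lemma pfT_le (ha : 0 < a) (hg : Continuous g) (hm : 0 < m) (hV : PfB V) {c t : ℝ}
    (h1 : ∀ s, t ≤ s → pfH g K m h V s ≤ (a * m ^ 2 + m) * c) : pfT g a K m h V t ≤ m * c := by
  have hn : 0 < 1 / a + m := by positivity
  have := pfPhi_le hn (pfHB (K := K) (h := h) ha hg hm hV) (c := (a * m ^ 2 + m) * c / a) (t := -t)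
    (fun s hs => div_le_div_of_nonneg_right (h1 (-s) (by linarith)) ha.le)
  refine this.trans (le_of_eq ?_)
  field_simp
  ring

lemma pfT_ge (ha : 0 < a) (hg : Continuous g) (hm : 0 < m) (hV : PfB V) {c t : ℝ}
    (h1 : ∀ s, t ≤ s → (a * m ^ 2 + m) * c ≤ pfH g K m h V s) : m * c ≤ pfT g a K m h V t := by
  have hn : 0 < 1 / a + m := by positivity
  have := pfPhi_ge hn (pfHB (K := K) (h := h) ha hg hm hV) (c := (a * m ^ 2 + m) * c / a) (t := -t)
    (fun s hs => div_le_div_of_nonneg_right (h1 (-s) (by linarith)) ha.le)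
  refine (le_of_eq ?_).trans this
  field_simp
  ring

lemma pfT_mono (ha : 0 < a) (hg : Continuous g) (hm : 0 < m) (hV : PfB V) (hW : PfB W)
    (h1 : ∀ s, pfH g K m h V s ≤ pfH g K m h W s) (t : ℝ) : pfT g a K m h V t ≤ pfT g a K m h W t := by
  have hn : 0 < 1 / a + m := by positivity
  exact pfPhi_mono hn (pfHB ha hg hm hV) (pfHB ha hg hm hW)
    (fun s _ => div_le_div_of_nonneg_right (h1 (-s)) ha.le)

lemma pfT_dct (ha : 0 < a) (hg : Continuous g) (hm : 0 < m) {Vn : ℕ → ℝ → ℝ} {M : ℝ} (hmeas : ∀ j, Measurable (Vn j))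
    (hb : ∀ j t, |Vn j t| ≤ M) (hl : ∀ t, Tendsto (fun j => Vn j t) atTop (nhds (V t))) (t : ℝ) :
    Tendsto (fun j => pfT g a K m h (Vn j) t) atTop (nhds (pfT g a K m h V t)) := by
  have hn : 0 < 1 / a + m := by positivity
  obtain ⟨N, hN⟩ := pfH_bdd (g := g) (K := K) (h := h) hg hm M
  apply pfPhi_dct hn (M := N / a)
  · intro j
    exact (pfHB ha hg hm ⟨hmeas j, M, hb j⟩).1
  · intro j s
    rw [abs_div, abs_of_pos ha]
    exact div_le_div_of_nonneg_right (hN _ (hmeas j) (hb j) _) ha.le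
  · intro s
    apply Tendsto.div_const
    unfold pfH
    exact ((pfPhi_dct hm hmeas hb hl _).const_mul K).add
      ((hg.tendsto _).comp (pfPhi_dct hm hmeas hb hl _))

end

section
variable {g : ℝ → ℝ} {κ θ A δ γ b k L a h m : ℝ} {V W V0 : ℝ → ℝ}

lemma pfH_mono (G : PfG g κ θ A δ γ b k L) (hm : 0 < m) (hh : 0 ≤ h) {K : ℝ}
    (hK : k * Real.exp (m * h) ≤ K) (hV : PfB V) (hW : PfB W) (hVW : ∀ s, V s ≤ W s)
    (h0 : ∀ s, 0 ≤ pfPhi m V s) (h1 : ∀ s, pfPhi m W s ≤ κ) (t : ℝ) :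
    pfH g K m h V t ≤ pfH g K m h W t := by
  unfold pfH
  have e1 := pfPhi_diff hm hV hW hVW hh t
  have e2 := pfPhi_mono hm hV hW (t := t) (fun s _ => hVW s)
  have e3 := pfPhi_mono hm hV hW (t := t - h) (fun s _ => hVW s)
  have e4 := G.Q _ _ (h0 (t - h)) e3 (h1 _)
  have e5 := mul_le_mul_of_nonneg_left e1 G.k0.le
  have e6 := mul_le_mul_of_nonneg_right hK (sub_nonneg.2 e2)
  nlinarith

lemma pf_iterate (G : PfG g κ θ A δ γ b k L) (ha : 0 < a) (hm : 0 < m) (hh : 0 ≤ h) {K : ℝ}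
    (hKd : K = a * m ^ 2 + m - 1) (hK : k * Real.exp (m * h) ≤ K)
    (hV0 : Measurable V0) (hV00 : ∀ t, 0 ≤ V0 t) (hV0κ : ∀ t, V0 t ≤ m * κ)
    (hsup : ∀ t, pfT g a K m h V0 t ≤ V0 t) :
    ∃ V : ℝ → ℝ, PfB V ∧ (∀ t, 0 ≤ V t) ∧ (∀ t, V t ≤ V0 t) ∧ (∀ t, V t = pfT g a K m h V t) ∧
      ∀ Vs : ℝ → ℝ, PfB Vs → (∀ t, Vs t ≤ V0 t) → (∀ t, 0 ≤ pfPhi m Vs t) →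
        (∀ t, Vs t ≤ pfT g a K m h Vs t) → ∀ t, Vs t ≤ V t := by
  have hκ : 0 < κ := by linarith [G.δ0, G.δθ, G.θκ]
  have hK0 : 0 < K := by have := G.k0; have : 0 < k * Real.exp (m * h) := by positivity
                         linarith
  set Vn : ℕ → ℝ → ℝ := fun j => (fun V => pfT g a K m h V)^[j] V0 with hVn
  have hVz : Vn 0 = V0 := rfl
  have hVs : ∀ j, Vn (j + 1) = pfT g a K m h (Vn j) := fun j => by
    simp only [hVn, Function.iterate_succ_apply']
  have hBB : ∀ V : ℝ → ℝ, Measurable V → (∀ t, 0 ≤ V t) → (∀ t, V t ≤ V0 t) →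
      PfB V ∧ (∀ t, 0 ≤ pfPhi m V t) ∧ (∀ t, pfPhi m V t ≤ κ) := by
    intro V h1 h2 h3
    have hB : PfB V := ⟨h1, m * κ, fun t => by rw [abs_of_nonneg (h2 t)]; exact (h3 t).trans (hV0κ t)⟩
    refine ⟨hB, fun t => ?_, fun t => ?_⟩
    · have := pfPhi_ge hm hB (c := 0) (t := t) (fun s _ => h2 s)
      simpa using this
    · have := pfPhi_le hm hB (c := m * κ) (t := t) (fun s _ => (h3 s).trans (hV0κ s))
      have e : m * κ / m = κ := by field_simp
      rwa [e] at this
  have hT0 : ∀ V : ℝ → ℝ, Measurable V → (∀ t, 0 ≤ V t) → (∀ t, V t ≤ V0 t) → ∀ t, 0 ≤ pfT g a K m h V t := by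
    intro V h1 h2 h3 t
    obtain ⟨q1, q2, q3⟩ := hBB V h1 h2 h3
    have := pfT_ge (K := K) (h := h) ha G.cont hm q1 (c := 0) (t := t) (fun s _ => by
      unfold pfH
      have := mul_nonneg hK0.le (q2 s)
      have := G.nonneg _ (q2 (s - h))
      linarith)
    linarith
  have key : ∀ j, Measurable (Vn j) ∧ (∀ t, 0 ≤ Vn j t) ∧ (∀ t, Vn j t ≤ V0 t) ∧ (∀ t, Vn (j + 1) t ≤ Vn j t) := by
    intro j
    induction j with
    | zero => exact ⟨hV0, hV00, fun t => le_rfl, fun t => by rw [hVs, hVz]; exact hsup t⟩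
    | succ j ih =>
      obtain ⟨i1, i2, i3, i4⟩ := ih
      obtain ⟨q1, q2, q3⟩ := hBB _ i1 i2 i3
      have hmeas : Measurable (Vn (j + 1)) := by
        rw [hVs]; exact (pfT_cont ha G.cont hm q1).measurable
      have hnn : ∀ t, 0 ≤ Vn (j + 1) t := by
        rw [hVs]; exact hT0 _ i1 i2 i3
      have hle : ∀ t, Vn (j + 1) t ≤ V0 t := fun t => (i4 t).trans (i3 t)
      obtain ⟨p1, p2, p3⟩ := hBB _ hmeas hnn hle
      refine ⟨hmeas, hnn, hle, fun t => ?_⟩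
      rw [hVs (j + 1)]
      nth_rewrite 2 [hVs j]
      exact pfT_mono ha G.cont hm p1 q1 (pfH_mono G hm hh hK p1 q1 i4 p2 q3) t
  have hanti : ∀ t, Antitone (fun j => Vn j t) := fun t => antitone_nat_of_succ_le fun j => (key j).2.2.2 t
  have hlim : ∀ t, Tendsto (fun j => Vn j t) atTop (nhds (⨅ j, Vn j t)) := fun t =>
    tendsto_atTop_ciInf (hanti t) ⟨0, by rintro _ ⟨j, rfl⟩; exact (key j).2.1 t⟩
  set V : ℝ → ℝ := fun t => ⨅ j, Vn j t with hV
  have hVm : Measurable V := measurable_of_tendsto_metrizable (fun j => (key j).1) (tendsto_pi_nhds.2 hlim)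
  have hVp : ∀ t, 0 ≤ V t := fun t => ge_of_tendsto' (hlim t) (fun j => (key j).2.1 t)
  have hVle : ∀ t, V t ≤ V0 t := fun t => le_of_tendsto' (hlim t) (fun j => (key j).2.2.1 t)
  obtain ⟨hVB, hV2, hV3⟩ := hBB V hVm hVp hVle
  refine ⟨V, hVB, hVp, hVle, fun t => ?_, ?_⟩
  · have h1 := pfT_dct (K := K) (h := h) ha G.cont hm (M := m * κ) (fun j => (key j).1)
      (fun j t => by rw [abs_of_nonneg ((key j).2.1 t)]; exact ((key j).2.2.1 t).trans (hV0κ t)) hlim t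
    have h2 := (hlim t).comp (tendsto_add_atTop_nat 1)
    refine tendsto_nhds_unique h2 (h1.congr fun j => ?_)
    simp only [Function.comp, hVs]
  · intro Vs hVsB hVs0 hVsΦ hVsub
    have : ∀ j t, Vs t ≤ Vn j t := by
      intro j
      induction j with
      | zero => exact hVs0
      | succ j ih =>
        intro t
        obtain ⟨i1, i2, i3, i4⟩ := key j
        obtain ⟨q1, q2, q3⟩ := hBB _ i1 i2 i3
        refine (hVsub t).trans ?_
        rw [hVs]
        exact pfT_mono ha G.cont hm hVsB q1 (pfH_mono G hm hh hK hVsB q1 ih hVsΦ q3) t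
    exact fun t => ge_of_tendsto' (hlim t) (fun j => this j t)

/-- sub-solution -/
lemma pf_sub (G : PfG g κ θ A δ γ b k L) (ha : 0 < a) (hm : 0 < m) (hh : 0 ≤ h) {K : ℝ}
    (hKd : K = a * m ^ 2 + m - 1) (hK0 : 0 ≤ K) {z2 z β τ : ℝ} (hz2 : 0 < z2) (hz : z2 < z)
    (hzγ : z ≤ (1 + γ) * z2) (hP2 : PfP a b h z2 = 0) {p : ℝ} (hP : PfP a b h z ≤ -p)
    (hβ : 0 < β) (hβδ : β ≤ δ) (hβp : A * β ^ γ ≤ p) :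
    ∃ Vs s : ℝ → ℝ, PfB Vs ∧ (∀ t, pfPhi m Vs t = s t) ∧ (∀ t, 0 ≤ s t) ∧
      (∀ t, t ≤ τ → s t = β * (Real.exp (z2 * (t - τ)) - Real.exp (z * (t - τ)))) ∧
      (∀ t, Vs t ≤ pfT g a K m h Vs t) ∧
      (∀ t, t ≤ τ → Vs t ≤ β * ((z2 + m) * Real.exp (z2 * (t - τ)))) ∧ (∀ t, τ < t → Vs t = 0) := by
  set S : ℝ → ℝ := fun t => β * (Real.exp (z2 * (t - τ)) - Real.exp (z * (t - τ))) with hS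
  set U : ℝ → ℝ := fun t => β * ((z2 + m) * Real.exp (z2 * (t - τ)) - (z + m) * Real.exp (z * (t - τ))) with hU
  set U1 : ℝ → ℝ := fun t => β * ((z2 + m) * (z2 * Real.exp (z2 * (t - τ))) - (z + m) * (z * Real.exp (z * (t - τ)))) with hU1
  have hed : ∀ w t : ℝ, HasDerivAt (fun t => Real.exp (w * (t - τ))) (w * Real.exp (w * (t - τ))) t := by
    intro w t
    have := (((hasDerivAt_id t).sub_const τ).const_mul w).exp
    exact this.congr_deriv (by simp only [id]; ring)
  have hSd : ∀ t, HasDerivAt S (U t - m * S t) t := fun t =>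
    (((hed z2 t).sub (hed z t)).const_mul β).congr_deriv (by simp only [hU, hS]; ring)
  have hUd : ∀ t, HasDerivAt U (U1 t) t := fun t =>
    ((((hed z2 t).const_mul (z2 + m)).sub ((hed z t).const_mul (z + m))).const_mul β)
  have hUc : Continuous U := continuous_iff_continuousAt.2 fun t => (hUd t).continuousAt
  have hSc : Continuous S := continuous_iff_continuousAt.2 fun t => (hSd t).continuousAt
  have hSτ : S τ = 0 := by simp [hS]
  have hexp : ∀ t, t ≤ τ → Real.exp (z * (t - τ)) ≤ Real.exp (z2 * (t - τ)) := by
    intro t ht; apply Real.exp_le_exp.2; nlinarith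
  have hexp1 : ∀ w t : ℝ, 0 < w → t ≤ τ → Real.exp (w * (t - τ)) ≤ 1 := by
    intro w t hw ht; apply Real.exp_le_one_iff.2; nlinarith
  set Vs : ℝ → ℝ := fun t => if t ≤ τ then U t else 0 with hVs
  set s : ℝ → ℝ := fun t => if t ≤ τ then S t else 0 with hs
  have hVsB : PfB Vs := by
    refine ⟨Measurable.ite measurableSet_Iic hUc.measurable measurable_const, β * ((z2 + m) + (z + m)), fun t => ?_⟩
    simp only [hVs]
    have hz0 : 0 < z := by linarith
    split_ifs with ht
    · have e1 := hexp1 z2 t hz2 ht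
      have e2 := hexp1 z t hz0 ht
      simp only [hU]
      rw [abs_mul, abs_of_pos hβ]
      apply mul_le_mul_of_nonneg_left _ hβ.le
      have e3 := mul_le_mul_of_nonneg_left e1 (by linarith : 0 ≤ z2 + m)
      have e4 := mul_le_mul_of_nonneg_left e2 (by linarith : 0 ≤ z + m)
      have e5 : 0 < (z2 + m) * Real.exp (z2 * (t - τ)) := by positivity
      have e6 : 0 < (z + m) * Real.exp (z * (t - τ)) := by positivity
      rw [abs_le]; constructor <;> linarith
    · rw [abs_zero]; positivity
  have hs0 : ∀ t, 0 ≤ s t := by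
    intro t
    simp only [hs]
    split_ifs with ht
    · exact mul_nonneg hβ.le (by linarith [hexp t ht])
    · exact le_rfl
  have hsc : Continuous s := by
    apply Continuous.if_le hSc continuous_const continuous_id continuous_const
    intro x hx
    have hx2 : x = τ := hx
    rw [hx2]; exact hSτ
  have hSb : ∀ t, t ≤ τ → S t ≤ β * Real.exp (z2 * (t - τ)) := by
    intro t ht
    simp only [hS]
    have := Real.exp_pos (z * (t - τ))
    nlinarith
  have hΦ : ∀ t, pfPhi m Vs t = s t := by
    apply pfPhi_unique hm hVsB τ hsc
    · intro t ht
      rcases lt_or_gt_of_ne ht with h1 | h1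
      · have e1 : s =ᶠ[nhds t] S := by
          filter_upwards [Iio_mem_nhds h1] with x hx
          simp only [hs, if_pos (le_of_lt (mem_Iio.1 hx))]
        have e2 : Vs t - m * s t = U t - m * S t := by
          simp only [hs, hVs, if_pos h1.le]
        rw [e2]
        exact (hSd t).congr_of_eventuallyEq e1
      · have e1 : s =ᶠ[nhds t] fun _ => 0 := by
          filter_upwards [Ioi_mem_nhds h1] with x hx
          simp only [hs, if_neg (not_le.2 (mem_Ioi.1 hx))]
        have e2 : Vs t - m * s t = 0 := by
          simp only [hs, hVs, if_neg (not_le.2 h1)]; ring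
        rw [e2]
        exact (hasDerivAt_const t (0:ℝ)).congr_of_eventuallyEq e1
    · apply squeeze_zero' (g := fun t => Real.exp (m * t) * β)
      · exact Eventually.of_forall fun t => mul_nonneg (Real.exp_pos _).le (hs0 t)
      · filter_upwards [eventually_le_atBot τ] with t ht
        apply mul_le_mul_of_nonneg_left _ (Real.exp_pos _).le
        simp only [hs, if_pos ht]
        have := hexp1 z2 t hz2 ht
        have := hSb t ht
        nlinarith
      · simpa using (pf_tendsto_exp_bot hm).mul_const β
  have hTnn : ∀ t, 0 ≤ pfT g a K m h Vs t := by
    intro t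
    have := pfT_ge (K := K) (h := h) ha G.cont hm hVsB (c := 0) (t := t) (fun x _ => by
      unfold pfH
      rw [hΦ, hΦ]
      have := mul_nonneg hK0 (hs0 x)
      have := G.nonneg _ (hs0 (x - h))
      linarith)
    linarith
  refine ⟨Vs, s, hVsB, hΦ, hs0, fun t ht => by simp only [hs, if_pos ht, hS], ?_, ?_, ?_⟩
  · have hanti : AntitoneOn (fun t => Real.exp (-(1 / a + m) * t) * (pfT g a K m h Vs t - U t)) (Iic τ) := by
      apply pf_anti (convex_Iic _) (fun t _ => pf_exp_mul_hasDeriv _ t ((pfT_deriv ha G.cont hm hVsB t).sub (hUd t)))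
      intro t ht
      have ht := mem_Iic.1 ht
      apply mul_nonpos_of_nonneg_of_nonpos (Real.exp_pos _).le
      have e0 : pfH g K m h Vs t = K * S t + g (S (t - h)) := by
        unfold pfH
        rw [hΦ, hΦ]
        simp only [hs, if_pos ht, if_pos (by linarith : t - h ≤ τ)]
      have hsd : 0 ≤ S (t - h) := mul_nonneg hβ.le (by linarith [hexp (t - h) (by linarith)])
      set X := Real.exp (z2 * (t - τ)) with hX
      set Y := Real.exp (z * (t - τ)) with hY
      have hXp : 0 < X := Real.exp_pos _
      have hYp : 0 < Y := Real.exp_pos _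
      have d1 : S (t - h) = β * (Real.exp (-(z2 * h)) * X - Real.exp (-(z * h)) * Y) := by
        simp only [hS, hX, hY]
        rw [← Real.exp_add, ← Real.exp_add]; ring_nf
      have d2 : S (t - h) ≤ β * X := by
        have : Real.exp (-(z2 * h)) ≤ 1 := Real.exp_le_one_iff.2 (by nlinarith)
        have := Real.exp_pos (-(z * h))
        rw [d1]
        apply mul_le_mul_of_nonneg_left _ hβ.le
        nlinarith
      have hX1 : X ≤ 1 := hexp1 z2 t hz2 ht
      have d3 : S (t - h) ≤ δ := by nlinarith
      have d4 := (abs_le.1 (G.hol _ hsd d3)).1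
      have d5 : A * S (t - h) ^ (1 + γ) ≤ p * (β * Y) := by
        have hγ := G.γ0
        have hA := G.A0
        have q1 : S (t - h) ^ (1 + γ) ≤ (β * X) ^ (1 + γ) := Real.rpow_le_rpow hsd d2 (by linarith)
        rw [Real.mul_rpow hβ.le hXp.le, Real.rpow_add hβ, Real.rpow_one, hX, ← Real.exp_mul] at q1
        have q2 : Real.exp (z2 * (t - τ) * (1 + γ)) ≤ Y := by
          apply Real.exp_le_exp.2; nlinarith
        calc A * S (t - h) ^ (1 + γ) ≤ A * (β * β ^ γ * Y) := by
              have : β * β ^ γ * Real.exp (z2 * (t - τ) * (1 + γ)) ≤ β * β ^ γ * Y := by gcongr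
              exact mul_le_mul_of_nonneg_left (q1.trans this) hA.le
          _ = A * β ^ γ * (β * Y) := by ring
          _ ≤ _ := by gcongr
      have e1 : -(1 / a + m) * (pfT g a K m h Vs t - U t) +
          ((1 / a + m) * pfT g a K m h Vs t - pfH g K m h Vs t / a - U1 t) =
          ((1 + a * m) * U t - a * U1 t - pfH g K m h Vs t) / a := by field_simp; ring
      refine e1.trans_le ?_
      apply div_nonpos_of_nonpos_of_nonneg _ ha.le
      rw [e0]
      have e2 : (1 + a * m) * U t - a * U1 t - K * S t - b * S (t - h) =
          - (β * (PfP a b h z2 * X - PfP a b h z * Y)) := by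
        rw [d1]; simp only [hU, hU1, hS, PfP, hKd, ← hX, ← hY]; ring
      rw [hP2] at e2
      have e3 : β * (PfP a b h z * Y) ≤ - (p * (β * Y)) := by
        have := mul_le_mul_of_nonneg_right hP (mul_pos hβ hYp).le
        linarith
      linarith
    intro t
    by_cases ht : t ≤ τ
    · simp only [hVs, if_pos ht]
      have e1 := hanti (mem_Iic.2 ht) (mem_Iic.2 le_rfl) ht
      have e2 : 0 ≤ pfT g a K m h Vs τ - U τ := by
        have : U τ = β * (z2 - z) := by simp [hU]
        have : U τ ≤ 0 := by rw [this]; nlinarith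
        linarith [hTnn τ]
      have e3 := (mul_nonneg (Real.exp_pos (-(1 / a + m) * τ)).le e2).trans e1
      have := nonneg_of_mul_nonneg_right e3 (Real.exp_pos _)
      linarith
    · have : Vs t = 0 := by simp only [hVs, if_neg ht]
      rw [this]; exact hTnn t
  · intro t ht
    simp only [hVs, if_pos ht, hU]
    have : 0 < (z + m) * Real.exp (z * (t - τ)) := by
      have : 0 < z := by linarith
      positivity
    nlinarith
  · intro t ht
    simp only [hVs, if_neg (not_le.2 ht)]
end

section
variable {g : ℝ → ℝ} {κ θ A δ γ b k L a h m : ℝ} {V W V0 : ℝ → ℝ}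

lemma pf_to_kappa (G : PfG g κ θ A δ γ b k L) (ha : 0 < a) (hm : 0 < m) (hh : 0 ≤ h) {K : ℝ}
    (hKd : K = a * m ^ 2 + m - 1) (hK0 : 0 ≤ K) (hV : PfB V) (hVc : Continuous V)
    (hVT : ∀ t, V t = pfT g a K m h V t) (hle : ∀ t, pfPhi m V t ≤ κ) {q T0 : ℝ} (hq : 0 < q)
    (hlow : ∀ t, T0 ≤ t → q ≤ pfPhi m V t) : Tendsto (pfPhi m V) atTop (nhds κ) := by
  set ψ := pfPhi m V with hψ
  set E : Set ℝ := {q | ∀ᶠ t in atTop, q ≤ ψ t} with hE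
  have hEb : ∀ q ∈ E, q ≤ κ := by
    intro q hq
    obtain ⟨t, ht⟩ := (hq : ∀ᶠ t in atTop, q ≤ ψ t).exists
    exact ht.trans (hle t)
  have hBA : BddAbove E := ⟨κ, hEb⟩
  have hqE : q ∈ E := eventually_atTop.2 ⟨T0, hlow⟩
  have hp0 : q ≤ sSup E := le_csSup hBA hqE
  have hpκ : sSup E ≤ κ := csSup_le ⟨q, hqE⟩ hEb
  set p := sSup E with hp
  have hpE : ∀ η, 0 < η → ∀ᶠ t in atTop, p - η ≤ ψ t := by
    intro η hη
    obtain ⟨r, hr, hr2⟩ := exists_lt_of_lt_csSup ⟨q, hqE⟩ (by linarith : p - η < sSup E)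
    filter_upwards [(hr : ∀ᶠ t in atTop, r ≤ ψ t)] with t ht
    linarith
  have hpeq : p = κ := by
    by_contra hne
    have hlt : p < κ := lt_of_le_of_ne hpκ hne
    obtain ⟨u0, hu0, hmin⟩ := (isCompact_Icc (a := p) (b := κ)).exists_isMinOn ⟨p, le_rfl, hpκ⟩ G.cont.continuousOn
    have hg0 : p < g u0 := by
      rcases hu0.2.lt_or_eq with h1 | h1
      · exact lt_of_le_of_lt hu0.1 (G.gt u0 (by linarith [hu0.1]) h1)
      · rw [h1, G.gk]; exact hlt
    set η := (g u0 - p) / 2 with hη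
    have hηp : 0 < η := by rw [hη]; linarith
    have hL := G.L0
    set η1 := min p (min (η / L) (η / (2 * (K + 1)))) with hη1
    have hη1p : 0 < η1 := by
      rw [hη1]; refine lt_min (by linarith) (lt_min (by positivity) (by positivity))
    have h1 : η1 ≤ p := min_le_left _ _
    have h2 : L * η1 ≤ η := by
      have : η1 ≤ η / L := (min_le_right _ _).trans (min_le_left _ _)
      rw [le_div_iff₀ hL] at this; linarith
    have h3 : K * η1 ≤ η / 2 := by
      have : η1 ≤ η / (2 * (K + 1)) := (min_le_right _ _).trans (min_le_right _ _)
      rw [le_div_iff₀ (by positivity)] at this; nlinarith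
    have hgl : ∀ u, p - η1 ≤ u → u ≤ κ → p + η ≤ g u := by
      intro u hu1 hu2
      by_cases hu : p ≤ u
      · have : g u0 ≤ g u := hmin ⟨hu, hu2⟩
        linarith
      · push Not at hu
        have e1 : g u0 ≤ g p := hmin ⟨le_rfl, hpκ⟩
        have e2 := G.lip u p (by linarith) hu.le hpκ
        have e3 : L * (p - u) ≤ L * η1 := mul_le_mul_of_nonneg_left (by linarith) hL.le
        linarith
    obtain ⟨T, hT⟩ := eventually_atTop.1 (hpE η1 hη1p)
    set v := p + η / (2 * (1 + K)) with hv
    have hvp : p < v := by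
      have : 0 < η / (2 * (1 + K)) := by positivity
      linarith
    have hVl : ∀ t, T + h ≤ t → m * v ≤ V t := by
      intro t ht
      rw [hVT]
      apply pfT_ge ha G.cont hm hV
      intro s hs
      have e1 := hT s (by linarith)
      have e2 := hgl _ (hT (s - h) (by linarith)) (hle _)
      have e3 := mul_le_mul_of_nonneg_left e1 hK0
      have e4 : (a * m ^ 2 + m) * v = (1 + K) * p + η / 2 := by
        have : a * m ^ 2 + m = 1 + K := by rw [hKd]; ring
        rw [this, hv]; field_simp
      have e5 : pfH g K m h V s = K * ψ s + g (ψ (s - h)) := rfl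
      rw [e4, e5]
      linarith
    have hmono : MonotoneOn (fun t => Real.exp (m * t) * (ψ t - v)) (Ici (T + h)) := by
      apply pf_mono (convex_Ici _) (fun t _ => pf_exp_mul_hasDeriv m t ((pfPhi_deriv hm hV hVc t).sub_const v))
      intro t ht
      apply mul_nonneg (Real.exp_pos _).le
      have := hVl t ht
      have e : m * (ψ t - v) + (V t - m * pfPhi m V t) = V t - m * v := by rw [hψ]; ring
      exact (sub_nonneg.2 this).trans e.ge
    have hev : (v + p) / 2 ∈ E := by
      set C := Real.exp (m * (T + h)) * (ψ (T + h) - v) with hC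
      have ht : Tendsto (fun t => Real.exp (-m * t) * C) atTop (nhds 0) := by
        simpa using (pf_tendsto_exp_top hm).mul_const C
      have h6 := ht.eventually (lt_mem_nhds (by linarith : -((v - p) / 2) < 0))
      change ∀ᶠ t in atTop, (v + p) / 2 ≤ ψ t
      filter_upwards [h6, eventually_ge_atTop (T + h)] with t ht1 ht2
      have e1 := hmono (mem_Ici.2 le_rfl) (mem_Ici.2 ht2) ht2
      have e2 := mul_le_mul_of_nonneg_left e1 (Real.exp_pos (-m * t)).le
      simp only at e2
      rw [← mul_assoc (Real.exp (-m * t)) (Real.exp (m * t)), pf_exp_neg_mul, one_mul] at e2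
      linarith
    have := le_csSup hBA hev
    linarith
  rw [hpeq] at hpE
  rw [Metric.tendsto_nhds]
  intro ε hε
  filter_upwards [hpE (ε / 2) (by linarith)] with t ht
  rw [Real.dist_eq, abs_lt]
  constructor <;> linarith [hle t]

lemma pf_exists_front (G : PfG g κ θ A δ γ b k L) (ha : 0 < a) (hm : 0 < m) (hh : 0 ≤ h) {K : ℝ}
    (hKd : K = a * m ^ 2 + m - 1) (hK : k * Real.exp (m * h) ≤ K)
    (hV0 : Measurable V0) (hV00 : ∀ t, 0 ≤ V0 t) (hV0κ : ∀ t, V0 t ≤ m * κ)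
    (hsup : ∀ t, pfT g a K m h V0 t ≤ V0 t) (hbot : Tendsto (pfPhi m V0) atBot (nhds 0))
    {z2 z p α tc ω : ℝ} (hz2 : 0 < z2) (hz : z2 < z)
    (hzγ : z ≤ (1 + γ) * z2) (hP2 : PfP a b h z2 = 0) (hp : 0 < p) (hP : PfP a b h z ≤ -p)
    (hα : 0 < α) (hω : 0 < ω) (hl : ∀ t, t ≤ tc → α * ((z2 + m) * Real.exp (z2 * t)) ≤ V0 t)
    (hr : ∀ t, tc < t → ω ≤ V0 t) : ∃ ψ ψ1 ψ2 : ℝ → ℝ, PfF g κ a h ψ ψ1 ψ2 := by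
  have hK0 : 0 < K := by have := G.k0; have : 0 < k * Real.exp (m * h) := by positivity
                         linarith
  obtain ⟨d, hd0, hdδ, hdp⟩ := G.small hp
  set β := min d (min α (ω / (z2 + m))) with hβ
  have hβ0 : 0 < β := by
    rw [hβ]; exact lt_min hd0 (lt_min hα (by positivity))
  have hβd : β ≤ d := min_le_left _ _
  have hβα : β ≤ α := (min_le_right _ _).trans (min_le_left _ _)
  have hβω : β * (z2 + m) ≤ ω := by
    have : β ≤ ω / (z2 + m) := (min_le_right _ _).trans (min_le_right _ _)
    rwa [le_div_iff₀ (by positivity)] at this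
  have hβp : A * β ^ γ ≤ p := by
    have e1 := Real.rpow_le_rpow hβ0.le hβd G.γ0.le
    have e2 := mul_le_mul_of_nonneg_left e1 G.A0.le
    linarith
  obtain ⟨V, hVB, hV0', hVle, hVT, hVmax⟩ := pf_iterate G ha hm hh hKd hK hV0 hV00 hV0κ hsup
  have hV0B : PfB V0 := ⟨hV0, m * κ, fun t => by rw [abs_of_nonneg (hV00 t)]; exact hV0κ t⟩
  have hVc : Continuous V := by
    rw [funext hVT]; exact pfT_cont ha G.cont hm hVB
  set ψ := pfPhi m V with hψ
  have hψl : ∀ τ t, 0 ≤ τ → t ≤ τ → β * (Real.exp (z2 * (t - τ)) - Real.exp (z * (t - τ))) ≤ ψ t := by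
    intro τ t hτ htτ
    obtain ⟨Vs, s, s1, s2, s3, s4, s5, s6, s7⟩ := pf_sub (τ := τ) G ha hm hh hKd hK0.le hz2 hz hzγ hP2 hP hβ0
      (hβd.trans hdδ) hβp
    rw [← s4 t htτ, ← s2]
    have hle : ∀ t, Vs t ≤ V t := by
      refine hVmax Vs s1 ?_ (fun t => by rw [s2]; exact s3 t) s5
      intro t
      by_cases h1 : t ≤ τ
      · refine (s6 t h1).trans ?_
        by_cases h2 : t ≤ tc
        · refine le_trans ?_ (hl t h2)
          have e1 : Real.exp (z2 * (t - τ)) ≤ Real.exp (z2 * t) := Real.exp_le_exp.2 (by nlinarith)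
          gcongr
        · refine le_trans ?_ (hr t (not_le.1 h2))
          have e1 : Real.exp (z2 * (t - τ)) ≤ 1 := Real.exp_le_one_iff.2 (by nlinarith)
          have e2 := mul_le_mul_of_nonneg_left e1 (by positivity : 0 ≤ β * (z2 + m))
          linarith
      · rw [s7 t (not_le.1 h1)]; exact hV00 t
    exact pfPhi_mono hm s1 hVB (fun s _ => hle s)
  have hψpos : ∀ t, 0 < ψ t := by
    intro t
    have h1 := hψl (max t 0 + 1) t (by linarith [le_max_right t 0]) (by linarith [le_max_left t 0])
    refine lt_of_lt_of_le (mul_pos hβ0 (sub_pos.2 (Real.exp_lt_exp.2 ?_))) h1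
    have : t - (max t 0 + 1) < 0 := by linarith [le_max_left t 0]
    nlinarith
  have hψκ : ∀ t, ψ t ≤ κ := by
    intro t
    have := pfPhi_le hm hVB (c := m * κ) (t := t) (fun s _ => (hVle s).trans (hV0κ s))
    have e : m * κ / m = κ := by field_simp
    rwa [e] at this
  have hd1 : ∀ t, HasDerivAt ψ (V t - m * ψ t) t := fun t => pfPhi_deriv hm hVB hVc t
  have hdV : ∀ t, HasDerivAt V ((1 / a + m) * V t - pfH g K m h V t / a) t := by
    intro t
    have := pfT_deriv (K := K) (h := h) ha G.cont hm hVB t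
    rw [← funext hVT] at this
    exact this
  refine ⟨ψ, fun t => V t - m * ψ t, fun t => ((1 / a + m) * V t - pfH g K m h V t / a) - m * (V t - m * ψ t),
    hψpos, hd1, fun t => (hdV t).sub ((hd1 t).const_mul m), ?_, ?_, ?_⟩
  · intro t
    have e5 : pfH g K m h V t = K * ψ t + g (ψ (t - h)) := rfl
    rw [e5, hKd]
    field_simp
    ring
  · apply squeeze_zero (fun t => (hψpos t).le) _ hbot
    intro t
    exact pfPhi_mono hm hVB hV0B (fun s _ => hVle s)
  · have hq : 0 < β * (Real.exp (z2 * (-1)) - Real.exp (z * (-1))) :=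
      mul_pos hβ0 (sub_pos.2 (Real.exp_lt_exp.2 (by linarith)))
    apply pf_to_kappa G ha hm hh hKd hK0.le hVB hVc hVT hψκ hq (T0 := 0)
    intro t ht
    have := hψl (t + 1) t (by linarith) (by linarith)
    have e : t - (t + 1) = -1 := by ring
    rwa [e] at this
end

section
variable {g : ℝ → ℝ} {κ θ A δ γ b k L a a0 h m : ℝ} {φ φ1 φ2 : ℝ → ℝ}

lemma PfF.cross (F : PfF g κ a h φ φ1 φ2) {d z m T : ℝ} (hd : 0 < d) (hz : 0 < z)
    (hs : ∀ B, 0 < B → ∀ᶠ t in atBot, B * Real.exp (z * t) < φ t) :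
    ∃ B tc, 0 < B ∧ tc ≤ T ∧ (∀ t, t ≤ tc → B * Real.exp (z * t) < φ t) ∧ (∀ t, t ≤ tc → φ t < d) ∧
      φ1 tc + m * φ tc < B * ((z + m) * Real.exp (z * tc)) := by
  obtain ⟨T1, hT1⟩ := eventually_atBot.1 (F.bot.eventually (gt_mem_nhds hd))
  set TB := min T T1 with hTB
  have hφd : ∀ t, t ≤ TB → φ t < d := fun t ht => hT1 t (ht.trans (min_le_right _ _))
  set B := d * Real.exp (-(z * TB)) with hB
  have hB0 : 0 < B := by positivity
  have hBT : B * Real.exp (z * TB) = d := by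
    rw [hB, mul_assoc, ← Real.exp_add]; simp
  obtain ⟨T2, hT2⟩ := eventually_atBot.1 (hs B hB0)
  set s0 := min TB T2 with hs0
  set f : ℝ → ℝ := fun t => B * Real.exp (z * t) - φ t with hf
  have hfd : ∀ t, HasDerivAt f (B * (z * Real.exp (z * t)) - φ1 t) t := fun t =>
    ((pf_hasDeriv_exp z t).const_mul B).sub (F.d1 t)
  have hfc : Continuous f := continuous_iff_continuousAt.2 fun t => (hfd t).continuousAt
  have hf0 : ∀ t, t ≤ s0 → f t < 0 := by
    intro t ht
    have := hT2 t (ht.trans (min_le_right _ _))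
    simp only [hf]; linarith
  obtain ⟨t1, h1, h2, h3, h4⟩ := pf_first_zero hfc (min_le_left TB T2) (hf0 s0 le_rfl) (by
    simp only [hf]; linarith [hφd TB le_rfl])
  have hwd : ∀ t, HasDerivAt (fun t => Real.exp (m * t) * f t) _ t := fun t => pf_exp_mul_hasDeriv m t (hfd t)
  obtain ⟨tc, htc, hmv⟩ := exists_hasDerivAt_eq_slope (fun t => Real.exp (m * t) * f t) _ h1
    (fun t _ => (hwd t).continuousAt.continuousWithinAt) (fun t _ => hwd t)
  have hpos : 0 < (Real.exp (m * t1) * f t1 - Real.exp (m * s0) * f s0) / (t1 - s0) := by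
    apply div_pos _ (by linarith)
    rw [h3]
    have := mul_neg_of_pos_of_neg (Real.exp_pos (m * s0)) (hf0 s0 le_rfl)
    linarith
  have hmv2 := hmv ▸ hpos
  have hmv3 := (pos_iff_pos_of_mul_pos hmv2).1 (Real.exp_pos _)
  have htcB : tc ≤ TB := htc.2.le.trans h2
  refine ⟨B, tc, hB0, htcB.trans (min_le_left _ _), fun t ht => ?_, fun t ht => hφd t (ht.trans htcB), ?_⟩
  · have : f t < 0 := by
      by_cases hts : t ≤ s0
      · exact hf0 t hts
      · exact h4 t (not_le.1 hts).le (lt_of_le_of_lt ht htc.2)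
    simp only [hf] at this; linarith
  · simp only [hf] at hmv3; linarith

set_option maxHeartbeats 4000000 in
lemma PfF.slow_sup (F : PfF g κ a0 h φ φ1 φ2) (G : PfG g κ θ A δ γ b k L) (ha0 : 0 < a0) (haa : a0 < a)
    (hm : 0 < m) (hh : 0 ≤ h) (hγ1 : γ ≤ 1) {K : ℝ}
    (hKd : K = a * m ^ 2 + m - 1) (hK : k * Real.exp (m * h) ≤ K) {M : ℝ}
    (hM : ∀ t, φ t ≤ M ∧ |φ1 t| ≤ M ∧ |φ2 t| ≤ M) (hφκ : ∀ t, φ t < κ) (hVn : ∀ t, 0 ≤ φ1 t + m * φ t)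
    {tc B α z2 z p ε0 ε2 T' : ℝ} (htc : tc ≤ 0) (hB : 0 < B) (hα : 0 < α) (hz2 : 0 < z2) (hz : z2 < z)
    (hzγ : z ≤ (1 + γ) * z2) (hP2 : PfP a b h z2 = 0) (hp : 0 < p) (hP : PfP a b h z ≤ -p)
    (hε0 : 0 < ε0) (hε2 : 0 < ε2)
    (hE1 : ∀ t, tc - h ≤ t → t ≤ tc → α * Real.exp (z2 * t) + B * Real.exp (z * t) ≤ φ t)
    (hφδ : ∀ t, t ≤ tc → φ t ≤ δ)
    (hε : α * Real.exp (z2 * tc) + B * Real.exp (z * tc) + ε0 ≤ φ tc)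
    (hjump : φ1 tc + m * φ tc + m * ε2 ≤ α * ((z2 + m) * Real.exp (z2 * tc)) + B * ((z + m) * Real.exp (z * tc)))
    (hT' : ∀ t, T' ≤ t → θ ≤ φ t)
    (hmid : (1 + L) * ε2 ≤ K * (ε0 * Real.exp (-m * (T' + h - tc))))
    (hρ : (a - a0) * M ≤ ε2) (hy : A * (B * Real.exp (z * tc)) ^ γ ≤ p / 4) (hx : A * α ^ γ ≤ p / 4)
    (hαB : α ≤ B) (hακ : α * (z2 + m) ≤ m * κ) : ∃ ψ ψ1 ψ2 : ℝ → ℝ, PfF g κ a h ψ ψ1 ψ2 := by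
  have ha : 0 < a := ha0.trans haa
  have hz0 : 0 < z := hz2.trans hz
  have hκ : 0 < κ := by linarith [G.δ0, G.δθ, G.θκ]
  have hk := G.k0
  have hL := G.L0
  have hK0 : 0 < K := by have : 0 < k * Real.exp (m * h) := by positivity
                         linarith
  set E : ℝ → ℝ := fun t => α * Real.exp (z2 * t) + B * Real.exp (z * t) with hE
  set VL : ℝ → ℝ := fun t => α * ((z2 + m) * Real.exp (z2 * t)) + B * ((z + m) * Real.exp (z * t)) with hVL
  set VL1 : ℝ → ℝ := fun t => α * ((z2 + m) * (z2 * Real.exp (z2 * t))) + B * ((z + m) * (z * Real.exp (z * t))) with hVL1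
  set VR : ℝ → ℝ := fun t => φ1 t + m * φ t + m * ε2 with hVR
  set ε := φ tc + ε2 - E tc with hεd
  have hEd : ∀ t, HasDerivAt E (VL t - m * E t) t := fun t =>
    (((pf_hasDeriv_exp z2 t).const_mul α).add ((pf_hasDeriv_exp z t).const_mul B)).congr_deriv
      (by simp only [hVL, hE]; ring)
  have hVLd : ∀ t, HasDerivAt VL (VL1 t) t := fun t =>
    (((pf_hasDeriv_exp z2 t).const_mul (z2 + m)).const_mul α).add
      (((pf_hasDeriv_exp z t).const_mul (z + m)).const_mul B)
  have hVRd : ∀ t, HasDerivAt VR (φ2 t + m * φ1 t) t := fun t =>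
    ((F.d2 t).add ((F.d1 t).const_mul m)).add_const _
  have hEφ : E tc ≤ φ tc := hE1 tc (by linarith) le_rfl
  have hE1 : ∀ t, tc - h ≤ t → t ≤ tc → E t ≤ φ t := hE1
  have hjump : VR tc ≤ VL tc := hjump
  have hεge : ε0 ≤ ε := by simp only [hεd, hE]; linarith
  clear_value E VL VL1 VR ε
  have hEc : Continuous E := continuous_iff_continuousAt.2 fun t => (hEd t).continuousAt
  have hVLc : Continuous VL := continuous_iff_continuousAt.2 fun t => (hVLd t).continuousAt
  have hVRc : Continuous VR := continuous_iff_continuousAt.2 fun t => (hVRd t).continuousAt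
  have hφc : Continuous φ := F.cont
  have hEpos : ∀ t, 0 < E t := fun t => by simp only [hE]; positivity
  have hVLpos : ∀ t, 0 < VL t := fun t => by simp only [hVL]; positivity
  have hVRge : ∀ t, m * ε2 ≤ VR t := fun t => by simp only [hVR]; linarith [hVn t]
  have hEmono : ∀ s t, s ≤ t → E s ≤ E t := by
    intro s t hst; simp only [hE]
    have : Real.exp (z2 * s) ≤ Real.exp (z2 * t) := Real.exp_le_exp.2 (mul_le_mul_of_nonneg_left hst (by positivity))
    have : Real.exp (z * s) ≤ Real.exp (z * t) := Real.exp_le_exp.2 (mul_le_mul_of_nonneg_left hst (by positivity))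
    gcongr
  have hEδ : ∀ t, t ≤ tc → E t ≤ δ := fun t ht => (hEmono t tc ht).trans (hEφ.trans (hφδ tc le_rfl))
  set e : ℝ → ℝ := fun t => ε * Real.exp (-m * (t - tc)) with he
  have hed : ∀ t, HasDerivAt e (-m * e t) t := fun t => by
    have := ((((hasDerivAt_id t).sub_const tc).const_mul (-m)).exp).const_mul ε
    exact this.congr_deriv (by simp only [he, id]; ring)
  clear_value e
  have hε' : 0 < ε := by linarith
  have hepos : ∀ t, 0 < e t := fun t => by simp only [he]; positivity
  set R : ℝ → ℝ := fun t => φ t + ε2 - e t with hR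
  have hRd : ∀ t, HasDerivAt R (VR t - m * R t) t := fun t =>
    (((F.d1 t).add_const ε2).sub (hed t)).congr_deriv (by simp only [hVR, hR]; ring)
  clear_value R
  have hRc : Continuous R := continuous_iff_continuousAt.2 fun t => (hRd t).continuousAt
  set VS : ℝ → ℝ := fun t => if t ≤ tc then VL t else VR t with hVS
  set S : ℝ → ℝ := fun t => if t ≤ tc then E t else R t with hS
  have hVSpos : ∀ t, 0 ≤ VS t := by
    intro t; simp only [hVS]; split_ifs
    · exact (hVLpos t).le
    · exact le_trans (by positivity) (hVRge t)
  have hVLb : ∀ t, t ≤ tc → VL t ≤ VL 0 := by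
    intro t ht; simp only [hVL]
    have : Real.exp (z2 * t) ≤ Real.exp (z2 * 0) := Real.exp_le_exp.2 (mul_le_mul_of_nonneg_left (ht.trans htc) (by positivity))
    have : Real.exp (z * t) ≤ Real.exp (z * 0) := Real.exp_le_exp.2 (mul_le_mul_of_nonneg_left (ht.trans htc) (by positivity))
    gcongr
  have hVRb : ∀ t, VR t ≤ M + m * M + m * ε2 := by
    intro t; obtain ⟨q1, q2, _⟩ := hM t
    have := mul_le_mul_of_nonneg_left q1 hm.le
    simp only [hVR]; linarith [(abs_le.1 q2).2]
  have hM0 : 0 ≤ M := (F.pos 0).le.trans (hM 0).1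
  have hVSm : Measurable VS := Measurable.ite measurableSet_Iic hVLc.measurable hVRc.measurable
  have hVSB : PfB VS := by
    refine ⟨hVSm, VL 0 + (M + m * M + m * ε2), fun t => ?_⟩
    rw [abs_of_nonneg (hVSpos t)]
    have : 0 ≤ M + m * M + m * ε2 := by positivity
    simp only [hVS]; split_ifs with ht
    · linarith [hVLb t ht]
    · linarith [hVRb t, hVLpos 0]
  have hSc : Continuous S := by
    apply Continuous.if_le hEc hRc continuous_id continuous_const
    intro x hx
    have hx2 : x = tc := hx
    rw [hx2]; simp [hR, he, hεd]
  clear_value VS S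
  have hΦS : ∀ t, pfPhi m VS t = S t := by
    apply pfPhi_unique hm hVSB tc hSc
    · intro t ht
      rcases lt_or_gt_of_ne ht with h1 | h1
      · have e1 : S =ᶠ[nhds t] E := by
          filter_upwards [Iio_mem_nhds h1] with x hx
          simp only [hS, if_pos (le_of_lt (mem_Iio.1 hx))]
        have e2 : VS t - m * S t = VL t - m * E t := by
          simp only [hS, hVS, if_pos h1.le]
        rw [e2]
        exact (hEd t).congr_of_eventuallyEq e1
      · have e1 : S =ᶠ[nhds t] R := by
          filter_upwards [Ioi_mem_nhds h1] with x hx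
          simp only [hS, if_neg (not_le.2 (mem_Ioi.1 hx))]
        have e2 : VS t - m * S t = VR t - m * R t := by
          simp only [hS, hVS, if_neg (not_le.2 h1)]
        rw [e2]
        exact (hRd t).congr_of_eventuallyEq e1
    · apply squeeze_zero' (g := fun t => Real.exp (m * t) * δ)
      · filter_upwards [eventually_le_atBot tc] with t ht
        simp only [hS, if_pos ht]
        exact mul_nonneg (Real.exp_pos _).le (hEpos t).le
      · filter_upwards [eventually_le_atBot tc] with t ht
        apply mul_le_mul_of_nonneg_left _ (Real.exp_pos _).le
        simp only [hS, if_pos ht]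
        exact hEδ t ht
      · simpa using (pf_tendsto_exp_bot hm).mul_const δ
  have hSnn : ∀ t, 0 ≤ S t := by
    intro t
    rw [← hΦS]
    have := pfPhi_ge hm hVSB (c := 0) (t := t) (fun s _ => hVSpos s)
    simpa using this
  set V0 : ℝ → ℝ := fun t => min (VS t) (m * κ) with hV0
  have hV0m : Measurable V0 := hVSB.1.min measurable_const
  have hV00 : ∀ t, 0 ≤ V0 t := fun t => le_min (hVSpos t) (by positivity)
  have hV0κ : ∀ t, V0 t ≤ m * κ := fun t => min_le_right _ _
  have hV0S : ∀ t, V0 t ≤ VS t := fun t => min_le_left _ _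
  clear_value V0
  have hV0B : PfB V0 := ⟨hV0m, m * κ, fun t => by rw [abs_of_nonneg (hV00 t)]; exact hV0κ t⟩
  have hΦ0 : ∀ t, 0 ≤ pfPhi m V0 t := by
    intro t
    have := pfPhi_ge hm hV0B (c := 0) (t := t) (fun s _ => hV00 s)
    simpa using this
  have hmκ : m * κ / m = κ := by field_simp
  have hΦκ : ∀ t, pfPhi m V0 t ≤ κ := by
    intro t
    have := pfPhi_le hm hV0B (c := m * κ) (t := t) (fun s _ => hV0κ s)
    rwa [hmκ] at this
  have hΦle : ∀ t, pfPhi m V0 t ≤ S t := by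
    intro t; rw [← hΦS]; exact pfPhi_mono hm hV0B hVSB (fun s _ => hV0S s)
  have hTκ : ∀ t, pfT g a K m h V0 t ≤ m * κ := by
    intro t
    apply pfT_le ha G.cont hm hV0B
    intro s _
    have := pfH_mono G hm hh hK hV0B (PfB.const (m * κ)) hV0κ hΦ0 (fun s => by
      rw [pfPhi_const hm, hmκ]) s
    refine this.trans (le_of_eq ?_)
    unfold pfH
    rw [pfPhi_const hm, pfPhi_const hm, hmκ, G.gk, hKd]; ring
  have hT0 : ∀ t, 0 ≤ pfT g a K m h V0 t := by
    intro t
    have := pfT_ge (K := K) (h := h) ha G.cont hm hV0B (c := 0) (t := t) (fun x _ => by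
      unfold pfH
      have := mul_nonneg hK0.le (hΦ0 x)
      have := G.nonneg _ (hΦ0 (x - h))
      linarith)
    linarith
  set gt : ℝ → ℝ := fun u => if u ≤ κ then g u else κ - k * (u - κ) with hgt
  clear_value gt
  have hgt1 : ∀ u, u ≤ κ → gt u = g u := fun u hu => by simp only [hgt, if_pos hu]
  have hgt2 : ∀ u, κ < u → gt u = κ - k * (u - κ) := fun u hu => by simp only [hgt, if_neg (not_le.2 hu)]
  have hgt3 : ∀ u, κ < u → gt u ≤ κ := fun u hu => by rw [hgt2 u hu]; linarith [mul_pos hk (sub_pos.2 hu)]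
  have hgtQ : ∀ u w, 0 ≤ u → u ≤ κ → u ≤ w → g u + k * u ≤ gt w + k * w := by
    intro u w h1 h2 h3
    by_cases hw : w ≤ κ
    · rw [hgt1 w hw]; exact G.Q u w h1 h3 hw
    · rw [hgt2 w (not_le.1 hw)]
      have := G.Q u κ h1 h2 le_rfl
      rw [G.gk] at this; linarith
  have hH : ∀ t, pfH g K m h V0 t ≤ K * S t + gt (S (t - h)) := by
    intro t
    unfold pfH
    have e1 := pfPhi_diff hm hV0B hVSB hV0S hh t
    rw [hΦS, hΦS] at e1
    have e4 := hgtQ _ _ (hΦ0 (t - h)) (hΦκ _) (hΦle (t - h))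
    have e5 := mul_le_mul_of_nonneg_left e1 G.k0.le
    have e6 := mul_le_mul_of_nonneg_right hK (sub_nonneg.2 (hΦle t))
    linarith
  -- right side
  have hDR : ∀ t, tc ≤ t → (a - a0) * φ2 t - g (φ (t - h)) - ε2 - K * e t + gt (S (t - h)) ≤ 0 := by
    intro t ht
    have hr1 : (a - a0) * φ2 t ≤ ε2 := by
      have := mul_le_mul_of_nonneg_left ((abs_le.1 (hM t).2.2).2) (by linarith : 0 ≤ a - a0)
      linarith
    have hKe : 0 ≤ K * e t := mul_nonneg hK0.le (hepos t).le
    by_cases h1 : t - h ≤ tc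
    · have e1 : S (t - h) = E (t - h) := by simp only [hS, if_pos h1]
      have e2 : E (t - h) ≤ φ (t - h) := hE1 _ (by linarith) h1
      have e3 := hφδ (t - h) h1
      rw [e1, hgt1 _ (by linarith [G.δθ, G.θκ])]
      have := G.mono _ _ (hEpos (t - h)).le e2 (by linarith [G.δθ])
      linarith
    · have e1 : S (t - h) = φ (t - h) + ε2 - e (t - h) := by simp only [hS, if_neg h1, hR]
      have e2 : e (t - h) = Real.exp (m * h) * e t := by
        simp only [he]
        rw [mul_left_comm, ← Real.exp_add]; ring_nf
      have e3 := hφκ (t - h)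
      have e4 := hepos (t - h)
      by_cases h2 : S (t - h) ≤ φ (t - h)
      · rw [hgt1 _ (by linarith)]
        have q1 := G.Q _ _ (hSnn (t - h)) h2 e3.le
        have q2 := mul_le_mul_of_nonneg_right hK (hepos t).le
        have q3 : k * (φ (t - h) - S (t - h)) ≤ k * e (t - h) := mul_le_mul_of_nonneg_left (by linarith) hk.le
        rw [e2] at q3
        linarith
      · push Not at h2
        by_cases h3 : T' ≤ t - h
        · have q1 := hT' _ h3
          have q2 : gt (S (t - h)) ≤ g (φ (t - h)) := by
            by_cases h4 : S (t - h) ≤ κ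
            · rw [hgt1 _ h4]; exact G.anti _ _ q1 h2.le
            · refine (hgt3 _ (not_le.1 h4)).trans ?_
              have := G.anti _ _ q1 e3.le
              rwa [G.gk] at this
          linarith
        · push Not at h3
          have q2 : gt (S (t - h)) - g (φ (t - h)) ≤ L * ε2 := by
            by_cases h4 : S (t - h) ≤ κ
            · rw [hgt1 _ h4]
              refine (G.lip _ _ (F.pos _).le h2.le h4).trans ?_
              exact mul_le_mul_of_nonneg_left (by linarith) hL.le
            · have := G.lip _ _ (F.pos (t - h)).le e3.le le_rfl
              rw [G.gk] at this
              have q3 : L * (κ - φ (t - h)) ≤ L * ε2 := mul_le_mul_of_nonneg_left (by linarith [not_le.1 h4]) hL.le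
              linarith [hgt3 _ (not_le.1 h4)]
          have q4 : ε0 * Real.exp (-m * (T' + h - tc)) ≤ e t := by
            simp only [he]
            have : Real.exp (-m * (T' + h - tc)) ≤ Real.exp (-m * (t - tc)) := Real.exp_le_exp.2 (mul_le_mul_of_nonpos_left (by linarith) (by linarith))
            gcongr
          have q5 := mul_le_mul_of_nonneg_left q4 hK0.le
          linarith
  have hR0 : ∀ t, tc ≤ t → pfT g a K m h V0 t ≤ VR t := by
    have := pf_barrier_fwd_bdd (Z := fun t => VR t - pfT g a K m h V0 t) (n := 1 / a + m) (T := tc)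
      (M := (M + m * M + m * ε2) + m * κ) (by positivity)
      (fun t _ => (hVRd t).sub (pfT_deriv ha G.cont hm hV0B t)) (fun t ht => ?_) (fun t ht => ?_)
    · intro t ht; exact sub_nonneg.1 (this t ht)
    · have hSt : S t = R t := by
        rcases ht.eq_or_lt with h1 | h1
        · rw [← h1]; simp [hS, hR, he, hεd]
        · simp only [hS, if_neg (not_le.2 h1)]
      have d1 := hDR t ht
      have d2 := hH t
      have d3 := F.eq t
      rw [hSt] at d2
      have e1 : a * (φ2 t + m * φ1 t) + pfH g K m h V0 t ≤ (1 + a * m) * VR t := by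
        simp only [hVR]
        simp only [hR] at d2
        have : (1 + a * m) * (φ1 t + m * φ t + m * ε2) = φ1 t + a * m * φ1 t + (1 + K) * φ t + (1 + K) * ε2 := by
          rw [hKd]; ring
        rw [this]
        linarith
      have e2 : φ2 t + m * φ1 t + pfH g K m h V0 t / a ≤ (1 / a + m) * VR t := by
        have := div_le_div_of_nonneg_right e1 ha.le
        have e3 : (a * (φ2 t + m * φ1 t) + pfH g K m h V0 t) / a = φ2 t + m * φ1 t + pfH g K m h V0 t / a := by field_simp
        have e4 : (1 + a * m) * VR t / a = (1 / a + m) * VR t := by field_simp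
        rwa [e3, e4] at this
      have e5 : φ2 t + m * φ1 t - ((1 / a + m) * pfT g a K m h V0 t - pfH g K m h V0 t / a) ≤
        (1 / a + m) * (VR t - pfT g a K m h V0 t) := by linarith
      exact e5
    · have := hVRb t
      have := hVRge t
      have := hT0 t
      have := hTκ t
      have : 0 ≤ m * ε2 := by positivity
      rw [abs_le]
      constructor <;> linarith
  have hL0 : ∀ t, t ≤ tc → pfT g a K m h V0 t ≤ VL t := by
    have hanti : AntitoneOn (fun t => Real.exp (-(1 / a + m) * t) * (VL t - pfT g a K m h V0 t)) (Iic tc) := by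
      apply pf_anti (convex_Iic _) (fun t _ => pf_exp_mul_hasDeriv _ t ((hVLd t).sub (pfT_deriv ha G.cont hm hV0B t)))
      intro t ht
      have ht := mem_Iic.1 ht
      apply mul_nonpos_of_nonneg_of_nonpos (Real.exp_pos _).le
      have hth : t - h ≤ tc := by linarith
      have d2 := hH t
      simp only [hS, if_pos ht, if_pos hth] at d2
      rw [hgt1 _ ((hEδ _ hth).trans (by linarith [G.δθ, G.θκ]))] at d2
      have d4 := (abs_le.1 (G.hol _ (hEpos (t - h)).le (hEδ _ hth))).2
      set X := Real.exp (z2 * t) with hX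
      set Y := Real.exp (z * t) with hY
      have hXp : 0 < X := Real.exp_pos _
      have hYp : 0 < Y := Real.exp_pos _
      have d1 : E (t - h) = α * (Real.exp (-(z2 * h)) * X) + B * (Real.exp (-(z * h)) * Y) := by
        simp only [hE, hX, hY]
        rw [← Real.exp_add, ← Real.exp_add]; ring_nf
      have d5 : A * E (t - h) ^ (1 + γ) ≤ p * (B * Y) := by
        have hγ := G.γ0
        have hA := G.A0
        have hEle : E (t - h) ≤ 2 * max (α * X) (B * Y) := by
          refine (hEmono _ t (by linarith)).trans ?_
          simp only [hE, ← hX, ← hY]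
          linarith [le_max_left (α * X) (B * Y), le_max_right (α * X) (B * Y)]
        have h2 : (2:ℝ) ^ (1 + γ) ≤ 4 := by
          calc (2:ℝ) ^ (1 + γ) ≤ 2 ^ (2:ℝ) := Real.rpow_le_rpow_of_exponent_le (by norm_num) (by linarith)
            _ = 4 := by norm_num
        have hmax : A * (max (α * X) (B * Y)) ^ (1 + γ) ≤ p / 4 * (B * Y) := by
          rcases max_cases (α * X) (B * Y) with ⟨q, _⟩ | ⟨q, _⟩ <;> rw [q]
          · rw [Real.mul_rpow hα.le hXp.le, Real.rpow_add hα, Real.rpow_one, hX, ← Real.exp_mul]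
            have q2 : Real.exp (z2 * t * (1 + γ)) ≤ Y := by
              apply Real.exp_le_exp.2; linarith [mul_le_mul_of_nonpos_right hzγ (ht.trans htc)]
            calc A * (α * α ^ γ * Real.exp (z2 * t * (1 + γ))) ≤ A * (B * α ^ γ * Y) := by gcongr
              _ = A * α ^ γ * (B * Y) := by ring
              _ ≤ _ := by gcongr
          · have hBY : 0 < B * Y := by positivity
            rw [Real.rpow_add hBY, Real.rpow_one]
            have q2 : Y ≤ Real.exp (z * tc) := Real.exp_le_exp.2 (mul_le_mul_of_nonneg_left ht (by positivity))
            calc A * (B * Y * (B * Y) ^ γ) ≤ A * (B * Y * (B * Real.exp (z * tc)) ^ γ) := by gcongr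
              _ = A * (B * Real.exp (z * tc)) ^ γ * (B * Y) := by ring
              _ ≤ _ := by gcongr
        have hmx : 0 < max (α * X) (B * Y) := lt_max_of_lt_left (by positivity)
        calc A * E (t - h) ^ (1 + γ) ≤ A * (2 * max (α * X) (B * Y)) ^ (1 + γ) := by
              have := (hEpos (t - h)).le
              gcongr
          _ = 2 ^ (1 + γ) * (A * (max (α * X) (B * Y)) ^ (1 + γ)) := by
              rw [Real.mul_rpow (by norm_num) hmx.le]; ring
          _ ≤ 4 * (p / 4 * (B * Y)) := by
              apply mul_le_mul h2 hmax (by positivity) (by norm_num)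
          _ = _ := by ring
      have e1 : -(1 / a + m) * (VL t - pfT g a K m h V0 t) +
          (VL1 t - ((1 / a + m) * pfT g a K m h V0 t - pfH g K m h V0 t / a)) =
          (a * VL1 t + pfH g K m h V0 t - (1 + a * m) * VL t) / a := by field_simp; ring
      refine e1.trans_le ?_
      apply div_nonpos_of_nonpos_of_nonneg _ ha.le
      have e2 : a * VL1 t - (1 + a * m) * VL t + K * E t + b * E (t - h) =
          PfP a b h z2 * (α * X) + PfP a b h z * (B * Y) := by
        rw [d1]; simp only [hVL, hVL1, hE, PfP, hKd, ← hX, ← hY]; ring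
      rw [hP2] at e2
      have e3 := mul_le_mul_of_nonneg_right hP (mul_pos hB hYp).le
      linarith
    intro t ht
    have e1 := hanti (mem_Iic.2 ht) (mem_Iic.2 le_rfl) ht
    have e2 : 0 ≤ VL tc - pfT g a K m h V0 tc := by
      have := hR0 tc le_rfl
      have : VR tc ≤ VL tc := hjump
      linarith
    have e3 := (mul_nonneg (Real.exp_pos (-(1 / a + m) * tc)).le e2).trans e1
    have := nonneg_of_mul_nonneg_right e3 (Real.exp_pos _)
    linarith
  have hsup : ∀ t, pfT g a K m h V0 t ≤ V0 t := by
    intro t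
    have hV0t : V0 t = min (VS t) (m * κ) := by rw [hV0]
    rw [hV0t]
    refine le_min ?_ (hTκ t)
    have hVSt : VS t = if t ≤ tc then VL t else VR t := by rw [hVS]
    rw [hVSt]; split_ifs with ht
    · exact hL0 t ht
    · exact hR0 t (not_le.1 ht).le
  have hbot : Tendsto (pfPhi m V0) atBot (nhds 0) := by
    have hE0 : Tendsto E atBot (nhds 0) := by
      rw [hE]
      simpa using ((pf_tendsto_exp_bot hz2).const_mul α).add ((pf_tendsto_exp_bot hz0).const_mul B)
    apply squeeze_zero' (Eventually.of_forall hΦ0) _ hE0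
    filter_upwards [eventually_le_atBot tc] with t ht
    have := hΦle t
    simpa only [hS, if_pos ht] using this
  apply pf_exists_front (ω := min (m * ε2) (m * κ)) (tc := tc) G ha hm hh hKd hK hV0m hV00 hV0κ hsup hbot hz2 hz hzγ hP2 hp hP hα
    (lt_min (by positivity) (by positivity))
  · intro t ht
    simp only [hV0]
    refine le_min ?_ ?_
    · simp only [hVS, if_pos ht, hVL]
      have : 0 < B * ((z + m) * Real.exp (z * t)) := by positivity
      linarith
    · have : Real.exp (z2 * t) ≤ 1 := Real.exp_le_one_iff.2 (mul_nonpos_of_nonneg_of_nonpos hz2.le (ht.trans htc))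
      have := mul_le_mul_of_nonneg_left this (by positivity : 0 ≤ α * (z2 + m))
      linarith
  · intro t ht
    simp only [hV0]
    refine min_le_min ?_ le_rfl
    simp only [hVS, if_neg (not_le.2 ht)]
    exact hVRge t
end

section
variable {g : ℝ → ℝ} {κ θ A δ γ b k L a a0 h m : ℝ} {φ φ1 φ2 : ℝ → ℝ}

lemma PfP_cont (a b h : ℝ) : Continuous (PfP a b h) := by
  unfold PfP; fun_prop

lemma PfF.slow (F : PfF g κ a0 h φ φ1 φ2) (G : PfG g κ θ A δ γ b k L) (ha0 : 0 < a0)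
    (hm : 0 < m) (hh : 0 ≤ h) (hγ1 : γ ≤ 1)
    (hK : k * Real.exp (m * h) < a0 * m ^ 2 + m - 1) {z2 z : ℝ} (hz2 : 0 < z2) (hz : z2 < z)
    (hzγ : z ≤ (1 + γ) * z2) (hP2 : PfP a0 b h z2 = 0) (hP : PfP a0 b h z < 0)
    (hs : ∀ B, 0 < B → ∀ᶠ t in atBot, B * Real.exp (z * t) < φ t) :
    ∃ a, a0 < a ∧ ∃ ψ ψ1 ψ2 : ℝ → ℝ, PfF g κ a h ψ ψ1 ψ2 := by
  have hz0 : 0 < z := hz2.trans hz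
  have hκ : 0 < κ := by linarith [G.δ0, G.δθ, G.θκ]
  have hk := G.k0
  have hL := G.L0
  have hK0 : 0 < a0 * m ^ 2 + m - 1 := by have : 0 < k * Real.exp (m * h) := by positivity
                                          linarith
  obtain ⟨p, hp⟩ : ∃ p, p = -PfP a0 b h z / 2 := ⟨_, rfl⟩
  have hp0 : 0 < p := by linarith
  obtain ⟨d, hd0, hdδ, hdp⟩ := G.small (by linarith : 0 < p / 4)
  obtain ⟨B, tc, hB, htc, hBφ, hφd, hJ⟩ := F.cross (m := m) (T := 0) hd0 hz0 hs
  have hcont : Continuous (fun t => φ t - B * Real.exp (z * t)) := by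
    have := F.cont
    fun_prop
  obtain ⟨u, hu, hmin⟩ := (isCompact_Icc (a := tc - h) (b := tc)).exists_isMinOn ⟨tc, by linarith, le_rfl⟩ hcont.continuousOn
  obtain ⟨μ, hμ⟩ : ∃ μ, μ = φ u - B * Real.exp (z * u) := ⟨_, rfl⟩
  have hμ0 : 0 < μ := by rw [hμ]; linarith [hBφ u hu.2]
  have hμle : ∀ t, tc - h ≤ t → t ≤ tc → μ ≤ φ t - B * Real.exp (z * t) := by
    intro t h1 h2; rw [hμ]; exact hmin ⟨h1, h2⟩
  obtain ⟨T', hT'⟩ := eventually_atTop.1 (F.top.eventually (lt_mem_nhds G.θκ))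
  obtain ⟨J, hJd⟩ : ∃ J, J = B * ((z + m) * Real.exp (z * tc)) - (φ1 tc + m * φ tc) := ⟨_, rfl⟩
  have hJ0 : 0 < J := by rw [hJd]; linarith
  obtain ⟨N, hN⟩ : ∃ N, N = (a0 * m ^ 2 + m - 1) * (μ / 2 * Real.exp (-m * (T' + h - tc))) := ⟨_, rfl⟩
  have hN0 : 0 < N := by rw [hN]; exact mul_pos hK0 (by positivity)
  obtain ⟨ε2, hε2⟩ : ∃ ε2, ε2 = min (J / m) (N / (1 + L)) := ⟨_, rfl⟩
  have hε20 : 0 < ε2 := by rw [hε2]; exact lt_min (by positivity) (by positivity)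
  have hε2J : m * ε2 ≤ J := by
    have : ε2 ≤ J / m := by rw [hε2]; exact min_le_left _ _
    rw [le_div_iff₀ hm] at this; linarith
  have hε2N : (1 + L) * ε2 ≤ N := by
    have : ε2 ≤ N / (1 + L) := by rw [hε2]; exact min_le_right _ _
    rw [le_div_iff₀ (by positivity)] at this; linarith
  obtain ⟨M, hM0, hM⟩ := F.bdd G.cont ha0
  obtain ⟨η, hη⟩ : ∃ η, η = min (ε2 / M) (p / z ^ 2) := ⟨_, rfl⟩
  have hη0 : 0 < η := by rw [hη]; exact lt_min (by positivity) (by positivity)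
  have hηM : η * M ≤ ε2 := by
    have : η ≤ ε2 / M := by rw [hη]; exact min_le_left _ _
    rwa [le_div_iff₀ hM0] at this
  have hηz : η * z ^ 2 ≤ p := by
    have : η ≤ p / z ^ 2 := by rw [hη]; exact min_le_right _ _
    rwa [le_div_iff₀ (by positivity)] at this
  have hPa : ∀ w, PfP (a0 + η) b h w = PfP a0 b h w + η * w ^ 2 := by
    intro w; unfold PfP; ring
  have hPaz : PfP (a0 + η) b h z ≤ -p := by rw [hPa]; linarith
  have hPa2 : 0 < PfP (a0 + η) b h z2 := by rw [hPa, hP2]; positivity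
  obtain ⟨z2', ⟨hz2a, hz2b⟩, hz2c⟩ : ∃ w ∈ Ioo z2 z, PfP (a0 + η) b h w = 0 := by
    have := intermediate_value_Ioo' hz.le (PfP_cont (a0 + η) b h).continuousOn
    exact this ⟨by linarith, hPa2⟩
  have hz2' : 0 < z2' := hz2.trans hz2a
  obtain ⟨α, hα⟩ : ∃ α, α = min (μ / 2) (min B (min d (m * κ / (z2' + m)))) := ⟨_, rfl⟩
  have hα0 : 0 < α := by
    rw [hα]; exact lt_min (by positivity) (lt_min hB (lt_min hd0 (by positivity)))
  have hαμ : α ≤ μ / 2 := by rw [hα]; exact min_le_left _ _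
  have hαB : α ≤ B := by rw [hα]; exact (min_le_right _ _).trans (min_le_left _ _)
  have hαd : α ≤ d := by rw [hα]; exact (min_le_right _ _).trans ((min_le_right _ _).trans (min_le_left _ _))
  have hακ : α * (z2' + m) ≤ m * κ := by
    have : α ≤ m * κ / (z2' + m) := by
      rw [hα]; exact (min_le_right _ _).trans ((min_le_right _ _).trans (min_le_right _ _))
    rwa [le_div_iff₀ (by positivity)] at this
  have hαe : ∀ t, t ≤ tc → α * Real.exp (z2' * t) ≤ μ / 2 := by
    intro t ht
    have : Real.exp (z2' * t) ≤ 1 := Real.exp_le_one_iff.2 (mul_nonpos_of_nonneg_of_nonpos hz2'.le (ht.trans htc))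
    have := mul_le_mul_of_nonneg_left this hα0.le
    linarith
  have hA := G.A0
  have hγ := G.γ0
  have hKK : a0 * m ^ 2 + m - 1 ≤ (a0 + η) * m ^ 2 + m - 1 := by
    have : 0 < η * m ^ 2 := by positivity
    linarith
  refine ⟨a0 + η, by linarith, F.slow_sup (M := M) (tc := tc) (B := B) (α := α) (z2 := z2') (z := z) (p := p)
    (ε0 := μ / 2) (ε2 := ε2) (T' := T') G ha0 (by linarith) hm hh hγ1 rfl (hK.le.trans hKK)
    (fun t => ⟨(hM t).1, (hM t).2.1, (hM t).2.2.1⟩) (F.lt_kappa G ha0 hm hh hK)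
    (F.V_nonneg G.cont G.nonneg ha0 hm hK0.le) htc hB hα0 hz2' hz2b ?_ hz2c hp0 hPaz (by positivity) hε20
    ?_ (fun t ht => (hφd t ht).le.trans hdδ) ?_ ?_ (fun t ht => (hT' t ht).le) ?_ ?_ ?_ ?_ hαB hακ⟩
  · refine hzγ.trans ?_
    gcongr
  · intro t h1 h2
    linarith [hαe t h2, hμle t h1 h2]
  · linarith [hαe tc le_rfl, hμle tc (by linarith) le_rfl]
  · have : 0 < α * ((z2' + m) * Real.exp (z2' * tc)) := by positivity
    linarith
  · refine hε2N.trans ?_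
    rw [hN]
    gcongr
  · linarith
  · have : B * Real.exp (z * tc) ≤ d := (hBφ tc le_rfl).le.trans (hφd tc le_rfl).le
    refine le_trans ?_ hdp
    gcongr
  · refine le_trans ?_ hdp
    gcongr
end

section
variable {g : ℝ → ℝ} {κ θ A δ γ b k L a a0 h m : ℝ} {φ φ1 φ2 : ℝ → ℝ}

lemma PfF.main (F : PfF g κ a h φ φ1 φ2) (G : PfG g κ θ A δ γ b k L) (ha : 0 < a)
    (hm : 0 < m) (hh : 0 ≤ h) (hγ1 : γ ≤ 1)
    (hK : k * Real.exp (m * h) < a * m ^ 2 + m - 1) {l Λ : ℝ} (hl : 0 < l) (hlΛ : l < Λ)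
    (hPl : PfP a b h l = 0) (hPΛ : PfP a b h Λ = 0) (hPn : ∀ w, l < w → w < Λ → PfP a b h w < 0)
    (hE : b * Real.exp (-(Λ * h)) * h < 2 * a * Λ - 1)
    (hno : ∀ a', a < a' → ¬ ∃ ψ ψ1 ψ2 : ℝ → ℝ, PfF g κ a' h ψ ψ1 ψ2) :
    ∃ A0 σ C T0, 0 < A0 ∧ 0 < σ ∧ ∀ t, t ≤ T0 → |φ t - A0 * Real.exp (Λ * t)| ≤ C * Real.exp ((Λ + σ) * t) ∧
      |φ1 t - Λ * (A0 * Real.exp (Λ * t))| ≤ C * Real.exp ((Λ + σ) * t) := by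
  have hk := G.k0
  have hγ := G.γ0
  have hb1 := G.b1
  have hΛ0 : 0 < Λ := hl.trans hlΛ
  have hK0 : 0 < a * m ^ 2 + m - 1 := by have : 0 < k * Real.exp (m * h) := by positivity
                                         linarith
  have hV := F.V_nonneg G.cont G.nonneg ha hm hK0.le
  obtain ⟨z, hz⟩ : ∃ z, z = min ((l + Λ) / 2) ((1 + γ) * l) := ⟨_, rfl⟩
  have hz1 : l < z := by rw [hz]; exact lt_min (by linarith) (by nlinarith)
  have hz2 : z < Λ := by rw [hz]; exact lt_of_le_of_lt (min_le_left _ _) (by linarith)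
  have hz3 : z ≤ (1 + γ) * l := by rw [hz]; exact min_le_right _ _
  have hz0 : 0 < z := hl.trans hz1
  by_cases hs : ∀ B, 0 < B → ∀ᶠ t in atBot, B * Real.exp (z * t) < φ t
  · obtain ⟨a', ha', hf⟩ := F.slow G ha hm hh hγ1 hK hl hz1 hz3 hPl (hPn z hz1 hz2) hs
    exact absurd hf (hno a' ha')
  push Not at hs
  obtain ⟨B, hB, hfr⟩ := hs
  have hfr : ∃ᶠ t in atBot, φ t ≤ B * Real.exp (z * t) := by
    simpa [Filter.not_eventually, Filter.Frequently] using hfr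
  obtain ⟨z', hz'⟩ : ∃ z', z' = max ((l + Λ) / 2) ((Λ + Λ / (1 + γ)) / 2) := ⟨_, rfl⟩
  have hq : Λ / (1 + γ) < Λ := div_lt_self hΛ0 (by linarith)
  have hz'1 : l < z' := by rw [hz']; exact lt_of_lt_of_le (by linarith) (le_max_left _ _)
  have hz'2 : z' < Λ := by rw [hz']; exact max_lt (by linarith) (by linarith)
  have hz'3 : Λ < (1 + γ) * z' := by
    have : Λ / (1 + γ) < z' := by rw [hz']; exact lt_of_lt_of_le (by linarith) (le_max_right _ _)
    rw [div_lt_iff₀ (by positivity)] at this; linarith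
  have hz'0 : 0 < z' := hl.trans hz'1
  obtain ⟨za, hza⟩ : ∃ za, za = (l + z) / 2 := ⟨_, rfl⟩
  have hza1 : l < za := by linarith
  have hza2 : za < z := by linarith
  have p1 := hPn z hz1 hz2
  have p2 := hPn z' hz'1 hz'2
  have p3 := hPn za hza1 (by linarith)
  obtain ⟨ε, hε⟩ : ∃ ε, ε = min (-PfP a b h z / 2) (min (-PfP a b h z' / 2) (-PfP a b h za / 2)) := ⟨_, rfl⟩
  have hε0 : 0 < ε := by
    rw [hε]; exact lt_min (by linarith) (lt_min (by linarith) (by linarith))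
  have e1 : ε ≤ -PfP a b h z / 2 := by rw [hε]; exact min_le_left _ _
  have e2 : ε ≤ -PfP a b h z' / 2 := by rw [hε]; exact (min_le_right _ _).trans (min_le_left _ _)
  have e3 : ε ≤ -PfP a b h za / 2 := by rw [hε]; exact (min_le_right _ _).trans (min_le_right _ _)
  have hPb : ∀ w, 0 < w → PfP a (b + ε) h w ≤ PfP a b h w + ε := by
    intro w hw
    have : Real.exp (-(w * h)) ≤ 1 := Real.exp_le_one_iff.2 (by nlinarith)
    have := mul_le_mul_of_nonneg_left this hε0.le
    unfold PfP
    linarith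
  have q1 := hPb z hz0
  have q2 := hPb z' hz'0
  have q3 := hPb za (hl.trans hza1)
  obtain ⟨d, hd0, hdδ, hdε⟩ := G.small hε0
  obtain ⟨T0, hT0⟩ := eventually_atBot.1 (F.bot.eventually (gt_mem_nhds hd0))
  have hg : ∀ t, t ≤ T0 → g (φ t) ≤ (b + ε) * φ t := by
    intro t ht
    have := (abs_le.1 (G.hol2 hdδ hdε (F.pos t).le (hT0 t ht).le)).2
    linarith
  obtain ⟨B', T, hB', hT⟩ := F.dich ha hh hm hV (b' := b + ε) (by linarith) hz0 hB (by linarith) hg hfr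
  obtain ⟨C, hC0, hC⟩ := F.improve ha hh (b' := b + ε) (z' := z') (by linarith) hza2 (by linarith) (by linarith) hg hT
  obtain ⟨A0, σ, C1, r1, r2, r3⟩ := F.fast G ha hh hm hK0.le hV (τ' := Λ - (l + z') / 2) (b' := b + ε) hz'0 hz'2 hz'3 (by linarith) hPΛ hE
    (hPn _ (by linarith) (by linarith)) (by linarith) hg (fun t ht => (hT0 t ht).le.trans hdδ) hC0 hC
  exact ⟨A0, σ, C1, T0, r1, r2, r3⟩
end

lemma pf_mkG (g : ℝ → ℝ) (κ θ A δ γ : ℝ)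
    (hg_nonneg : ∀ x : ℝ, 0 ≤ x → 0 ≤ g x)
    (hg_C1 : ContDiff ℝ 1 g)
    (hg0 : g 0 = 0)
    (hg'0 : 1 < deriv g 0)
    (hκ : 0 < κ)
    (hfix : ∀ x : ℝ, 0 ≤ x → (g x = x ↔ x = 0 ∨ x = κ))
    (hθ1 : 0 < θ) (hθ2 : θ < κ)
    (hUinc : StrictMonoOn g (Ico 0 θ))
    (hUdec : StrictAntiOn g (Ici θ))
    (hmin : ∀ u ∈ Icc 0 κ, deriv g κ ≤ deriv g u)
    (hgκ : deriv g κ < 0)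
    (hA : 0 < A) (hδ1 : 0 < δ) (hδ2 : δ < θ) (hγ1 : 0 < γ)
    (hHolder : ∀ u ∈ Icc 0 δ, |deriv g u - deriv g 0| ≤ A * u ^ γ) :
    ∃ L, PfG g κ θ A δ γ (deriv g 0) (-deriv g κ) L := by
  have hd : ∀ u, HasDerivAt g (deriv g u) u := fun u => (hg_C1.differentiable (by norm_num) u).hasDerivAt
  have hdc : Continuous (deriv g) := hg_C1.continuous_deriv le_rfl
  have hgc : Continuous g := hg_C1.continuous
  have hgk : g κ = κ := (hfix κ hκ.le).2 (Or.inr rfl)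
  obtain ⟨N, hN⟩ := (isCompact_Icc (a := 0) (b := κ)).exists_bound_of_continuousOn hdc.continuousOn
  have hN0 : 0 ≤ N := (norm_nonneg _).trans (hN κ ⟨hκ.le, le_rfl⟩)
  have hmv : ∀ u w, u < w → ∃ ξ, u < ξ ∧ ξ < w ∧ g w - g u = deriv g ξ * (w - u) := by
    intro u w huw
    obtain ⟨ξ, hξ, he⟩ := exists_hasDerivAt_eq_slope g (deriv g) huw hgc.continuousOn (fun x _ => hd x)
    refine ⟨ξ, hξ.1, hξ.2, ?_⟩
    rw [he]; field_simp [sub_ne_zero.2 huw.ne']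
  have hanti : ∀ u w, θ ≤ u → u ≤ w → g w ≤ g u := fun u w h1 h2 =>
    hUdec.antitoneOn (mem_Ici.2 h1) (mem_Ici.2 (h1.trans h2)) h2
  refine ⟨N + 1, hgc, hg_nonneg, hg0, hgk, hg'0, by linarith, by linarith, hA, hγ1, hδ1, hδ2, hθ2,
    ?_, ?_, ?_, hanti, ?_, ?_, ?_⟩
  · intro u hu0 huκ
    by_contra hcon
    push Not at hcon
    have hev : ∀ᶠ x in nhds (0:ℝ), 1 < deriv g x := hdc.continuousAt.eventually (lt_mem_nhds hg'0)
    obtain ⟨r, hr, hr2⟩ := Metric.eventually_nhds_iff.1 hev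
    set w := min r u / 2 with hw
    have hmr : 0 < min r u := lt_min hr hu0
    have hw0 : 0 < w := by rw [hw]; linarith
    have hwr : w < r := by rw [hw]; linarith [min_le_left r u]
    have hwu : w < u := by rw [hw]; linarith [min_le_right r u]
    obtain ⟨ξ, x1, x2, x3⟩ := hmv 0 w hw0
    have x4 : 1 < deriv g ξ := hr2 (by rw [Real.dist_eq, sub_zero, abs_of_pos x1]; linarith)
    have x5 : w < g w := by rw [hg0] at x3; nlinarith
    obtain ⟨y, hy, hy2⟩ := intermediate_value_Icc' hwu.le (f := fun x => g x - x) (by fun_prop)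
      (show (0:ℝ) ∈ Icc (g u - u) (g w - w) from ⟨by linarith, by linarith⟩)
    have hy3 : g y = y := by
      have : g y - y = 0 := hy2
      linarith
    rcases (hfix y (by linarith [hy.1])).1 hy3 with h1 | h1
    · linarith [hy.1]
    · linarith [hy.2]
  · intro u hu
    have := hanti κ u hθ2.le hu
    rwa [hgk] at this
  · intro u w h1 h2 h3
    rcases h2.eq_or_lt with h4 | h4
    · rw [h4]
    rcases h3.eq_or_lt with h5 | h5
    · rw [h5]
      have ht : Tendsto g (nhdsWithin θ (Iio θ)) (nhds (g θ)) := hgc.continuousAt.continuousWithinAt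
      refine ge_of_tendsto ht ?_
      have hm1 : Ioo u θ ∈ nhdsWithin θ (Iio θ) := Ioo_mem_nhdsLT (by linarith)
      filter_upwards [hm1] with x hx
      exact hUinc.monotoneOn ⟨h1, by linarith⟩ ⟨by linarith [hx.1], hx.2⟩ hx.1.le
    · exact hUinc.monotoneOn ⟨h1, by linarith⟩ ⟨by linarith, h5⟩ h2
  · intro u w h1 h2 h3
    rcases h2.eq_or_lt with h4 | h4
    · rw [h4]
    obtain ⟨ξ, x1, x2, x3⟩ := hmv u w h4
    have := hmin ξ ⟨by linarith, by linarith⟩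
    have := mul_le_mul_of_nonneg_right this (sub_nonneg.2 h2)
    linarith
  · intro u w h1 h2 h3
    rcases h2.eq_or_lt with h4 | h4
    · rw [h4]; simp
    obtain ⟨ξ, x1, x2, x3⟩ := hmv u w h4
    have := hN ξ ⟨by linarith, by linarith⟩
    have := (abs_le.1 this).2
    rw [x3]
    exact mul_le_mul_of_nonneg_right (by linarith) (sub_nonneg.2 h2)
  · intro u h1 h2
    rcases h1.eq_or_lt with h4 | h4
    · rw [← h4, hg0, Real.zero_rpow (by linarith)]; simp
    obtain ⟨ξ, x1, x2, x3⟩ := hmv 0 u h4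
    have e1 := hHolder ξ ⟨x1.le, by linarith⟩
    have e2 : ξ ^ γ ≤ u ^ γ := Real.rpow_le_rpow x1.le x2.le hγ1.le
    have e3 : g u - deriv g 0 * u = (deriv g ξ - deriv g 0) * u := by
      rw [hg0, sub_zero, sub_zero] at x3; rw [x3]; ring
    rw [e3, abs_mul, abs_of_pos h4, Real.rpow_add h4, Real.rpow_one]
    calc _ ≤ A * ξ ^ γ * u := by gcongr
      _ ≤ A * u ^ γ * u := by gcongr
      _ = _ := by ring

lemma pf_of_wave {g : ℝ → ℝ} {κ c h : ℝ} {φ : ℝ → ℝ} (hc : 0 < c) (hW : Wavefront g κ c h φ) :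
    PfF g κ (1 / c ^ 2) h (fun t => φ (c * t)) (fun t => c * deriv φ (c * t))
      (fun t => c * (c * deriv (deriv φ) (c * t))) := by
  obtain ⟨h1, h2, h3, h4, h5⟩ := hW
  have hd : ∀ t, HasDerivAt φ (deriv φ t) t := fun t => (h2.differentiable (by norm_num) t).hasDerivAt
  have h6 : ContDiff ℝ 1 (deriv φ) := ((contDiff_succ_iff_deriv (n := 1)).1 (by exact_mod_cast h2)).2.2
  have hd2 : ∀ t, HasDerivAt (deriv φ) (deriv (deriv φ) t) t := fun t => (h6.differentiable (by norm_num) t).hasDerivAt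
  have hl : ∀ t : ℝ, HasDerivAt (fun t => c * t) c t := fun t => by
    simpa using (hasDerivAt_id t).const_mul c
  refine ⟨fun t => h1 _, fun t => ?_, fun t => ?_, fun t => ?_, ?_, ?_⟩
  · have := (hd (c * t)).comp t (hl t)
    exact this.congr_deriv (by ring)
  · have := ((hd2 (c * t)).comp t (hl t)).const_mul c
    exact this.congr_deriv (by ring)
  · have := h3 (c * t)
    have e : c * (t - h) = c * t - c * h := by ring
    rw [e, ← this]
    field_simp
  · exact h4.comp (tendsto_id.const_mul_atBot hc)
  · exact h5.comp (tendsto_id.const_mul_atTop hc)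

lemma pf_to_wave {g : ℝ → ℝ} {κ a h : ℝ} {ψ ψ1 ψ2 : ℝ → ℝ} (hg : Continuous g) (ha : 0 < a)
    (F : PfF g κ a h ψ ψ1 ψ2) : Wavefront g κ (1 / Real.sqrt a) h (fun t => ψ (Real.sqrt a * t)) := by
  obtain ⟨r, hr⟩ : ∃ r, r = Real.sqrt a := ⟨_, rfl⟩
  have hr0 : 0 < r := by rw [hr]; exact Real.sqrt_pos.2 ha
  have hra : a = r ^ 2 := by rw [hr, Real.sq_sqrt ha.le]
  rw [← hr]
  have hl : ∀ t : ℝ, HasDerivAt (fun t => r * t) r t := fun t => by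
    simpa using (hasDerivAt_id t).const_mul r
  have hd1 : ∀ t, HasDerivAt (fun t => ψ (r * t)) (r * ψ1 (r * t)) t := fun t => by
    have := (F.d1 (r * t)).comp t (hl t)
    exact this.congr_deriv (by ring)
  have hd2 : ∀ t, HasDerivAt (fun t => r * ψ1 (r * t)) (r * (r * ψ2 (r * t))) t := fun t => by
    have := ((F.d2 (r * t)).comp t (hl t)).const_mul r
    exact this.congr_deriv (by ring)
  have e1 : deriv (fun t => ψ (r * t)) = fun t => r * ψ1 (r * t) := funext fun t => (hd1 t).deriv
  have e2 : deriv (fun t => r * ψ1 (r * t)) = fun t => r * (r * ψ2 (r * t)) := funext fun t => (hd2 t).deriv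
  have hψ2 : Continuous ψ2 := by
    have : ψ2 = fun t => (ψ1 t + ψ t - g (ψ (t - h))) / a := funext fun t => by
      have := F.eq t
      field_simp
      linarith
    rw [this]
    have := F.cont
    have := F.cont1
    fun_prop
  refine ⟨fun t => F.pos _, ?_, fun t => ?_, ?_, ?_⟩
  · have q1 : ContDiff ℝ 1 (fun t => r * ψ1 (r * t)) := by
      rw [contDiff_one_iff_deriv]
      refine ⟨fun t => (hd2 t).differentiableAt, ?_⟩
      rw [e2]; fun_prop
    have q2 : ContDiff ℝ (1 + 1) (fun t => ψ (r * t)) := by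
      rw [contDiff_succ_iff_deriv]
      refine ⟨fun t => (hd1 t).differentiableAt, fun hw => by simp at hw, ?_⟩
      rw [e1]; exact q1
    have e : (1 + 1 : WithTop ℕ∞) = 2 := by norm_num
    rwa [e] at q2
  · rw [e1, e2]
    have := F.eq (r * t)
    rw [hra] at this
    have e : r * (t - 1 / r * h) = r * t - h := by field_simp
    simp only [e]
    rw [← this]
    field_simp
  · exact F.bot.comp (tendsto_id.const_mul_atBot hr0)
  · exact F.top.comp (tendsto_id.const_mul_atTop hr0)

lemma PfP_tangent {a b h : ℝ} (hb : 0 ≤ b) (w x : ℝ) :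
    PfP a b h w + (2 * a * w - 1 - b * Real.exp (-(w * h)) * h) * (x - w) + a * (x - w) ^ 2 ≤ PfP a b h x := by
  have e : Real.exp (-(x * h)) = Real.exp (-(w * h)) * Real.exp ((w - x) * h) := by
    rw [← Real.exp_add]; ring_nf
  have h1 := Real.add_one_le_exp ((w - x) * h)
  have h2 := mul_le_mul_of_nonneg_left h1 (mul_nonneg hb (Real.exp_pos (-(w * h))).le)
  unfold PfP
  rw [e]
  linarith

lemma pf_m {a k h hs : ℝ} (ha : 0 < a) (hk : 0 < k) (hh : h ∈ Icc 0 hs)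
    (hs_eq : 1 = k * hs * Real.exp (hs + 1)) : ∃ m, 0 < m ∧ k * Real.exp (m * h) < a * m ^ 2 + m - 1 := by
  obtain ⟨h0, h1⟩ := hh
  rcases h0.eq_or_lt with h2 | h2
  · refine ⟨k + 1, by linarith, ?_⟩
    rw [← h2, mul_zero, Real.exp_zero]
    have : 0 < a * (k + 1) ^ 2 := by positivity
    linarith
  · refine ⟨1 + 1 / h, by positivity, ?_⟩
    have e1 : (1 + 1 / h) * h = h + 1 := by field_simp
    rw [e1]
    have e2 : k * h * Real.exp (h + 1) ≤ 1 := by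
      refine le_trans ?_ hs_eq.ge
      have : Real.exp (h + 1) ≤ Real.exp (hs + 1) := Real.exp_le_exp.2 (by linarith)
      have : 0 < hs := by linarith
      gcongr
    have e3 : k * Real.exp (h + 1) ≤ 1 / h := by
      rw [le_div_iff₀ h2]; linarith
    have : 0 < a * (1 + 1 / h) ^ 2 := by positivity
    linarith

lemma pf_chi {b c h z : ℝ} (hc : 0 < c) : PfP (1 / c ^ 2) b h (c * z) = chi0 b c h z := by
  unfold PfP chi0
  have : c * z * h = z * c * h := by ring
  rw [this]
  field_simp

theorem pushed_front_asymptotics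
    (g : ℝ → ℝ) (κ θ A δ γ : ℝ)
    (hg_nonneg : ∀ x : ℝ, 0 ≤ x → 0 ≤ g x)
    (hg_C1 : ContDiff ℝ 1 g)
    (hg0 : g 0 = 0)
    (hg'0 : 1 < deriv g 0)
    (hκ : 0 < κ)
    (hfix : ∀ x : ℝ, 0 ≤ x → (g x = x ↔ x = 0 ∨ x = κ))
    (hθ1 : 0 < θ) (hθ2 : θ < κ)
    (hUinc : StrictMonoOn g (Ico 0 θ))
    (hUdec : StrictAntiOn g (Ici θ))
    (hmin : ∀ u ∈ Icc 0 κ, deriv g κ ≤ deriv g u)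
    (hgκ : deriv g κ < 0)
    (hA : 0 < A) (hδ1 : 0 < δ) (hδ2 : δ < θ) (hγ1 : 0 < γ) (hγ2 : γ ≤ 1)
    (hHolder : ∀ u ∈ Icc 0 δ, |deriv g u - deriv g 0| ≤ A * u ^ γ)
    (L : ℝ) (hL : 0 < L)
    (hC1γ : ∀ u ∈ Icc 0 κ, ∀ v ∈ Icc 0 κ, |deriv g u - deriv g v| ≤ L * |u - v| ^ γ)
    (hs : ℝ) (hs_pos : 0 < hs)
    (hs_eq : 1 = |deriv g κ| * hs * Real.exp (hs + 1))
    (hs_unique : ∀ h' : ℝ, 1 = |deriv g κ| * h' * Real.exp (h' + 1) → h' = hs)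
    (h : ℝ) (hh : h ∈ Icc 0 hs)
    (cstar : ℝ)
    (hcstar : ∀ c' : ℝ, (∃ φ : ℝ → ℝ, Wavefront g κ c' h φ) ↔ cstar ≤ c')
    (csharp : ℝ) (hcsharp_pos : 0 < csharp)
    (hcsharp : ∃ z : ℝ, 0 < z ∧ chi0 (deriv g 0) csharp h z = 0 ∧
      2 * z - csharp - deriv g 0 * csharp * h * Real.exp (-(z * csharp * h)) = 0)
    (hcsharp_uniq : ∀ c' : ℝ, 0 < c' →
      (∃ z : ℝ, 0 < z ∧ chi0 (deriv g 0) c' h z = 0 ∧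
        2 * z - c' - deriv g 0 * c' * h * Real.exp (-(z * c' * h)) = 0) → c' = csharp)
    (hpushed : csharp < cstar)
    (lam1 : ℝ) (hlam1_pos : 0 < lam1)
    (hlam1_root : chi0 (deriv g 0) cstar h lam1 = 0)
    (hlam1_max : ∀ z : ℝ, 0 < z → chi0 (deriv g 0) cstar h z = 0 → z ≤ lam1) :
    ∀ φ : ℝ → ℝ, Wavefront g κ cstar h φ →
      ∃ s0 σ : ℝ, 0 < σ ∧
        ((fun t => φ (t + s0) - Real.exp (lam1 * t)) =O[atBot]
          fun t => Real.exp ((lam1 + σ) * t)) ∧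
        ((fun t => deriv φ (t + s0) - lam1 * Real.exp (lam1 * t)) =O[atBot]
          fun t => Real.exp ((lam1 + σ) * t)) := by
  intro φ hW
  obtain ⟨L', G⟩ := pf_mkG g κ θ A δ γ hg_nonneg hg_C1 hg0 hg'0 hκ hfix hθ1 hθ2 hUinc hUdec hmin hgκ hA hδ1 hδ2
    hγ1 hHolder
  have hc : 0 < cstar := hcsharp_pos.trans hpushed
  obtain ⟨c, hcc⟩ : ∃ c, c = cstar := ⟨_, rfl⟩
  rw [← hcc] at hc hW hlam1_root hlam1_max hcstar hpushed
  have F := pf_of_wave hc hW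
  have ha : 0 < 1 / c ^ 2 := by positivity
  have hk := G.k0
  obtain ⟨m, hm, hK⟩ := pf_m ha hk hh (by rw [← abs_of_neg hgκ]; exact hs_eq)
  have hb0 : 0 < deriv g 0 := by linarith
  have hh0 := hh.1
  have hP0 : 0 < PfP (1 / c ^ 2) (deriv g 0) h 0 := by unfold PfP; simp; linarith
  have hPΛ : PfP (1 / c ^ 2) (deriv g 0) h (c * lam1) = 0 := by rw [pf_chi hc]; exact hlam1_root
  obtain ⟨zs, hzs, hzs1, -⟩ := hcsharp
  have hPs : PfP (1 / c ^ 2) (deriv g 0) h (c * zs) < 0 := by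
    rw [pf_chi hc]
    unfold chi0 at hzs1 ⊢
    have e1 : csharp * zs < c * zs := mul_lt_mul_of_pos_right hpushed hzs
    have e2 : Real.exp (-(zs * c * h)) ≤ Real.exp (-(zs * csharp * h)) := by
      apply Real.exp_le_exp.2
      have : zs * csharp * h ≤ zs * c * h := by gcongr
      linarith
    have e3 := mul_le_mul_of_nonneg_left e2 hb0.le
    linarith
  have hws : 0 < c * zs := mul_pos hc hzs
  have hcontP := PfP_cont (1 / c ^ 2) (deriv g 0) h
  obtain ⟨l, ⟨hl0, hl1⟩, hPl⟩ : ∃ w ∈ Ioo 0 (c * zs), PfP (1 / c ^ 2) (deriv g 0) h w = 0 :=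
    intermediate_value_Ioo' hws.le hcontP.continuousOn ⟨hPs, hP0⟩
  have hΛs : c * zs < c * lam1 := by
    obtain ⟨W, hWd⟩ : ∃ W, W = max (c * zs + 1) (1 + 2 * c ^ 2) := ⟨_, rfl⟩
    have w1 : c * zs < W := by rw [hWd]; exact lt_of_lt_of_le (by linarith) (le_max_left _ _)
    have w2 : 1 + 2 * c ^ 2 ≤ W := by rw [hWd]; exact le_max_right _ _
    have w3 : 0 < PfP (1 / c ^ 2) (deriv g 0) h W := by
      have q1 : 2 ≤ 1 / c ^ 2 * W := by
        rw [one_div, inv_mul_eq_div, le_div_iff₀ (by positivity)]; linarith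
      have q2 : 1 ≤ W := by nlinarith [sq_nonneg c]
      have q3 : 0 < deriv g 0 * Real.exp (-(W * h)) := by positivity
      unfold PfP
      nlinarith
    obtain ⟨x, ⟨hx0, hx1⟩, hPx⟩ : ∃ w ∈ Ioo (c * zs) W, PfP (1 / c ^ 2) (deriv g 0) h w = 0 :=
      intermediate_value_Ioo w1.le hcontP.continuousOn ⟨hPs, w3⟩
    have hxc : c * (x / c) = x := by field_simp
    have := hlam1_max (x / c) (div_pos (by linarith) hc) (by rw [← pf_chi hc, hxc]; exact hPx)
    rw [div_le_iff₀ hc] at this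
    linarith
  have hlΛ : l < c * lam1 := hl1.trans hΛs
  have hPn : ∀ w, l < w → w < c * lam1 → PfP (1 / c ^ 2) (deriv g 0) h w < 0 := by
    intro w h1 h2
    by_contra hcon
    push Not at hcon
    have t1 := PfP_tangent (a := 1 / c ^ 2) (h := h) hb0.le w l
    have t2 := PfP_tangent (a := 1 / c ^ 2) (h := h) hb0.le w (c * lam1)
    rw [hPl] at t1
    rw [hPΛ] at t2
    have s1 : 0 < 1 / c ^ 2 * (l - w) ^ 2 := mul_pos ha (by have : l - w ≠ 0 := sub_ne_zero.2 h1.ne; positivity)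
    have s2 : 0 < 1 / c ^ 2 * (c * lam1 - w) ^ 2 := mul_pos ha (pow_pos (by linarith) 2)
    rcases le_total 0 (2 * (1 / c ^ 2) * w - 1 - deriv g 0 * Real.exp (-(w * h)) * h) with h3 | h3
    · have := mul_nonneg h3 (by linarith : 0 ≤ c * lam1 - w)
      linarith
    · have := mul_nonneg_of_nonpos_of_nonpos h3 (by linarith : l - w ≤ 0)
      linarith
  have hE : deriv g 0 * Real.exp (-(c * lam1 * h)) * h < 2 * (1 / c ^ 2) * (c * lam1) - 1 := by
    have t1 := PfP_tangent (a := 1 / c ^ 2) (h := h) hb0.le (c * lam1) (c * zs)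
    rw [hPΛ] at t1
    have s1 : 0 ≤ 1 / c ^ 2 * (c * zs - c * lam1) ^ 2 := by positivity
    by_contra hcon
    push Not at hcon
    have := mul_nonneg_of_nonpos_of_nonpos (by linarith : 2 * (1 / c ^ 2) * (c * lam1) - 1 - deriv g 0 * Real.exp (-(c * lam1 * h)) * h ≤ 0)
      (by linarith : c * zs - c * lam1 ≤ 0)
    linarith
  have hno : ∀ a', 1 / c ^ 2 < a' → ¬ ∃ ψ ψ1 ψ2 : ℝ → ℝ, PfF g κ a' h ψ ψ1 ψ2 := by
    rintro a' ha' ⟨ψ, ψ1, ψ2, Fψ⟩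
    have ha'0 := ha.trans ha'
    have h1 := (hcstar (1 / Real.sqrt a')).1 ⟨_, pf_to_wave G.cont ha'0 Fψ⟩
    have h2 : 1 / c < Real.sqrt a' := by
      apply Real.lt_sqrt_of_sq_lt
      rw [div_pow, one_pow]; exact ha'
    have h3 : 1 / Real.sqrt a' < c := by
      rw [div_lt_iff₀ hc] at h2
      rw [div_lt_iff₀ (Real.sqrt_pos.2 ha'0)]; linarith
    linarith
  obtain ⟨A0, σ, C, T0, hA0, hσ, hbd⟩ := F.main G ha hm hh0 hγ2 hK hl0 hlΛ hPl hPΛ hPn hE hno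
  obtain ⟨s0, hs0⟩ : ∃ s0, s0 = -Real.log A0 / lam1 := ⟨_, rfl⟩
  have hAs : ∀ t, A0 * Real.exp (c * lam1 * ((t + s0) / c)) = Real.exp (lam1 * t) := by
    intro t
    have : c * lam1 * ((t + s0) / c) = lam1 * t - Real.log A0 := by
      rw [hs0]; field_simp; ring
    rw [this, Real.exp_sub, Real.exp_log hA0]; field_simp
  have hEs : ∀ t, Real.exp ((c * lam1 + σ) * ((t + s0) / c)) =
      Real.exp ((lam1 + σ / c) * s0) * Real.exp ((lam1 + σ / c) * t) := by
    intro t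
    rw [← Real.exp_add]; congr 1; field_simp; ring
  have hct : ∀ t, c * ((t + s0) / c) = t + s0 := fun t => by field_simp
  refine ⟨s0, σ / c, by positivity, ?_, ?_⟩
  · apply IsBigO.of_bound (C * Real.exp ((lam1 + σ / c) * s0))
    filter_upwards [eventually_le_atBot (c * T0 - s0)] with t ht
    have h1 := (hbd ((t + s0) / c) (by rw [div_le_iff₀ hc]; linarith)).1
    rw [hAs, hEs, hct] at h1
    rw [Real.norm_eq_abs, Real.norm_eq_abs, abs_of_pos (Real.exp_pos _)]
    linarith
  · apply IsBigO.of_bound (C * Real.exp ((lam1 + σ / c) * s0) / c)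
    filter_upwards [eventually_le_atBot (c * T0 - s0)] with t ht
    have h1 := (hbd ((t + s0) / c) (by rw [div_le_iff₀ hc]; linarith)).2
    rw [hAs, hEs, hct] at h1
    rw [Real.norm_eq_abs, Real.norm_eq_abs, abs_of_pos (Real.exp_pos _)]
    have e : c * deriv φ (t + s0) - c * lam1 * Real.exp (lam1 * t) =
      c * (deriv φ (t + s0) - lam1 * Real.exp (lam1 * t)) := by ring
    rw [e, abs_mul, abs_of_pos hc] at h1
    rw [div_mul_eq_mul_div, le_div_iff₀ hc]
    linarith
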